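/- For x > 0 and η > 0, | Σ_{N𝔫 ≤ x} (1/N𝔫)·(1 − N𝔫/x)^{n_K} − κ_K·( log x − Σ_{j=1}^{n_K} 1/j ) − κ_K γ_K | ≪ e^{O_η(n_K)} · ( n_K^{n_K} D_K )^{1/4 + η} · x^{−1/2}, where the sum runs over the nonzero integral ideals 𝔫 of K. -/

import Mathlib

open scoped BigOperators
open Complex NumberField Filter Topology

noncomputable section

namespace RTZ

/-- The degree `n_K = [K : ℚ]` of a number field. -/
def nK (K : Type*) [Field K] [NumberField K] : ℕ := Module.finrank ℚ K

/-- The absolute value `D_K` of the discriminant of `K`. -/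
def DK (K : Type*) [Field K] [NumberField K] : ℕ := (NumberField.discr K).natAbs

/-- An algebraic integer is totally positive if it is positive under every real embedding. -/
def TotPos (K : Type*) [Field K] [NumberField K] (α : 𝓞 K) : Prop :=
  ∀ φ : K →+* ℝ, 0 < φ (algebraMap (𝓞 K) K α)

/-- A Hecke (narrow ray class) character modulo `𝔮`, regarded as a function on integral
ideals extended by zero: it is completely multiplicative, vanishes on ideals not coprime
to `𝔮`, has modulus one on ideals coprime to `𝔮`, and is trivial on principal ideals
generated by totally positive elements `α ≡ 1 (mod 𝔮)`. -/
structure HeckeChar (K : Type*) [Field K] [NumberField K] (𝔮 : Ideal (𝓞 K)) where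
  toFun : Ideal (𝓞 K) → ℂ
  map_mul' : ∀ 𝔞 𝔟 : Ideal (𝓞 K), toFun (𝔞 * 𝔟) = toFun 𝔞 * toFun 𝔟
  eq_zero' : ∀ 𝔞 : Ideal (𝓞 K), ¬ IsCoprime 𝔞 𝔮 → toFun 𝔞 = 0
  norm_one' : ∀ 𝔞 : Ideal (𝓞 K), IsCoprime 𝔞 𝔮 → ‖toFun 𝔞‖ = 1
  ray_one' : ∀ α : 𝓞 K, TotPos K α → α - 1 ∈ 𝔮 → toFun (Ideal.span {α}) = 1

variable {K : Type*} [Field K] [NumberField K]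

/-- The trivial (principal) Hecke character condition. -/
def IsTrivialChar {𝔮 : Ideal (𝓞 K)} (χ : HeckeChar K 𝔮) : Prop :=
  ∀ 𝔞, IsCoprime 𝔞 𝔮 → χ.toFun 𝔞 = 1

open scoped Classical in
/-- `δ(χ)`: the indicator of the trivial character. -/
def delta {𝔮 : Ideal (𝓞 K)} (χ : HeckeChar K 𝔮) : ℝ :=
  if IsTrivialChar χ then 1 else 0

/-- `χ' (mod 𝔣)` induces `χ (mod 𝔮)`: `𝔣 ∣ 𝔮` and the two characters agree on ideals
coprime to `𝔮`. -/
def Induces {𝔣 𝔮 : Ideal (𝓞 K)} (χ' : HeckeChar K 𝔣) (χ : HeckeChar K 𝔮) : Prop :=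
  𝔮 ≤ 𝔣 ∧ ∀ 𝔞, IsCoprime 𝔞 𝔮 → χ.toFun 𝔞 = χ'.toFun 𝔞

/-- `𝔣` is the conductor `𝔣_χ` of `χ`: `χ` is induced from a character mod `𝔣`, and `𝔣`
divides every modulus from which `χ` is induced. -/
def IsConductor {𝔮 : Ideal (𝓞 K)} (χ : HeckeChar K 𝔮) (𝔣 : Ideal (𝓞 K)) : Prop :=
  (∃ χ' : HeckeChar K 𝔣, Induces χ' χ) ∧
    ∀ 𝔣' : Ideal (𝓞 K), (∃ χ' : HeckeChar K 𝔣', Induces χ' χ) → 𝔣' ≤ 𝔣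

/-- A Hecke character is primitive if its conductor equals its modulus. -/
def IsPrimitiveChar {𝔮 : Ideal (𝓞 K)} (χ : HeckeChar K 𝔮) : Prop := IsConductor χ 𝔮

/-- Two integral ideals lie in the same narrow ray class mod `𝔮`: `(α)𝔞 = (β)𝔟` for some
totally positive `α, β ≡ 1 (mod 𝔮)`. -/
def rayEquiv (𝔮 𝔞 𝔟 : Ideal (𝓞 K)) : Prop :=
  ∃ α β : 𝓞 K, TotPos K α ∧ TotPos K β ∧ α - 1 ∈ 𝔮 ∧ β - 1 ∈ 𝔮 ∧
    Ideal.span {α} * 𝔞 = Ideal.span {β} * 𝔟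

/-- A congruence class group `H (mod 𝔮)`: a subgroup of `I(𝔮)` containing `P_𝔮`, described
by the set of integral ideals whose narrow ray class lies in the subgroup. -/
structure CongClassGroup (K : Type*) [Field K] [NumberField K] (𝔮 : Ideal (𝓞 K)) where
  mem : Ideal (𝓞 K) → Prop
  coprime' : ∀ 𝔞, mem 𝔞 → IsCoprime 𝔞 𝔮
  princ_mem' : ∀ α : 𝓞 K, TotPos K α → α - 1 ∈ 𝔮 → mem (Ideal.span {α})
  mul_mem' : ∀ 𝔞 𝔟, mem 𝔞 → mem 𝔟 → mem (𝔞 * 𝔟)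
  class_mem' : ∀ 𝔞 𝔟, IsCoprime 𝔟 𝔮 → rayEquiv 𝔮 𝔞 𝔟 → mem 𝔞 → mem 𝔟

/-- `χ(H) = 1`: the character is trivial on the congruence class group `H`. -/
def CharTrivOn {𝔮 : Ideal (𝓞 K)} (χ : HeckeChar K 𝔮) (H : CongClassGroup K 𝔮) : Prop :=
  ∀ 𝔞, H.mem 𝔞 → χ.toFun 𝔞 = 1

/-- The coset of `H` in `I(𝔮)` determined by an integral ideal `𝔞₀`. -/
def coset {𝔮 : Ideal (𝓞 K)} (H : CongClassGroup K 𝔮) (𝔞₀ : Ideal (𝓞 K)) :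
    Set (Ideal (𝓞 K)) :=
  {𝔞 | ∃ 𝔥, H.mem 𝔥 ∧ rayEquiv 𝔮 (𝔞₀ * 𝔥) 𝔞}

/-- `h_H = [I(𝔮) : H]`, the number of cosets of `H`. -/
def hH {𝔮 : Ideal (𝓞 K)} (H : CongClassGroup K 𝔮) : ℕ :=
  Nat.card {C : Set (Ideal (𝓞 K)) // ∃ 𝔞₀, IsCoprime 𝔞₀ 𝔮 ∧ C = coset H 𝔞₀}

/-- `Q = Q_H = max { N𝔣_χ : χ (mod 𝔮), χ(H) = 1 }`. -/
def QH {𝔮 : Ideal (𝓞 K)} (H : CongClassGroup K 𝔮) : ℕ :=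
  sSup {n | ∃ (χ : HeckeChar K 𝔮) (𝔣 : Ideal (𝓞 K)),
    CharTrivOn χ H ∧ IsConductor χ 𝔣 ∧ n = Ideal.absNorm 𝔣}

/-- `𝔣_H = lcm { 𝔣_χ : χ(H) = 1 }` (the lcm of ideals is their infimum). -/
def fH {𝔮 : Ideal (𝓞 K)} (H : CongClassGroup K 𝔮) : Ideal (𝓞 K) :=
  sInf {𝔣 | ∃ χ : HeckeChar K 𝔮, CharTrivOn χ H ∧ IsConductor χ 𝔣}

/-- A congruence class group `H (mod 𝔮)` is primitive if `𝔮 = 𝔣_H`. -/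
def IsPrimitiveCCG {𝔮 : Ideal (𝓞 K)} (H : CongClassGroup K 𝔮) : Prop := 𝔮 = fH H

/-- The Dirichlet series `Σ_𝔫 χ(𝔫) N𝔫^{-s}` of a Hecke character. -/
def LSer {𝔮 : Ideal (𝓞 K)} (χ : HeckeChar K 𝔮) (s : ℂ) : ℂ :=
  ∑' 𝔞 : {I : Ideal (𝓞 K) // I ≠ ⊥}, χ.toFun 𝔞.1 * (Ideal.absNorm 𝔞.1 : ℂ) ^ (-s)

/-- `L` is "the" Hecke `L`-function of `χ`: analytic away from `s = 1` and given by the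
Dirichlet series on `Re s > 1` (this determines `L` away from `s = 1`). -/
def IsLFun {𝔮 : Ideal (𝓞 K)} (χ : HeckeChar K 𝔮) (L : ℂ → ℂ) : Prop :=
  (∀ s : ℂ, s ≠ 1 → DifferentiableAt ℂ L s) ∧ ∀ s : ℂ, 1 < s.re → L s = LSer χ s

/-- The Dedekind zeta series of `K`. -/
def zetaSer (K : Type*) [Field K] [NumberField K] (s : ℂ) : ℂ :=
  ∑' 𝔞 : {I : Ideal (𝓞 K) // I ≠ ⊥}, (Ideal.absNorm 𝔞.1 : ℂ) ^ (-s)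

/-- `Z` is "the" Dedekind zeta function of `K`. -/
def IsZetaFun (K : Type*) [Field K] [NumberField K] (Z : ℂ → ℂ) : Prop :=
  (∀ s : ℂ, s ≠ 1 → DifferentiableAt ℂ Z s) ∧ ∀ s : ℂ, 1 < s.re → Z s = zetaSer K s

/-- `L` vanishes at `ρ` to order at least `m`. -/
def ZeroOrderAtLeast (L : ℂ → ℂ) (ρ : ℂ) (m : ℕ) : Prop :=
  ∃ g : ℂ → ℂ, AnalyticAt ℂ g ρ ∧ ∀ᶠ z in nhds ρ, L z = (z - ρ) ^ m * g z

/-- `L` vanishes at `ρ` to order exactly `m`. -/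
def ZeroOrderExact (L : ℂ → ℂ) (ρ : ℂ) (m : ℕ) : Prop :=
  ∃ g : ℂ → ℂ, AnalyticAt ℂ g ρ ∧ g ρ ≠ 0 ∧ ∀ᶠ z in nhds ρ, L z = (z - ρ) ^ m * g z

open scoped Classical in
/-- The von Mangoldt function `Λ_K` of the field `K`. -/
def ΛK (K : Type*) [Field K] [NumberField K] (𝔫 : Ideal (𝓞 K)) : ℝ :=
  if h : ∃ (𝔭 : Ideal (𝓞 K)) (k : ℕ), 𝔭.IsPrime ∧ 𝔭 ≠ ⊥ ∧ 1 ≤ k ∧ 𝔫 = 𝔭 ^ k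
  then Real.log (Ideal.absNorm h.choose) else 0

/-- The residue `κ_K` of `ζ_K` at `s = 1`, characterized as a limit of the real Dirichlet
series. -/
def IsResidue (K : Type*) [Field K] [NumberField K] (κ : ℝ) : Prop :=
  Filter.Tendsto (fun σ : ℝ => (σ - 1) *
      ∑' 𝔞 : {I : Ideal (𝓞 K) // I ≠ ⊥}, (Ideal.absNorm 𝔞.1 : ℝ) ^ (-σ))
    (nhdsWithin 1 (Set.Ioi 1)) (nhds κ)

/-- `γ_K`, the Euler–Kronecker constant: `ζ_K(s) - κ_K/(s-1) → κ_K γ_K` as `s → 1⁺`. -/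
def IsEulerKronecker (K : Type*) [Field K] [NumberField K] (κ γK : ℝ) : Prop :=
  Filter.Tendsto (fun σ : ℝ =>
      (∑' 𝔞 : {I : Ideal (𝓞 K) // I ≠ ⊥}, (Ideal.absNorm 𝔞.1 : ℝ) ^ (-σ)) - κ / (σ - 1))
    (nhdsWithin 1 (Set.Ioi 1)) (nhds (κ * γK))

section Poisson

open MeasureTheory
open scoped ENNReal

theorem ennreal_tsum_fin_prod {α : Type*} (f : α → ℝ≥0∞) (n : ℕ) :
    ∑' m : Fin n → α, ∏ i, f (m i) = (∑' a, f a) ^ n := by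
  induction n with
  | zero => simp [tsum_fintype]
  | succ n ih =>
    rw [← (Fin.consEquiv (fun _ : Fin (n + 1) => α)).tsum_eq]
    simp only [Fin.consEquiv_apply, Fin.prod_univ_succ, Fin.cons_zero, Fin.cons_succ]
    rw [ENNReal.tsum_prod (f := fun a (m : Fin n → α) => f a * ∏ i, f (m i))]
    simp_rw [ENNReal.tsum_mul_left]
    rw [ih, ENNReal.tsum_mul_right, pow_succ']

theorem ennreal_tsum_pi_prod {ι α : Type*} [Fintype ι] (f : α → ℝ≥0∞) :
    ∑' m : ι → α, ∏ i, f (m i) = (∑' a, f a) ^ Fintype.card ι := by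
  classical
  rw [← ennreal_tsum_fin_prod, ← ((Fintype.equivFin ι).arrowCongr (Equiv.refl α)).tsum_eq]
  refine tsum_congr fun m => ?_
  rw [← (Fintype.equivFin ι).prod_comp]
  simp

theorem summable_pi_prod {ι α : Type*} [Fintype ι] {f : α → ℝ} (hf0 : ∀ a, 0 ≤ f a)
    (hf : Summable f) : Summable fun m : ι → α => ∏ i, f (m i) := by
  have h : ∑' m : ι → α, ENNReal.ofReal (∏ i, f (m i)) ≠ ∞ := by
    simp_rw [ENNReal.ofReal_prod_of_nonneg (fun i _ => hf0 _)]
    rw [ennreal_tsum_pi_prod (fun a => ENNReal.ofReal (f a))]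
    exact ENNReal.pow_ne_top hf.tsum_ofReal_ne_top
  refine (ENNReal.summable_toReal h).congr fun m => ?_
  rw [ENNReal.toReal_ofReal (Finset.prod_nonneg fun i _ => hf0 _)]

theorem summable_int_exp_neg_sq {c : ℝ} (hc : 0 < c) :
    Summable fun m : ℤ => Real.exp (-c * (m : ℝ) ^ 2) := by
  have key : Summable fun m : ℕ => Real.exp (-c * (m : ℝ) ^ 2) := by
    refine Summable.of_nonneg_of_le (fun _ => (Real.exp_pos _).le) (fun m => ?_)
      (Real.summable_exp_nat_mul_iff.mpr (neg_lt_zero.mpr hc))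
    apply Real.exp_le_exp.mpr
    have : (m : ℝ) ≤ (m : ℝ) ^ 2 := by exact_mod_cast Nat.le_self_pow two_ne_zero m
    nlinarith
  refine Summable.of_nat_of_neg ?_ ?_
  · simpa using key
  · simpa using key

theorem summable_pi_exp_neg_sq {ι : Type*} [Fintype ι] {c : ℝ} (hc : 0 < c) :
    Summable fun m : ι → ℤ => Real.exp (-c * ∑ i, (m i : ℝ) ^ 2) := by
  refine (summable_pi_prod (ι := ι) (fun m : ℤ => (Real.exp_pos _).le)
    (summable_int_exp_neg_sq hc)).congr fun m => ?_
  rw [← Real.exp_sum, Finset.mul_sum]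

theorem half_sq_sub_sq_le {ι : Type*} [Fintype ι] (x m : ι → ℝ) :
    (∑ i, m i ^ 2) / 2 - ∑ i, x i ^ 2 ≤ ∑ i, (x i + m i) ^ 2 := by
  rw [Finset.sum_div, ← Finset.sum_sub_distrib]
  refine Finset.sum_le_sum fun i _ => ?_
  nlinarith [sq_nonneg (2 * x i + m i)]

/-- Poisson summation over `ℤ^ι` for a continuous function with Gaussian decay. -/
theorem poisson_summation_pi {ι : Type*} [Fintype ι] (f : (ι → ℝ) → ℂ) (hf : Continuous f)
    {C c : ℝ} (hc : 0 < c) (hbound : ∀ x, ‖f x‖ ≤ C * Real.exp (-c * ∑ i, x i ^ 2))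
    (fhat : (ι → ℤ) → ℂ)
    (hfhat : ∀ k, ∫ x : ι → ℝ, Complex.exp (-2 * Real.pi * I * ∑ i, (k i : ℂ) * x i) * f x = fhat k)
    (hs : Summable fhat) :
    ∑' m : ι → ℤ, f (fun i => m i) = ∑' k, fhat k := by
  classical
  have hC : 0 ≤ C := by
    have := (norm_nonneg _).trans (hbound 0)
    simpa using this
  set tr : (ι → ℤ) → (ι → ℝ) → (ι → ℝ) := fun m x i => x i + m i with htr
  have htrc : ∀ m, Continuous (tr m) := fun m => by
    refine continuous_pi fun i => ?_
    exact (continuous_apply i).add continuous_const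
  set u : ℝ → (ι → ℤ) → ℝ := fun R m =>
    C * Real.exp (c * (Fintype.card ι * R ^ 2)) * Real.exp (-(c / 2) * ∑ i, (m i : ℝ) ^ 2) with hu
  have husum : ∀ R, Summable (u R) := fun R => (summable_pi_exp_neg_sq (half_pos hc)).mul_left _
  have hle : ∀ R m x, ‖x‖ ≤ R → ‖f (tr m x)‖ ≤ u R m := by
    intro R m x hx
    refine (hbound _).trans ?_
    rw [hu]
    simp only
    rw [mul_assoc, ← Real.exp_add]
    refine mul_le_mul_of_nonneg_left (Real.exp_le_exp.mpr ?_) hC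
    have h1 := half_sq_sub_sq_le x (fun i => (m i : ℝ))
    have h2 : ∑ i, x i ^ 2 ≤ Fintype.card ι * R ^ 2 := by
      calc ∑ i, x i ^ 2 ≤ ∑ _i : ι, R ^ 2 := by
            refine Finset.sum_le_sum fun i _ => ?_
            have h3 : |x i| ≤ R := (norm_le_pi_norm x i).trans hx
            exact sq_le_sq' (by linarith [abs_le.mp h3]) (abs_le.mp h3).2
        _ = _ := by simp
    simp only [htr]
    nlinarith [mul_le_mul_of_nonneg_left h1 hc.le, mul_le_mul_of_nonneg_left h2 hc.le]
  set F : (ι → ℝ) → ℂ := fun x => ∑' m, f (tr m x) with hF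
  have hFc : Continuous F := by
    rw [continuous_iff_continuousAt]
    intro x
    have h1 : ContinuousOn F (Metric.ball 0 (‖x‖ + 1)) := by
      refine continuousOn_tsum (fun m => (hf.comp (htrc m)).continuousOn) (husum (‖x‖ + 1)) ?_
      intro m y hy
      refine hle _ m y ?_
      rw [mem_ball_zero_iff] at hy
      exact hy.le
    exact h1.continuousAt (Metric.isOpen_ball.mem_nhds (by simp))
  have hFper : ∀ x (k : ι → ℤ), F (tr k x) = F x := by
    intro x k
    rw [hF]
    simp only
    rw [← (Equiv.addLeft k).tsum_eq (fun m => f (tr m x))]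
    refine tsum_congr fun m => ?_
    congr 1
    funext i
    simp [htr]
    ring
  set p : (ι → ℝ) → UnitAddTorus ι := fun x i => (x i : UnitAddCircle) with hp
  have hpq : IsOpenQuotientMap p :=
    IsOpenQuotientMap.piMap (f := fun (_ : ι) (x : ℝ) => (x : UnitAddCircle))
      fun i => QuotientAddGroup.isOpenQuotientMap_mk
  have hcompat : ∀ a b, p a = p b → F a = F b := by
    intro a b hab
    have : ∀ i, ∃ k : ℤ, a i = b i + k := by
      intro i
      have h := congrFun hab i
      simp only [hp] at h
      rw [QuotientAddGroup.eq_iff_sub_mem, AddSubgroup.mem_zmultiples_iff] at h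
      obtain ⟨k, hk⟩ := h
      refine ⟨k, ?_⟩
      rw [zsmul_one] at hk
      linarith
    choose k hk using this
    have : a = tr k b := funext hk
    rw [this, hFper]
  have hsurj : Function.Surjective p := hpq.surjective
  have hGp : ∀ x, F (Function.surjInv hsurj (p x)) = F x := fun x =>
    hcompat _ _ (Function.surjInv_eq hsurj (p x))
  let G : C(UnitAddTorus ι, ℂ) := ⟨fun t => F (Function.surjInv hsurj t), by
    rw [hpq.isQuotientMap.continuous_iff]
    exact hFc.congr fun x => (hGp x).symm⟩
  have hG : ∀ x, G (p x) = F x := hGp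
  set Q : Set (ι → ℝ) := {x | ∀ i, x i ∈ Set.Ioc (0 : ℝ) (0 + 1)} with hQ
  have hQpi : Q = Set.univ.pi fun _ => Set.Ioc (0 : ℝ) (0 + 1) := by
    ext x; simp [hQ]
  have hQm : MeasurableSet Q := by
    rw [hQpi]; exact MeasurableSet.univ_pi fun i => measurableSet_Ioc
  have hQv : volume Q = 1 := by
    rw [hQpi, Real.volume_pi_Ioc]; simp
  have hQb : ∀ x ∈ Q, ‖x‖ ≤ 1 := by
    intro x hx
    rw [pi_norm_le_iff_of_nonneg zero_le_one]
    intro i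
    have := hx i
    rw [zero_add] at this
    rw [Real.norm_eq_abs, abs_of_pos this.1]
    exact this.2
  have hcoeff : ∀ k, UnitAddTorus.mFourierCoeff G k = fhat k := by
    intro k
    set e : (ι → ℝ) → ℂ := fun x => Complex.exp (-2 * Real.pi * I * ∑ i, (k i : ℂ) * x i) with he
    have hec : Continuous e := by fun_prop
    have henorm : ∀ x, ‖e x‖ = 1 := by
      intro x
      have : e x = Complex.exp ((-2 * Real.pi * ∑ i, (k i : ℝ) * x i : ℝ) * I) := by
        simp only [he]; push_cast; congr 1; ring
      rw [this, Complex.norm_exp_ofReal_mul_I]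
    have heF : ∀ x, UnitAddTorus.mFourier (-k) (p x) = e x := by
      intro x
      simp only [UnitAddTorus.mFourier, ContinuousMap.coe_mk, he, hp, fourier_coe_apply]
      rw [← Complex.exp_sum, Finset.mul_sum]
      congr 1
      refine Finset.sum_congr rfl fun i _ => ?_
      push_cast [Pi.neg_apply]
      simp
      ring
    have heper : ∀ (m : ι → ℤ) x, e (tr m x) = e x := by
      intro m x
      rw [← heF, ← heF]
      congr 1
      funext i
      simp only [hp, htr]
      rw [QuotientAddGroup.eq_iff_sub_mem, AddSubgroup.mem_zmultiples_iff]
      exact ⟨m i, by simp⟩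
    have hbc : ∀ m, Continuous fun x => e (tr m x) * f (tr m x) := fun m =>
      (hec.comp (htrc m)).mul (hf.comp (htrc m))
    have hnb : ∀ m, ∀ x ∈ Q, ‖e (tr m x) * f (tr m x)‖ ≤ u 1 m := by
      intro m x hx
      rw [norm_mul, henorm, one_mul]
      exact hle 1 m x (hQb x hx)
    have h_int : ∀ m, IntegrableOn (fun x => e (tr m x) * f (tr m x)) Q := by
      intro m
      refine IntegrableOn.of_bound (by simp [hQv]) (hbc m).aestronglyMeasurable (u 1 m) ?_
      exact (ae_restrict_iff' hQm).mpr (Eventually.of_forall (hnb m))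
    rw [UnitAddTorus.mFourierCoeff_eq_integral (G : UnitAddTorus ι → ℂ) k 0, ← hfhat]
    simp only [Pi.zero_apply]
    have h1 : ∫ x in Q, UnitAddTorus.mFourier (-k) (p x) • G (p x) =
        ∑' m, ∫ x in Q, e (tr m x) * f (tr m x) := by
      rw [integral_tsum_of_summable_integral_norm h_int]
      · refine setIntegral_congr_fun hQm fun x hx => ?_
        simp only [heF, hG, heper, smul_eq_mul, hF]
        rw [tsum_mul_left]
      · refine Summable.of_nonneg_of_le (fun m => integral_nonneg fun _ => norm_nonneg _)
          (fun m => ?_) (husum 1)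
        have := setIntegral_mono_on (h_int m).norm (integrableOn_const (by simp [hQv])) hQm (hnb m)
        simpa [Measure.real, hQv] using this
    refine h1.trans ?_
    have hQu : (⋃ m, tr m '' Q) = Set.univ := by
      refine Set.eq_univ_of_forall fun y => Set.mem_iUnion.mpr ?_
      refine ⟨fun i => ⌈y i⌉ - 1, fun i => y i - (⌈y i⌉ - 1), fun i => ?_, ?_⟩
      · constructor
        · have := Int.ceil_lt_add_one (y i); linarith
        · have := Int.le_ceil (y i); linarith
      · funext i; simp [htr]
    have hinj : ∀ m, Function.Injective (tr m) := by
      intro m x y hxy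
      funext i
      have := congrFun hxy i
      simpa [htr] using this
    have hdisj : Pairwise (Function.onFun Disjoint fun m => tr m '' Q) := by
      intro m m' hmm
      rw [Function.onFun, Set.disjoint_left]
      rintro _ ⟨x, hx, rfl⟩ ⟨y, hy, hxy⟩
      apply hmm
      funext i
      have h2 := congrFun hxy i
      simp only [htr] at h2
      have hxi := hx i
      have hyi := hy i
      have h3 : (m i : ℝ) - m' i < 1 := by linarith [hxi.1, hyi.2]
      have h4 : (m' i : ℝ) - m i < 1 := by linarith [hyi.1, hxi.2]
      have h5 : m i - m' i < 1 := by exact_mod_cast h3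
      have h6 : m' i - m i < 1 := by exact_mod_cast h4
      omega
    have htrmp : ∀ m, MeasurePreserving (tr m) volume volume := by
      intro m
      exact measurePreserving_add_right volume (fun i => (m i : ℝ))
    have hemb : ∀ m, MeasurableEmbedding (tr m) := by
      intro m
      exact measurableEmbedding_addRight (fun i => (m i : ℝ))
    have hfi : Integrable fun x => e x * f x := by
      have hg : Integrable fun x : ι → ℝ => C * Real.exp (-c * ∑ i, x i ^ 2) := by
        refine Integrable.const_mul ?_ C
        have : (fun x : ι → ℝ => Real.exp (-c * ∑ i, x i ^ 2)) =
            fun x => ∏ i, Real.exp (-c * x i ^ 2) := by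
          funext x
          rw [← Real.exp_sum, Finset.mul_sum]
        rw [this]
        exact Integrable.fintype_prod (f := fun _ y => Real.exp (-c * y ^ 2))
          fun _ => integrable_exp_neg_mul_sq hc
      refine hg.mono' (hec.mul hf).aestronglyMeasurable (Eventually.of_forall fun x => ?_)
      rw [norm_mul, henorm, one_mul]
      exact hbound x
    rw [← setIntegral_univ, ← hQu, integral_iUnion (fun m => (hemb m).measurableSet_image.mpr hQm)
      hdisj hfi.integrableOn]
    refine tsum_congr fun m => ?_
    rw [(htrmp m).setIntegral_image_emb (hemb m)]
  have hsum : Summable (UnitAddTorus.mFourierCoeff G) := by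
    rw [funext hcoeff]; exact hs
  have := (UnitAddTorus.hasSum_mFourier_series_apply_of_summable hsum (p 0)).tsum_eq
  rw [hG] at this
  simp only [hcoeff] at this
  have h0 : ∀ k, UnitAddTorus.mFourier k (p 0) = 1 := by
    intro k
    simp [UnitAddTorus.mFourier, hp]
  simp only [h0, smul_eq_mul, mul_one] at this
  rw [this, hF]
  simp [htr]

end Poisson

section GaussianTheta
open MeasureTheory
variable {ι : Type*} [Fintype ι] [DecidableEq ι]

lemma exists_lower_bound_mulVec (A : Matrix ι ι ℝ) (hA : IsUnit A.det) :
    ∃ c : ℝ, 0 < c ∧ ∀ x : ι → ℝ, c * ∑ i, x i ^ 2 ≤ ∑ i, (A.mulVec x i) ^ 2 := by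
  set B := A⁻¹ with hB
  set S : ℝ := ∑ i, ∑ j, B i j ^ 2 with hS
  have hS0 : 0 ≤ S := by positivity
  have key : ∀ y : ι → ℝ, ∑ i, (B.mulVec y i) ^ 2 ≤ S * ∑ i, y i ^ 2 := by
    intro y
    rw [hS, Finset.sum_mul]
    refine Finset.sum_le_sum fun i _ => ?_
    exact Finset.sum_mul_sq_le_sq_mul_sq _ _ _
  refine ⟨(S + 1)⁻¹, by positivity, fun x => ?_⟩
  have h := key (A.mulVec x)
  rw [Matrix.mulVec_mulVec, hB, Matrix.nonsing_inv_mul _ hA, Matrix.one_mulVec] at h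
  rw [inv_mul_le_iff₀ (by positivity)]
  have : 0 ≤ ∑ i, (A.mulVec x i) ^ 2 := by positivity
  nlinarith

lemma integral_fourier_gaussian_matrix (A : Matrix ι ι ℝ) (hA : IsUnit A.det) (k : ι → ℤ) :
    ∫ x : ι → ℝ, Complex.exp (-2 * Real.pi * I * ∑ i, (k i : ℂ) * x i) *
      ((Real.exp (-Real.pi * ∑ i, (A.mulVec x i) ^ 2) : ℝ) : ℂ) =
    ((|A.det|⁻¹ * Real.exp (-Real.pi * ∑ i, ((A⁻¹).transpose.mulVec (fun j => (k j : ℝ)) i) ^ 2)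
      : ℝ) : ℂ) := by
  set d : ι → ℝ := (A⁻¹).transpose.mulVec (fun j => (k j : ℝ)) with hd
  set g : (ι → ℝ) → ℂ := fun y => Complex.exp (-(Real.pi : ℂ) * ∑ i, (y i : ℂ) ^ 2 +
    ∑ i, (-2 * Real.pi * I * d i) * (y i : ℂ)) with hg
  have hgc : Continuous g := by rw [hg]; fun_prop
  have hfg : ∀ x : ι → ℝ, Complex.exp (-2 * Real.pi * I * ∑ i, (k i : ℂ) * x i) *
      ((Real.exp (-Real.pi * ∑ i, (A.mulVec x i) ^ 2) : ℝ) : ℂ) = g (A.mulVec x) := by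
    intro x
    have h1 : ∑ i, (k i : ℝ) * x i = ∑ i, d i * A.mulVec x i := by
      change (fun j => (k j : ℝ)) ⬝ᵥ x = d ⬝ᵥ A.mulVec x
      rw [Matrix.dotProduct_mulVec, hd, ← Matrix.mulVec_transpose, Matrix.mulVec_mulVec,
        ← Matrix.transpose_mul, Matrix.nonsing_inv_mul _ hA, Matrix.transpose_one,
        Matrix.one_mulVec]
    have h2 : ∑ i, (k i : ℂ) * (x i : ℂ) = ∑ i, (d i : ℂ) * (A.mulVec x i : ℂ) := by
      exact_mod_cast h1
    rw [h2, hg]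
    push_cast
    rw [← Complex.exp_add]
    congr 1
    rw [add_comm, Finset.mul_sum _ _ (-2 * Real.pi * I)]
    simp only [mul_assoc]
  simp_rw [hfg]
  have hdet : A.det ≠ 0 := hA.ne_zero
  have hmap := Real.map_matrix_volume_pi_eq_smul_volume_pi hdet
  have h3 : ∫ x : ι → ℝ, g (A.mulVec x) =
      ∫ y, g y ∂(Measure.map (Matrix.toLin' A) volume) := by
    rw [integral_map]
    · simp
    · exact (LinearMap.continuous_of_finiteDimensional _).aemeasurable
    · exact hgc.aestronglyMeasurable
  rw [h3, hmap, integral_smul_measure, hg]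
  rw [GaussianFourier.integral_cexp_neg_mul_sum_add (by simpa using Real.pi_pos)]
  have hpi : (Real.pi : ℂ) ≠ 0 := by exact_mod_cast Real.pi_ne_zero
  rw [div_self hpi, Complex.one_cpow, one_mul, ENNReal.toReal_ofReal (abs_nonneg _), abs_inv]
  push_cast
  rw [Complex.real_smul]
  push_cast
  congr 2
  rw [Finset.mul_sum, Finset.sum_div]
  refine Finset.sum_congr rfl fun i _ => ?_
  field_simp
  ring_nf
  simp only [I_sq]
  ring

lemma summable_gaussian_matrix (A : Matrix ι ι ℝ) (hA : IsUnit A.det) :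
    Summable fun m : ι → ℤ =>
      Real.exp (-Real.pi * ∑ i, (A.mulVec (fun j => (m j : ℝ)) i) ^ 2) := by
  obtain ⟨c, hc, h⟩ := exists_lower_bound_mulVec A hA
  refine Summable.of_nonneg_of_le (fun _ => by positivity) (fun m => ?_)
    (summable_pi_exp_neg_sq (ι := ι) (c := Real.pi * c) (by positivity))
  apply Real.exp_le_exp.mpr
  have := h (fun j => (m j : ℝ))
  have hp := Real.pi_pos
  nlinarith

lemma theta_matrix (A : Matrix ι ι ℝ) (hA : IsUnit A.det) :
    ∑' m : ι → ℤ, Real.exp (-Real.pi * ∑ i, (A.mulVec (fun j => (m j : ℝ)) i) ^ 2) =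
    |A.det|⁻¹ * ∑' m : ι → ℤ, Real.exp (-Real.pi *
      ∑ i, ((A⁻¹).transpose.mulVec (fun j => (m j : ℝ)) i) ^ 2) := by
  obtain ⟨c, hc, h⟩ := exists_lower_bound_mulVec A hA
  have hA' : IsUnit (A⁻¹).transpose.det := by
    rw [Matrix.det_transpose]; exact Matrix.isUnit_nonsing_inv_det A hA
  have hP := poisson_summation_pi (ι := ι)
    (fun x => ((Real.exp (-Real.pi * ∑ i, (A.mulVec x i) ^ 2) : ℝ) : ℂ))
    (by
      have : Continuous fun x : ι → ℝ => A.mulVec x := by fun_prop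
      fun_prop) (C := 1) (c := Real.pi * c) (by positivity)
    (fun x => by
      rw [Complex.norm_real, Real.norm_of_nonneg (by positivity), one_mul]
      apply Real.exp_le_exp.mpr
      have := h x
      have hp := Real.pi_pos
      nlinarith)
    _ (fun k => integral_fourier_gaussian_matrix A hA k)
    (by
      have := (summable_gaussian_matrix _ hA').mul_left |A.det|⁻¹
      exact_mod_cast this)
  rw [← tsum_mul_left]
  exact_mod_cast hP

lemma sum_sq_mulVec_eq (A : Matrix ι ι ℝ) (x : ι → ℝ) :
    ∑ i, (A.mulVec x i) ^ 2 = x ⬝ᵥ (A.transpose * A).mulVec x := by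
  rw [← Matrix.mulVec_mulVec, Matrix.dotProduct_mulVec, Matrix.vecMul_transpose]
  simp [dotProduct, sq]

lemma exists_matrix_of_posDef {M : Matrix ι ι ℝ} (hM : M.PosDef) :
    ∃ A : Matrix ι ι ℝ, IsUnit A.det ∧ M = A.transpose * A := by
  obtain ⟨A, hA⟩ : ∃ A : Matrix ι ι ℝ, M = A.transpose * A := by
    open scoped MatrixOrder in
    obtain ⟨A, hA⟩ := CStarAlgebra.nonneg_iff_eq_star_mul_self.mp hM.posSemidef.nonneg
    exact ⟨A, by simpa [Matrix.star_eq_conjTranspose] using hA⟩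
  refine ⟨A, ?_, hA⟩
  have := hM.det_pos
  rw [hA, Matrix.det_mul] at this
  exact isUnit_iff_ne_zero.mpr (right_ne_zero_of_mul this.ne')

lemma summable_theta_posDef {M : Matrix ι ι ℝ} (hM : M.PosDef) :
    Summable fun m : ι → ℤ =>
      Real.exp (-Real.pi * ((fun j => (m j : ℝ)) ⬝ᵥ M.mulVec (fun j => (m j : ℝ)))) := by
  obtain ⟨A, hA, rfl⟩ := exists_matrix_of_posDef hM
  simpa only [sum_sq_mulVec_eq] using summable_gaussian_matrix A hA

lemma theta_posDef {M : Matrix ι ι ℝ} (hM : M.PosDef) :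
    ∑' m : ι → ℤ,
      Real.exp (-Real.pi * ((fun j => (m j : ℝ)) ⬝ᵥ M.mulVec (fun j => (m j : ℝ)))) =
    (Real.sqrt M.det)⁻¹ * ∑' m : ι → ℤ,
      Real.exp (-Real.pi * ((fun j => (m j : ℝ)) ⬝ᵥ M⁻¹.mulVec (fun j => (m j : ℝ)))) := by
  obtain ⟨A, hA, rfl⟩ := exists_matrix_of_posDef hM
  have h := theta_matrix A hA
  simp only [sum_sq_mulVec_eq] at h
  rw [h, Matrix.det_mul, Matrix.det_transpose, Real.sqrt_mul_self_eq_abs, Matrix.mul_inv_rev,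
    Matrix.transpose_transpose, Matrix.transpose_nonsing_inv]

end GaussianTheta

section ThetaForm
open Module

/-- The quadratic form `∑_w m_w t_w |a|_w²` on a number field. -/
def quadForm (t : InfinitePlace K → ℝ) (a : K) : ℝ :=
  ∑ w : InfinitePlace K, (w.mult : ℝ) * t w * (w a) ^ 2

lemma sum_embeddings_eq_sum_places (f : InfinitePlace K → ℝ) :
    ∑ φ : K →+* ℂ, f (InfinitePlace.mk φ) = ∑ w : InfinitePlace K, (w.mult : ℝ) * f w := by
  classical
  rw [← Finset.sum_fiberwise Finset.univ (fun φ : K →+* ℂ => InfinitePlace.mk φ)]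
  refine Finset.sum_congr rfl fun w _ => ?_
  rw [Finset.sum_congr rfl (g := fun _ => f w)
    (fun φ hφ => by rw [(Finset.mem_filter.mp hφ).2]), Finset.sum_const,
    InfinitePlace.card_filter_mk_eq, nsmul_eq_mul]

lemma prod_embeddings_eq_prod_places (f : InfinitePlace K → ℝ) :
    ∏ φ : K →+* ℂ, f (InfinitePlace.mk φ) = ∏ w : InfinitePlace K, f w ^ w.mult := by
  classical
  rw [← Finset.prod_fiberwise Finset.univ (fun φ : K →+* ℂ => InfinitePlace.mk φ)]
  refine Finset.prod_congr rfl fun w _ => ?_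
  rw [Finset.prod_congr rfl (g := fun _ => f w)
    (fun φ hφ => by rw [(Finset.mem_filter.mp hφ).2]), Finset.prod_const,
    InfinitePlace.card_filter_mk_eq]

lemma quadForm_eq_sum_embeddings (t : InfinitePlace K → ℝ) (a : K) :
    quadForm t a = ∑ φ : K →+* ℂ, t (InfinitePlace.mk φ) * ‖φ a‖ ^ 2 := by
  have := sum_embeddings_eq_sum_places (K := K) (fun w => t w * (w a) ^ 2)
  simp only [InfinitePlace.apply] at this
  rw [this, quadForm]
  simp [mul_assoc]

lemma trace_eq_sum_ringHom (x : K) :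
    ((Algebra.trace ℚ K x : ℚ) : ℂ) = ∑ φ : K →+* ℂ, φ x := by
  have h := trace_eq_sum_embeddings (K := ℚ) (L := K) ℂ (x := x)
  rw [eq_ratCast] at h
  rw [h]
  exact Fintype.sum_equiv (RingHom.equivRatAlgHom (R := K) (S := ℂ)).symm _ _ (fun _ => rfl)

/-- The Gram matrix of `quadForm t` in a basis. -/
def formMatrix {ι : Type*} (t : InfinitePlace K → ℝ) (b : ι → K) : Matrix ι ι ℝ :=
  fun i j => ∑ φ : K →+* ℂ, t (InfinitePlace.mk φ) *
    ((starRingEnd ℂ) (φ (b i)) * φ (b j)).re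

lemma dotProduct_formMatrix {ι : Type*} [Fintype ι] (t : InfinitePlace K → ℝ) (b : ι → K)
    (x : ι → ℝ) : x ⬝ᵥ (formMatrix t b).mulVec x =
      ∑ φ : K →+* ℂ, t (InfinitePlace.mk φ) * ‖∑ i, (x i : ℂ) * φ (b i)‖ ^ 2 := by
  have h : ∀ φ : K →+* ℂ, ‖∑ i, (x i : ℂ) * φ (b i)‖ ^ 2 =
      ∑ i, ∑ j, x i * (((starRingEnd ℂ) (φ (b i)) * φ (b j)).re * x j) := by
    intro φ
    have h1 : ((‖∑ i, (x i : ℂ) * φ (b i)‖ ^ 2 : ℝ) : ℂ) =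
        ∑ i, ∑ j, (x i : ℂ) * (((starRingEnd ℂ) (φ (b i)) * φ (b j)) * x j) := by
      push_cast
      rw [← Complex.conj_mul', map_sum, Finset.sum_mul_sum]
      refine Finset.sum_congr rfl fun i _ => Finset.sum_congr rfl fun j _ => ?_
      simp only [map_mul, Complex.conj_ofReal]
      ring
    have h2 := congrArg Complex.re h1
    rw [Complex.ofReal_re] at h2
    rw [h2]
    simp only [Complex.re_sum]
    refine Finset.sum_congr rfl fun i _ => Finset.sum_congr rfl fun j _ => ?_
    simp only [Complex.re_ofReal_mul, Complex.re_mul_ofReal]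
  simp only [h, dotProduct, Matrix.mulVec, formMatrix, Finset.mul_sum, Finset.sum_mul]
  symm
  rw [Finset.sum_comm]
  refine Finset.sum_congr rfl fun i _ => ?_
  rw [Finset.sum_comm]
  refine Finset.sum_congr rfl fun j _ => ?_
  refine Finset.sum_congr rfl fun φ _ => ?_
  ring

lemma quadForm_sum {ι : Type*} [Fintype ι] (t : InfinitePlace K → ℝ) (b : ι → K) (m : ι → ℤ) :
    quadForm t (∑ i, m i • b i) =
      (fun j => (m j : ℝ)) ⬝ᵥ (formMatrix t b).mulVec (fun j => (m j : ℝ)) := by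
  rw [dotProduct_formMatrix, quadForm_eq_sum_embeddings]
  simp [map_sum]

open scoped Classical in
lemma formMatrix_map_ofReal (t : InfinitePlace K → ℝ) (b : (K →+* ℂ) → K) :
    (formMatrix t b).map Complex.ofRealHom =
      (Matrix.of fun (φ i : K →+* ℂ) => φ (b i)).conjTranspose *
        Matrix.diagonal (fun φ => (t (InfinitePlace.mk φ) : ℂ)) *
        (Matrix.of fun (φ i : K →+* ℂ) => φ (b i)) := by
  ext i j
  rw [Matrix.mul_apply]
  simp only [Matrix.map_apply, formMatrix, Matrix.mul_diagonal, Matrix.conjTranspose_apply, Matrix.of_apply, map_sum, map_mul, Complex.ofRealHom_eq_coe]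
  set F : (K →+* ℂ) → ℂ := fun φ => (starRingEnd ℂ) (φ (b i)) * φ (b j) with hF
  have hconj : ∑ φ : K →+* ℂ, (t (InfinitePlace.mk φ) : ℂ) * (starRingEnd ℂ) (F φ) =
      ∑ φ : K →+* ℂ, (t (InfinitePlace.mk φ) : ℂ) * F φ := by
    refine Fintype.sum_equiv (NumberField.ComplexEmbedding.involutive_conjugate K).toPerm _ _
      fun φ => ?_
    simp only [Function.Involutive.coe_toPerm, hF]
    rw [InfinitePlace.mk_conjugate_eq]
    simp [ComplexEmbedding.conjugate_coe_eq]
  have h2 : ∀ φ : K →+* ℂ, ((F φ).re : ℂ) = (F φ + (starRingEnd ℂ) (F φ)) / 2 := by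
    intro φ
    rw [Complex.add_conj]
    push_cast
    ring
  change ∑ φ : K →+* ℂ, (t (InfinitePlace.mk φ) : ℂ) * ((F φ).re : ℂ) = _
  simp only [h2]
  have h3 : ∑ φ : K →+* ℂ, (t (InfinitePlace.mk φ) : ℂ) * ((F φ + (starRingEnd ℂ) (F φ)) / 2) =
      ((∑ φ : K →+* ℂ, (t (InfinitePlace.mk φ) : ℂ) * F φ) +
       ∑ φ : K →+* ℂ, (t (InfinitePlace.mk φ) : ℂ) * (starRingEnd ℂ) (F φ)) / 2 := by
    rw [← Finset.sum_add_distrib, Finset.sum_div]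
    refine Finset.sum_congr rfl fun φ _ => ?_
    ring
  rw [h3, hconj, add_self_div_two]
  refine Finset.sum_congr rfl fun φ _ => ?_
  simp only [hF, Complex.star_def]
  ring

open scoped Classical in
lemma embMatrix_transpose_mul (b : Basis (K →+* ℂ) ℚ K) :
    (Matrix.of fun (φ i : K →+* ℂ) => φ (b i)).transpose *
      (Matrix.of fun (φ i : K →+* ℂ) => φ (b.traceDual i)) = 1 := by
  ext i j
  simp only [Matrix.mul_apply, Matrix.transpose_apply, Matrix.of_apply, ← map_mul]
  rw [← trace_eq_sum_ringHom, Basis.trace_mul_traceDual, Matrix.one_apply]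
  split_ifs <;> simp

open scoped Classical in
lemma embMatrix_det_sq (b : Basis (K →+* ℂ) ℚ K) :
    (Matrix.of fun (φ i : K →+* ℂ) => φ (b i)).det ^ 2 = ((Algebra.discr ℚ b : ℚ) : ℂ) := by
  rw [sq]
  nth_rewrite 1 [← Matrix.det_transpose]
  rw [← Matrix.det_mul, Algebra.discr_def, ← eq_ratCast (Rat.castHom ℂ), RingHom.map_det]
  congr 1
  ext i j
  simp only [Matrix.mul_apply, Matrix.transpose_apply, Matrix.of_apply, ← map_mul,
    RingHom.mapMatrix_apply, Matrix.map_apply, Algebra.traceMatrix_apply, Algebra.traceForm_apply]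
  rw [← trace_eq_sum_ringHom, eq_ratCast]

open scoped Classical in
lemma formMatrix_det (t : InfinitePlace K → ℝ) (b : Basis (K →+* ℂ) ℚ K) :
    (formMatrix t b).det =
      (∏ w : InfinitePlace K, t w ^ w.mult) * |((Algebra.discr ℚ b : ℚ) : ℝ)| := by
  have h := congrArg Matrix.det (formMatrix_map_ofReal t b)
  rw [← RingHom.mapMatrix_apply, ← RingHom.map_det, Matrix.det_mul, Matrix.det_mul,
    Matrix.det_conjTranspose, Matrix.det_diagonal] at h
  set d := (Matrix.of fun (φ i : K →+* ℂ) => φ (b i)).det with hd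
  have h1 : star d * d = ((|((Algebra.discr ℚ b : ℚ) : ℝ)| : ℝ) : ℂ) := by
    rw [Complex.star_def, Complex.conj_mul', ← Complex.ofReal_pow, ← norm_pow, hd,
      embMatrix_det_sq, Complex.norm_ratCast]
  have h2 : (∏ φ : K →+* ℂ, (t (InfinitePlace.mk φ) : ℂ)) =
      ((∏ w : InfinitePlace K, t w ^ w.mult : ℝ) : ℂ) := by
    rw [← prod_embeddings_eq_prod_places]
    push_cast
    rfl
  rw [mul_right_comm, h1, h2, Complex.ofRealHom_eq_coe, ← Complex.ofReal_mul] at h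
  rw [Complex.ofReal_injective h, mul_comm]

open scoped Classical in
lemma formMatrix_mul_traceDual {t : InfinitePlace K → ℝ} (ht : ∀ w, 0 < t w)
    (b : Basis (K →+* ℂ) ℚ K) :
    formMatrix t b * formMatrix (fun w => (t w)⁻¹) b.traceDual = 1 := by
  apply Matrix.map_injective Complex.ofRealHom.injective
  have hsymm : formMatrix (fun w => (t w)⁻¹) b.traceDual =
      (formMatrix (fun w => (t w)⁻¹) b.traceDual).transpose := by
    ext i j
    simp only [formMatrix, Matrix.transpose_apply, Complex.mul_re, Complex.conj_re,
      Complex.conj_im]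
    refine Finset.sum_congr rfl fun φ _ => ?_
    ring
  change (_ * _ : Matrix _ _ ℝ).map Complex.ofRealHom =
    (1 : Matrix (K →+* ℂ) (K →+* ℂ) ℝ).map Complex.ofRealHom
  rw [Matrix.map_mul, hsymm, Matrix.transpose_map, formMatrix_map_ofReal,
    formMatrix_map_ofReal]
  set B := (Matrix.of fun (φ i : K →+* ℂ) => φ (b i)) with hB
  set B' := (Matrix.of fun (φ i : K →+* ℂ) => φ (b.traceDual i)) with hB'
  have h1 : B.transpose * B' = 1 := embMatrix_transpose_mul b
  have h2 : B * B'.transpose = 1 := by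
    rw [mul_eq_one_comm, ← Matrix.transpose_transpose B, ← Matrix.transpose_mul,
      h1, Matrix.transpose_one]
  have h3 : B.conjTranspose * B'.map (starRingEnd ℂ) = 1 := by
    have : B.conjTranspose = B.transpose.map (starRingEnd ℂ) := rfl
    rw [this, ← Matrix.map_mul, h1, Matrix.map_one _ (map_zero _) (map_one _)]
  have h4 : B'.conjTranspose.transpose = B'.map (starRingEnd ℂ) := rfl
  rw [Matrix.transpose_mul, Matrix.transpose_mul, Matrix.diagonal_transpose, h4]
  have h5 : (Matrix.diagonal fun φ : K →+* ℂ => ((t (InfinitePlace.mk φ) : ℝ) : ℂ)) *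
      (Matrix.diagonal fun φ : K →+* ℂ => (((t (InfinitePlace.mk φ))⁻¹ : ℝ) : ℂ)) = 1 := by
    rw [Matrix.diagonal_mul_diagonal, ← Matrix.diagonal_one]
    congr 1
    ext φ
    have := (ht (InfinitePlace.mk φ)).ne'
    push_cast
    exact mul_inv_cancel₀ (by exact_mod_cast this)
  rw [Matrix.map_one _ (map_zero _) (map_one _), ← h3]
  simp only [Matrix.mul_assoc]
  rw [← Matrix.mul_assoc B, h2, Matrix.one_mul, ← Matrix.mul_assoc (Matrix.diagonal _), h5,
    Matrix.one_mul]

open scoped Classical in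
lemma formMatrix_posDef {t : InfinitePlace K → ℝ} (ht : ∀ w, 0 < t w)
    (b : Basis (K →+* ℂ) ℚ K) : (formMatrix t b).PosDef := by
  have hsymm : (formMatrix t b).IsHermitian := by
    ext i j
    simp only [formMatrix, Matrix.conjTranspose_apply, Complex.mul_re, Complex.conj_re,
      Complex.conj_im, star_trivial]
    refine Finset.sum_congr rfl fun φ _ => ?_
    ring
  have hsemi : (formMatrix t b).PosSemidef := by
    refine Matrix.PosSemidef.of_dotProduct_mulVec_nonneg hsymm fun x => ?_
    rw [star_trivial, dotProduct_formMatrix]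
    exact Finset.sum_nonneg fun φ _ => mul_nonneg (ht _).le (by positivity)
  rw [hsemi.posDef_iff_isUnit]
  exact IsUnit.of_mul_eq_one _ (formMatrix_mul_traceDual ht b)

open scoped Classical in
lemma theta_basis {t : InfinitePlace K → ℝ} (ht : ∀ w, 0 < t w) (b : Basis (K →+* ℂ) ℚ K) :
    ∑' m : (K →+* ℂ) → ℤ, Real.exp (-Real.pi * quadForm t (∑ i, m i • b i)) =
    (Real.sqrt ((∏ w : InfinitePlace K, t w ^ w.mult) * |((Algebra.discr ℚ b : ℚ) : ℝ)|))⁻¹ *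
      ∑' m : (K →+* ℂ) → ℤ,
        Real.exp (-Real.pi * quadForm (fun w => (t w)⁻¹) (∑ i, m i • b.traceDual i)) := by
  simp only [quadForm_sum]
  rw [theta_posDef (formMatrix_posDef ht b), formMatrix_det,
    Matrix.inv_eq_right_inv (formMatrix_mul_traceDual ht b)]

/-- The coordinates of a `ℤ`-lattice with respect to a basis. -/
def latticeEquiv {ι : Type*} [Fintype ι] (b : Basis ι ℚ K) (S : Set K)
    (hb : ∀ x, x ∈ Submodule.span ℤ (Set.range b) ↔ x ∈ S) : (ι → ℤ) ≃ S :=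
  (b.restrictScalars ℤ).equivFun.symm.toEquiv.trans (Equiv.subtypeEquivRight hb)

lemma latticeEquiv_apply {ι : Type*} [Fintype ι] (b : Basis ι ℚ K) (S : Set K)
    (hb : ∀ x, x ∈ Submodule.span ℤ (Set.range b) ↔ x ∈ S) (m : ι → ℤ) :
    (latticeEquiv b S hb m : K) = ∑ i, m i • b i := by
  simp [latticeEquiv, Basis.equivFun_symm_apply]

lemma tsum_lattice_eq {X ι : Type*} [AddCommMonoid X] [TopologicalSpace X] [Fintype ι]
    (b : Basis ι ℚ K) (S : Set K)
    (hb : ∀ x, x ∈ Submodule.span ℤ (Set.range b) ↔ x ∈ S) (f : K → X) :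
    ∑' a : S, f a = ∑' m : ι → ℤ, f (∑ i, m i • b i) := by
  rw [← (latticeEquiv b S hb).tsum_eq]
  simp only [latticeEquiv_apply]

lemma summable_lattice_iff {X ι : Type*} [AddCommMonoid X] [TopologicalSpace X] [Fintype ι]
    (b : Basis ι ℚ K) (S : Set K)
    (hb : ∀ x, x ∈ Submodule.span ℤ (Set.range b) ↔ x ∈ S) (f : K → X) :
    (Summable fun a : S => f a) ↔ Summable fun m : ι → ℤ => f (∑ i, m i • b i) := by
  rw [← (latticeEquiv b S hb).summable_iff]
  simp only [Function.comp_def, latticeEquiv_apply]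

variable (K) in
lemma card_chooseBasisIndex_eq (I : (FractionalIdeal (nonZeroDivisors (𝓞 K)) K)ˣ) :
    Nonempty (Free.ChooseBasisIndex ℤ I ≃ (K →+* ℂ)) := by
  refine ⟨Fintype.equivOfCardEq ?_⟩
  rw [NumberField.Embeddings.card, ← Module.finrank_eq_card_basis (basisOfFractionalIdeal K I)]

/-- A `ℚ`-basis of `K`, indexed by the complex embeddings, spanning a fractional ideal. -/
def embBasis (I : (FractionalIdeal (nonZeroDivisors (𝓞 K)) K)ˣ) : Basis (K →+* ℂ) ℚ K :=
  (basisOfFractionalIdeal K I).reindex (card_chooseBasisIndex_eq K I).some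

lemma mem_span_embBasis (I : (FractionalIdeal (nonZeroDivisors (𝓞 K)) K)ˣ) (x : K) :
    x ∈ Submodule.span ℤ (Set.range (embBasis I)) ↔ x ∈ (I.1 : Set K) := by
  rw [embBasis, Basis.range_reindex]
  exact mem_span_basisOfFractionalIdeal K

open scoped Classical in
lemma discr_embBasis (I : (FractionalIdeal (nonZeroDivisors (𝓞 K)) K)ˣ) :
    |((Algebra.discr ℚ (embBasis I) : ℚ) : ℝ)| =
      (DK K : ℝ) * ((FractionalIdeal.absNorm I.1 : ℚ) : ℝ) ^ 2 := by
  have hc : Fintype.card (Free.ChooseBasisIndex ℤ (𝓞 K)) =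
      Fintype.card (Free.ChooseBasisIndex ℤ I) := by
    rw [← Module.finrank_eq_card_basis (basisOfFractionalIdeal K I),
      ← Module.finrank_eq_card_basis (integralBasis K)]
  obtain e := Fintype.equivOfCardEq hc
  have h := det_basisOfFractionalIdeal_eq_absNorm K I e
  have h1 : Algebra.discr ℚ (embBasis I) =
      Algebra.discr ℚ ((basisOfFractionalIdeal K I).reindex e.symm) := by
    simp only [embBasis, Basis.coe_reindex, Algebra.discr_reindex]
  rw [h1]
  have h2 : ((basisOfFractionalIdeal K I).reindex e.symm : _ → K) =
      Matrix.vecMul (integralBasis K) (((integralBasis K).toMatrix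
        ((basisOfFractionalIdeal K I).reindex e.symm)).map (algebraMap ℚ K)) := by
    rw [Basis.toMatrix_map_vecMul]
  rw [h2, Algebra.discr_of_matrix_vecMul, ← NumberField.coe_discr, ← Basis.det_apply, ← h]
  push_cast
  rw [abs_mul, abs_pow, mul_comm, sq_abs, DK, Nat.cast_natAbs]
  push_cast
  rfl

/-- The trace dual of a fractional ideal. -/
def dualIdeal (I : (FractionalIdeal (nonZeroDivisors (𝓞 K)) K)ˣ) :
    (FractionalIdeal (nonZeroDivisors (𝓞 K)) K)ˣ :=
  Units.mk0 (FractionalIdeal.dual ℤ ℚ I.1) (FractionalIdeal.dual_ne_zero ℤ ℚ I.ne_zero)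

open scoped Classical in
lemma mem_span_traceDual_embBasis (I : (FractionalIdeal (nonZeroDivisors (𝓞 K)) K)ˣ) (x : K) :
    x ∈ Submodule.span ℤ (Set.range (embBasis I).traceDual) ↔
      x ∈ ((dualIdeal I).1 : Set K) := by
  rw [← Submodule.traceDual_span_of_basis ℤ (K := ℚ) (L := K) (B := 𝓞 K) (I.1 : Submodule (𝓞 K) K)
    (embBasis I)]
  · rw [← FractionalIdeal.coe_dual ℤ ℚ I.ne_zero]
    rfl
  · ext y
    rw [mem_span_embBasis]
    rfl

/-- The theta series of a fractional ideal. -/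
def theta (I : (FractionalIdeal (nonZeroDivisors (𝓞 K)) K)ˣ) (t : InfinitePlace K → ℝ) : ℝ :=
  ∑' a : (I.1 : Set K), Real.exp (-Real.pi * quadForm t (a : K))

lemma summable_theta (I : (FractionalIdeal (nonZeroDivisors (𝓞 K)) K)ˣ)
    {t : InfinitePlace K → ℝ} (ht : ∀ w, 0 < t w) :
    Summable fun a : (I.1 : Set K) => Real.exp (-Real.pi * quadForm t (a : K)) := by
  classical
  rw [summable_lattice_iff (embBasis I) _ (mem_span_embBasis I)
    (fun x => Real.exp (-Real.pi * quadForm t x))]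
  simp only [quadForm_sum]
  exact summable_theta_posDef (formMatrix_posDef ht (embBasis I))

theorem theta_functional_equation (I : (FractionalIdeal (nonZeroDivisors (𝓞 K)) K)ˣ)
    {t : InfinitePlace K → ℝ} (ht : ∀ w, 0 < t w) :
    theta I t = (Real.sqrt ((∏ w : InfinitePlace K, t w ^ w.mult) *
      ((DK K : ℝ) * ((FractionalIdeal.absNorm I.1 : ℚ) : ℝ) ^ 2)))⁻¹ *
        theta (dualIdeal I) (fun w => (t w)⁻¹) := by
  classical
  rw [theta, theta, tsum_lattice_eq (embBasis I) _ (mem_span_embBasis I)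
      (fun x => Real.exp (-Real.pi * quadForm t x)),
    tsum_lattice_eq (embBasis I).traceDual _ (mem_span_traceDual_embBasis I)
      (fun x => Real.exp (-Real.pi * quadForm (fun w => (t w)⁻¹) x)),
    theta_basis ht, discr_embBasis]

lemma absNorm_pos (I : (FractionalIdeal (nonZeroDivisors (𝓞 K)) K)ˣ) :
    (0 : ℝ) < ((FractionalIdeal.absNorm I.1 : ℚ) : ℝ) := by
  have : FractionalIdeal.absNorm I.1 ≠ 0 := by
    rw [Ne, FractionalIdeal.absNorm_eq_zero_iff]
    exact I.ne_zero
  exact_mod_cast lt_of_le_of_ne (FractionalIdeal.absNorm_nonneg _) this.symm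

variable (K) in
lemma DK_pos : (0 : ℝ) < DK K := by
  have := NumberField.discr_ne_zero K
  have : 0 < DK K := Int.natAbs_pos.mpr this
  exact_mod_cast this

lemma absNorm_dualIdeal (I : (FractionalIdeal (nonZeroDivisors (𝓞 K)) K)ˣ) :
    ((FractionalIdeal.absNorm (dualIdeal I).1 : ℚ) : ℝ) =
      ((DK K : ℝ) * ((FractionalIdeal.absNorm I.1 : ℚ) : ℝ))⁻¹ := by
  have h1 : FractionalIdeal.absNorm
      (FractionalIdeal.dual ℤ ℚ (1 : FractionalIdeal (nonZeroDivisors (𝓞 K)) K)) =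
        ((DK K : ℚ))⁻¹ := by
    have h := coeIdeal_differentIdeal ℤ ℚ (L := K) (B := 𝓞 K)
    have h2 := NumberField.absNorm_differentIdeal (K := K) (𝒪 := 𝓞 K)
    rw [eq_comm, inv_eq_iff_eq_inv] at h
    rw [h, map_inv₀, FractionalIdeal.coeIdeal_absNorm, h2, DK]
  have h3 : (dualIdeal I).1 = FractionalIdeal.dual ℤ ℚ 1 * (I.1)⁻¹ :=
    FractionalIdeal.dual_eq_mul_inv ..
  rw [h3, map_mul, h1, map_inv₀]
  push_cast
  rw [mul_inv]

end ThetaForm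

section Unfolding

open NumberField.Units NumberField.Units.dirichletUnitTheorem MeasureTheory
open scoped ENNReal nonZeroDivisors Classical

/-- Extension of a vector of the logarithmic space to all infinite places with coordinate sum
zero. -/
def extLog (z : logSpace K) (w : InfinitePlace K) : ℝ := 
  if h : w = w₀ then -∑ v, z v else z ⟨w, h⟩

lemma extLog_add (z z' : logSpace K) (w : InfinitePlace K) :
    extLog (z + z') w = extLog z w + extLog z' w := by
  unfold extLog
  split_ifs
  · simp [Finset.sum_add_distrib]; ring
  · rfl

lemma extLog_neg (z : logSpace K) (w : InfinitePlace K) : extLog (-z) w = -extLog z w := by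
  unfold extLog
  split_ifs <;> simp

lemma sum_place_eq (f : InfinitePlace K → ℝ) :
    ∑ w, f w = f w₀ + ∑ v : {w : InfinitePlace K // w ≠ w₀}, f v := by
  rw [Fintype.sum_eq_add_sum_subtype_ne _ w₀]

lemma sum_extLog (z : logSpace K) : ∑ w, extLog z w = 0 := by
  rw [sum_place_eq]
  have h : ∀ v : {w : InfinitePlace K // w ≠ w₀}, extLog z v.1 = z v := fun v => by
    simp [extLog, v.2]
  rw [Finset.sum_congr rfl fun v _ => h v]
  simp [extLog]

lemma extLog_logEmbedding (u : (𝓞 K)ˣ) (w : InfinitePlace K) :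
    extLog (logEmbedding K (Additive.ofMul u)) w = w.mult * Real.log (w (u : K)) := by
  unfold extLog
  split_ifs with h
  · subst h
    rw [sum_logEmbedding_component]; ring
  · rw [logEmbedding_component]

@[fun_prop]
lemma continuous_extLog (w : InfinitePlace K) : Continuous fun z : logSpace K => extLog z w := by
  unfold extLog
  split_ifs <;> fun_prop

lemma nK_pos : 0 < nK K := Module.finrank_pos

lemma sum_mult : ∑ w : InfinitePlace K, (w.mult : ℝ) = nK K := by
  exact_mod_cast InfinitePlace.sum_mult_eq (K := K)

lemma mult_pos' (w : InfinitePlace K) : (0 : ℝ) < w.mult := by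
  exact_mod_cast InfinitePlace.mult_pos

/-- The normalising scale attached to a fractional ideal. -/
def idealScale (I : (FractionalIdeal (𝓞 K)⁰ K)ˣ) : ℝ :=
  ((DK K : ℝ) * ((FractionalIdeal.absNorm I.1 : ℚ) : ℝ) ^ 2) ^ (-(nK K : ℝ)⁻¹)

lemma idealScale_pos (I : (FractionalIdeal (𝓞 K)⁰ K)ˣ) : 0 < idealScale I :=
  Real.rpow_pos_of_pos (mul_pos (DK_pos K) (pow_pos (absNorm_pos I) 2)) _

lemma idealScale_pow (I : (FractionalIdeal (𝓞 K)⁰ K)ˣ) :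
    idealScale I ^ nK K = ((DK K : ℝ) * ((FractionalIdeal.absNorm I.1 : ℚ) : ℝ) ^ 2)⁻¹ := by
  have h := mul_pos (DK_pos K) (pow_pos (absNorm_pos I) 2)
  rw [idealScale, ← Real.rpow_natCast, ← Real.rpow_mul h.le, neg_mul,
    inv_mul_cancel₀ (by exact_mod_cast nK_pos.ne'), Real.rpow_neg_one]

lemma idealScale_dualIdeal (I : (FractionalIdeal (𝓞 K)⁰ K)ˣ) :
    idealScale (dualIdeal I) = (idealScale I)⁻¹ := by
  have h1 := DK_pos K
  have h2 := absNorm_pos I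
  rw [idealScale, idealScale, absNorm_dualIdeal, ← Real.inv_rpow (by positivity)]
  congr 1
  field_simp

/-- The parameter of the theta function of `I` at radial coordinate `y` and angular
coordinate `z`. -/
def tPar (I : (FractionalIdeal (𝓞 K)⁰ K)ˣ) (y : ℝ) (z : logSpace K) (w : InfinitePlace K) : ℝ :=
  idealScale I * y ^ (nK K : ℝ)⁻¹ * Real.exp (2 * extLog z w / w.mult)

lemma tPar_pos (I : (FractionalIdeal (𝓞 K)⁰ K)ˣ) {y : ℝ} (hy : 0 < y) (z : logSpace K)
    (w : InfinitePlace K) : 0 < tPar I y z w :=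
  mul_pos (mul_pos (idealScale_pos I) (Real.rpow_pos_of_pos hy _)) (Real.exp_pos _)

lemma prod_tPar (I : (FractionalIdeal (𝓞 K)⁰ K)ˣ) {y : ℝ} (hy : 0 < y) (z : logSpace K) :
    (∏ w, tPar I y z w ^ w.mult) *
      ((DK K : ℝ) * ((FractionalIdeal.absNorm I.1 : ℚ) : ℝ) ^ 2) = y := by
  have h1 := DK_pos K
  have h2 := absNorm_pos I
  have h : ∏ w, tPar I y z w ^ w.mult = idealScale I ^ nK K * y := by
    simp only [tPar, mul_pow, Finset.prod_mul_distrib, ← Real.exp_nat_mul]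
    rw [← Real.exp_sum, Finset.prod_pow_eq_pow_sum, Finset.prod_pow_eq_pow_sum]
    have hs : ∑ w : InfinitePlace K, w.mult = nK K := InfinitePlace.sum_mult_eq (K := K)
    have h0 : ∑ w : InfinitePlace K, (w.mult : ℝ) * (2 * extLog z w / w.mult) = 0 := by
      rw [← mul_zero (2 : ℝ), ← sum_extLog z, Finset.mul_sum]
      refine Finset.sum_congr rfl fun w _ => ?_
      have := (mult_pos' w).ne'
      field_simp
    rw [hs, h0, Real.exp_zero, mul_one, Real.rpow_inv_natCast_pow hy.le nK_pos.ne']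
  rw [h, idealScale_pow]
  field_simp

lemma inv_tPar (I : (FractionalIdeal (𝓞 K)⁰ K)ˣ) {y : ℝ} (hy : 0 < y) (z : logSpace K) :
    (fun w => (tPar I y z w)⁻¹) = tPar (dualIdeal I) (1 / y) (-z) := by
  ext w
  simp only [tPar, idealScale_dualIdeal, extLog_neg, one_div, mul_inv, Real.inv_rpow hy.le,
    mul_neg, neg_div, Real.exp_neg]

lemma quadForm_tPar_unit_mul (I : (FractionalIdeal (𝓞 K)⁰ K)ˣ) (y : ℝ) (z : logSpace K)
    (u : (𝓞 K)ˣ) (a : K) :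
    quadForm (tPar I y z) ((u : K) * a) =
      quadForm (tPar I y (z + logEmbedding K (Additive.ofMul u))) a := by
  unfold quadForm
  refine Finset.sum_congr rfl fun w _ => ?_
  have hu : 0 < w (u : K) := by
    rw [InfinitePlace.pos_iff]; exact coe_ne_zero u
  have hm := (mult_pos' w).ne'
  have : Real.exp (2 * extLog (z + logEmbedding K (Additive.ofMul u)) w / w.mult) =
      Real.exp (2 * extLog z w / w.mult) * w (u : K) ^ 2 := by
    rw [extLog_add, extLog_logEmbedding, mul_add, add_div, Real.exp_add]
    congr 1
    rw [show 2 * ((w.mult : ℝ) * Real.log (w (u : K))) / w.mult = (2 : ℕ) * Real.log (w (u : K)) by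
      field_simp; push_cast; ring, Real.exp_nat_mul, Real.exp_log hu]
  rw [tPar, tPar, this, map_mul]
  ring

/-- The theta series without its constant term, with values in `[0, ∞]`. -/
def thetaE (I : (FractionalIdeal (𝓞 K)⁰ K)ˣ) (t : InfinitePlace K → ℝ) : ℝ≥0∞ :=
  ∑' a : {a : K // a ∈ I.1 ∧ a ≠ 0}, ENNReal.ofReal (Real.exp (-Real.pi * quadForm t a.1))

lemma ofReal_theta (I : (FractionalIdeal (𝓞 K)⁰ K)ˣ) {t : InfinitePlace K → ℝ}
    (ht : ∀ w, 0 < t w) : ENNReal.ofReal (theta I t) = 1 + thetaE I t := by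
  rw [theta, ENNReal.ofReal_tsum_of_nonneg (fun _ => (Real.exp_pos _).le) (summable_theta I ht)]
  have h0 : (0 : K) ∈ (I.1 : Set K) := I.1.zero_mem
  rw [ENNReal.tsum_eq_add_tsum_ite (⟨0, h0⟩ : (I.1 : Set K))]
  congr 1
  · simp [quadForm]
  · unfold thetaE
    let e : {a : K // a ∈ I.1 ∧ a ≠ 0} → (I.1 : Set K) := fun a => ⟨a.1, a.2.1⟩
    have he : Function.Injective e := fun a b h => Subtype.ext (congrArg (fun x => x.1) h)
    symm
    rw [← he.tsum_eq]
    · refine tsum_congr fun a => ?_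
      rw [if_neg]
      intro h
      exact a.2.2 (congrArg (fun x => x.1) h)
    · intro x hx
      refine ⟨⟨x.1, x.2, fun h => ?_⟩, rfl⟩
      have hx0 : x = ⟨0, h0⟩ := Subtype.ext h
      simp [hx0] at hx

/-- A fundamental domain of the unit lattice. -/
def unitDomain (K : Type*) [Field K] [NumberField K] : Set (logSpace K) :=
  ZSpan.fundamentalDomain ((basisUnitLattice K).ofZLatticeBasis ℝ (unitLattice K))

/-- The integral of the theta series over the unit domain; `ε = ± 1` is the orientation. -/
def thetaInt (I : (FractionalIdeal (𝓞 K)⁰ K)ˣ) (ε : ℝ) (y : ℝ) : ℝ≥0∞ :=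
  ∫⁻ z in unitDomain K, thetaE I (tPar I y (ε • z))

lemma volume_unitDomain_ne_top : volume (unitDomain K) ≠ ∞ :=
  (ZSpan.fundamentalDomain_isBounded _).measure_lt_top.ne

lemma thetaInt_functional_equation (I : (FractionalIdeal (𝓞 K)⁰ K)ˣ) (ε : ℝ) {y : ℝ}
    (hy : 0 < y) :
    volume (unitDomain K) + thetaInt I ε y = ENNReal.ofReal (Real.sqrt y)⁻¹ *
      (volume (unitDomain K) + thetaInt (dualIdeal I) (-ε) (1 / y)) := by
  have key : ∀ (J : (FractionalIdeal (𝓞 K)⁰ K)ˣ) (ε' : ℝ) (y' : ℝ), 0 < y' →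
      volume (unitDomain K) + thetaInt J ε' y' =
        ∫⁻ z in unitDomain K, ENNReal.ofReal (theta J (tPar J y' (ε' • z))) := by
    intro J ε' y' hy'
    simp_rw [ofReal_theta J (tPar_pos J hy' _)]
    rw [lintegral_add_left measurable_const, lintegral_one, Measure.restrict_apply_univ]
    rfl
  rw [key I ε y hy, key (dualIdeal I) (-ε) (1 / y) (by positivity),
    ← lintegral_const_mul' _ _ ENNReal.ofReal_ne_top]
  refine lintegral_congr fun z => ?_
  rw [theta_functional_equation I (tPar_pos I hy _), prod_tPar I hy, inv_tPar I hy,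
    ENNReal.ofReal_mul (by positivity), neg_smul]

end Unfolding

section Mellin

open NumberField.Units NumberField.Units.dirichletUnitTheorem MeasureTheory
open scoped ENNReal nonZeroDivisors Classical

lemma tsum_units_eq (F : logSpace K → ℝ≥0∞) :
    ∑' u : (𝓞 K)ˣ, F (logEmbedding K (Additive.ofMul u)) =
      Nat.card (torsion K) * ∑' l : unitLattice K, F l := by
  have hs : ∀ l : unitLattice K, ∃ u : (𝓞 K)ˣ, logEmbedding K (Additive.ofMul u) = l := by
    rintro ⟨l, u, -, rfl⟩
    exact ⟨Additive.toMul u, rfl⟩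
  choose s hs using hs
  have htors : ∀ u : (𝓞 K)ˣ, u ∈ torsion K ↔ logEmbedding K (Additive.ofMul u) = 0 :=
    fun u => logEmbedding_eq_zero_iff.symm
  let e : torsion K × unitLattice K → (𝓞 K)ˣ := fun p => p.1.1 * s p.2
  have hlog : ∀ p, logEmbedding K (Additive.ofMul (e p)) = p.2 := fun p => by
    simp only [e, ofMul_mul, map_add, hs, (htors _).1 p.1.2, zero_add]
  have he : Function.Bijective e := by
    constructor
    · intro p q h
      have h2 : p.2 = q.2 := Subtype.ext (by rw [← hlog p, ← hlog q, h])
      refine Prod.ext (Subtype.ext ?_) h2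
      simp only [e, h2] at h
      exact mul_right_cancel h
    · intro u
      let l : unitLattice K := ⟨logEmbedding K (Additive.ofMul u), ⟨Additive.ofMul u, trivial, rfl⟩⟩
      refine ⟨(⟨u * (s l)⁻¹, ?_⟩, l), ?_⟩
      · rw [htors, ofMul_mul, map_add, ofMul_inv, map_neg, hs, add_neg_cancel]
      · simp [e]
  rw [← (Equiv.ofBijective e he).tsum_eq]
  simp_rw [Equiv.ofBijective_apply, hlog]
  rw [ENNReal.tsum_prod (f := fun (_ : torsion K) (l : unitLattice K) => F l)]
  rw [ENNReal.tsum_const, ENat.card_eq_coe_natCard]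
  rfl

lemma tsum_units_lintegral (G : logSpace K → ℝ≥0∞) {ε : ℝ} (hε : ε = 1 ∨ ε = -1) :
    ∑' u : (𝓞 K)ˣ, ∫⁻ z in unitDomain K, G (ε • z + logEmbedding K (Additive.ofMul u)) =
      Nat.card (torsion K) * ∫⁻ z, G z := by
  rw [tsum_units_eq fun l => ∫⁻ z in unitDomain K, G (ε • z + l)]
  congr 1
  have hfd : IsAddFundamentalDomain (unitLattice K).toAddSubgroup (unitDomain K) volume :=
    ZLattice.isAddFundamentalDomain (basisUnitLattice K) volume
  have : Countable (unitLattice K).toAddSubgroup :=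
    inferInstanceAs (Countable (unitLattice K))
  rcases hε with rfl | rfl
  · rw [hfd.lintegral_eq_tsum'']
    refine tsum_congr fun l => ?_
    simp_rw [one_smul, add_comm _ (l : logSpace K)]
    rfl
  · rw [← lintegral_neg_eq_self, hfd.lintegral_eq_tsum'',
      ← (Equiv.neg (unitLattice K).toAddSubgroup).tsum_eq]
    refine tsum_congr fun l => ?_
    refine lintegral_congr fun z => ?_
    congr 1
    show (-1 : ℝ) • z + (l : logSpace K) = -(-(l : logSpace K) + z)
    rw [neg_smul, one_smul]; abel

lemma lintegral_Ioi_eq_lintegral_exp (g : ℝ → ℝ≥0∞) :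
    ∫⁻ y in Set.Ioi (0 : ℝ), g y = ∫⁻ r, ENNReal.ofReal (Real.exp r) * g (Real.exp r) := by
  have h := lintegral_image_eq_lintegral_abs_deriv_mul (s := Set.univ) (f := Real.exp)
    (f' := Real.exp) MeasurableSet.univ (fun x _ => (Real.hasDerivAt_exp x).hasDerivWithinAt)
    Real.exp_injective.injOn g
  rw [Set.image_univ, Real.range_exp] at h
  rw [h, Measure.restrict_univ]
  simp_rw [abs_of_pos (Real.exp_pos _)]

lemma lintegral_exp_mul_sub_exp {a b : ℝ} (ha : 0 < a) (hb : 0 < b) :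
    ∫⁻ r : ℝ, ENNReal.ofReal (Real.exp (a * r - b * Real.exp r)) =
      ENNReal.ofReal (Real.Gamma a * b ^ (-a)) := by
  have h1 := Real.integral_rpow_mul_exp_neg_mul_Ioi ha hb
  have h_int : IntegrableOn (fun y : ℝ => y ^ (a - 1) * Real.exp (-(b * y))) (Set.Ioi 0) := by
    have := integrableOn_rpow_mul_exp_neg_mul_rpow (s := a - 1) (p := 1) (b := b)
      (by linarith) one_pos hb
    simpa [neg_mul] using this
  have h2 := ofReal_integral_eq_lintegral_ofReal h_int
    ((ae_restrict_iff' measurableSet_Ioi).2 (ae_of_all _ fun y hy => by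
      have : (0 : ℝ) < y := hy
      positivity))
  rw [lintegral_Ioi_eq_lintegral_exp] at h2
  rw [h1, one_div, Real.inv_rpow hb.le, ← Real.rpow_neg hb.le, mul_comm] at h2
  rw [h2]
  refine lintegral_congr fun r => ?_
  rw [← ENNReal.ofReal_mul (Real.exp_pos _).le, ← Real.exp_mul, ← Real.exp_add, ← Real.exp_add]
  congr 2
  ring

lemma lintegral_pi_prod_ofReal {ι : Type*} [Fintype ι] {f : ι → ℝ → ℝ} (hf : ∀ i x, 0 ≤ f i x)
    (hm : ∀ i, Measurable (f i)) (hfin : ∀ i, ∫⁻ x, ENNReal.ofReal (f i x) ≠ ∞) :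
    ∫⁻ x : ι → ℝ, ENNReal.ofReal (∏ i, f i (x i)) = ∏ i, ∫⁻ x, ENNReal.ofReal (f i x) := by
  have h_int : ∀ i, Integrable (f i) := fun i =>
    (lintegral_ofReal_ne_top_iff_integrable (hm i).aestronglyMeasurable
      (ae_of_all _ (hf i))).1 (hfin i)
  refine (ofReal_integral_eq_lintegral_ofReal (Integrable.fintype_prod h_int)
    (ae_of_all _ fun x => Finset.prod_nonneg fun i _ => hf i _)).symm.trans ?_
  rw [← volume_pi, integral_fintype_prod_volume_eq_prod,
    ENNReal.ofReal_prod_of_nonneg fun i _ => integral_nonneg (hf i)]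
  exact Finset.prod_congr rfl fun i _ =>
    ofReal_integral_eq_lintegral_ofReal (h_int i) (ae_of_all _ (hf i))

/-- Linear change of variables between (radial, angular) coordinates and place coordinates. -/
def radialEquiv (K : Type*) [Field K] [NumberField K] :
    (ℝ × logSpace K) ≃L[ℝ] (InfinitePlace K → ℝ) :=
  LinearEquiv.toContinuousLinearEquiv
    { toFun := fun p w => p.1 / nK K + 2 * extLog p.2 w / w.mult
      map_add' := fun p q => by
        ext w; simp only [Prod.fst_add, Prod.snd_add, extLog_add, Pi.add_apply]; ring
      map_smul' := fun c p => by
        ext w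
        have : extLog (c • p.2) w = c * extLog p.2 w := by
          unfold extLog
          split_ifs
          · simp [Finset.mul_sum]
          · rfl
        simp only [Prod.smul_fst, Prod.smul_snd, this, Pi.smul_apply, smul_eq_mul,
          RingHom.id_apply]
        ring
      invFun := fun τ => (∑ w, w.mult * τ w,
        fun v => v.1.mult * (τ v.1 - (∑ w, w.mult * τ w) / nK K) / 2)
      left_inv := fun p => by
        have hn : (nK K : ℝ) ≠ 0 := by exact_mod_cast nK_pos.ne'
        have h1 : ∑ w : InfinitePlace K,
            (w.mult : ℝ) * (p.1 / nK K + 2 * extLog p.2 w / w.mult) = p.1 := by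
          have : ∀ w : InfinitePlace K,
              (w.mult : ℝ) * (p.1 / nK K + 2 * extLog p.2 w / w.mult) =
                w.mult * (p.1 / nK K) + 2 * extLog p.2 w := fun w => by
            have := (mult_pos' w).ne'
            field_simp
          simp_rw [this]
          rw [Finset.sum_add_distrib, ← Finset.sum_mul, ← Finset.mul_sum, sum_extLog, sum_mult]
          field_simp
          ring
        refine Prod.ext h1 ?_
        ext v
        simp only [h1]
        have := (mult_pos' v.1).ne'
        have hv : extLog p.2 v.1 = p.2 v := by simp [extLog, v.2]
        rw [hv]
        field_simp
        ring
      right_inv := fun τ => by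
        have hn : (nK K : ℝ) ≠ 0 := by exact_mod_cast nK_pos.ne'
        ext w
        simp only
        have := (mult_pos' w).ne'
        by_cases hw : w = w₀
        · subst hw
          have h1 := sum_place_eq fun w : InfinitePlace K =>
            (w.mult : ℝ) * (τ w - (∑ w, w.mult * τ w) / nK K) / 2
          have h2 : ∑ w : InfinitePlace K,
              (w.mult : ℝ) * (τ w - (∑ w, w.mult * τ w) / nK K) / 2 = 0 := by
            rw [← Finset.sum_div]
            simp_rw [mul_sub]
            rw [Finset.sum_sub_distrib, ← Finset.sum_mul, sum_mult]
            field_simp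
            ring
          rw [h2] at h1
          simp only [extLog, dite_true]
          rw [show ∑ v : {w : InfinitePlace K // w ≠ w₀},
            (v.1.mult : ℝ) * (τ v.1 - (∑ w, w.mult * τ w) / nK K) / 2 =
            -((w₀ : InfinitePlace K).mult * (τ w₀ - (∑ w, w.mult * τ w) / nK K) / 2) by linarith]
          field_simp
          ring
        · simp only [extLog, hw, dite_false]
          field_simp
          ring }

lemma radialEquiv_apply (p : ℝ × logSpace K) (w : InfinitePlace K) :
    radialEquiv K p w = p.1 / nK K + 2 * extLog p.2 w / w.mult := rfl

lemma sum_mult_radialEquiv (p : ℝ × logSpace K) :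
    ∑ w, (w.mult : ℝ) * radialEquiv K p w = p.1 :=
  congrArg Prod.fst ((radialEquiv K).symm_apply_apply p)

lemma exists_radial_const (K : Type*) [Field K] [NumberField K] :
    ∃ c : ℝ≥0∞, c ≠ 0 ∧ c ≠ ∞ ∧
      Measure.map (radialEquiv K) (volume : Measure (ℝ × logSpace K)) = c • volume := by
  have : (volume : Measure (ℝ × logSpace K)).IsAddHaarMeasure := by
    rw [Measure.volume_eq_prod]
    exact Measure.prod.instIsAddHaarMeasure _ _
  have h1 : (Measure.map (radialEquiv K)
      (volume : Measure (ℝ × logSpace K))).IsAddHaarMeasure :=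
    (radialEquiv K).isAddHaarMeasure_map volume
  exact ⟨_, by simpa using (Measure.addHaarScalarFactor_pos_of_isAddHaarMeasure _ volume).ne', ENNReal.coe_ne_top, Measure.isAddLeftInvariant_eq_smul _ volume⟩

/-- The Jacobian of `radialEquiv`. -/
def radialConst (K : Type*) [Field K] [NumberField K] : ℝ≥0∞ := (exists_radial_const K).choose

lemma radialConst_ne_zero : radialConst K ≠ 0 := (exists_radial_const K).choose_spec.1

lemma radialConst_ne_top : radialConst K ≠ ∞ := (exists_radial_const K).choose_spec.2.1

lemma lintegral_radialEquiv {H : (InfinitePlace K → ℝ) → ℝ≥0∞} (hH : Measurable H) :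
    ∫⁻ p, H (radialEquiv K p) = radialConst K * ∫⁻ τ, H τ := by
  have h := (exists_radial_const K).choose_spec.2.2
  rw [← lintegral_map hH (radialEquiv K).continuous.measurable, h, lintegral_smul_measure]
  rfl

lemma lintegral_radial {β : InfinitePlace K → ℝ} (hβ : ∀ w, 0 < β w) {s : ℝ} (hs : 0 < s) :
    ∫⁻ y in Set.Ioi (0 : ℝ), (∫⁻ z : logSpace K, ENNReal.ofReal (Real.exp
        (-∑ w, β w * (y ^ (nK K : ℝ)⁻¹ * Real.exp (2 * extLog z w / w.mult))))) *
        ENNReal.ofReal (y ^ (s - 1)) =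
      radialConst K *
        ENNReal.ofReal (∏ w, (Real.Gamma (s * w.mult) * β w ^ (-(s * w.mult)))) := by
  let H : (InfinitePlace K → ℝ) → ℝ≥0∞ := fun τ =>
    ENNReal.ofReal (∏ w, Real.exp (s * w.mult * τ w - β w * Real.exp (τ w)))
  have hH : Measurable H := by
    refine ENNReal.measurable_ofReal.comp ?_
    fun_prop
  have h1 : ∀ (r : ℝ) (z : logSpace K), H (radialEquiv K (r, z)) =
      ENNReal.ofReal (Real.exp r) * (ENNReal.ofReal (Real.exp
        (-∑ w, β w * (Real.exp r ^ (nK K : ℝ)⁻¹ * Real.exp (2 * extLog z w / w.mult)))) *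
        ENNReal.ofReal (Real.exp r ^ (s - 1))) := fun r z => by
    rw [← ENNReal.ofReal_mul (Real.exp_pos _).le, ← ENNReal.ofReal_mul (Real.exp_pos _).le]
    simp only [H]
    congr 1
    rw [← Real.exp_sum, ← Real.exp_mul, ← Real.exp_mul, ← Real.exp_add, ← Real.exp_add]
    congr 1
    rw [Finset.sum_sub_distrib]
    simp_rw [mul_assoc s]
    rw [← Finset.mul_sum, sum_mult_radialEquiv]
    simp_rw [radialEquiv_apply, Real.exp_add, div_eq_mul_inv r]
    ring
  calc _ = ∫⁻ r : ℝ, ∫⁻ z : logSpace K, H (radialEquiv K (r, z)) := by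
        rw [lintegral_Ioi_eq_lintegral_exp]
        refine lintegral_congr fun r => ?_
        simp_rw [h1]
        rw [lintegral_const_mul' _ _ ENNReal.ofReal_ne_top,
          lintegral_mul_const' _ _ ENNReal.ofReal_ne_top]
    _ = ∫⁻ p, H (radialEquiv K p) := by
        rw [Measure.volume_eq_prod, lintegral_prod]
        exact (hH.comp (radialEquiv K).continuous.measurable).aemeasurable
    _ = radialConst K * ∫⁻ τ, H τ := lintegral_radialEquiv hH
    _ = _ := by
        congr 1
        have hone : ∀ w : InfinitePlace K, ∫⁻ x : ℝ,
            ENNReal.ofReal (Real.exp (s * w.mult * x - β w * Real.exp x)) =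
            ENNReal.ofReal (Real.Gamma (s * w.mult) * β w ^ (-(s * w.mult))) := fun w =>
          lintegral_exp_mul_sub_exp (mul_pos hs (mult_pos' w)) (hβ w)
        rw [ENNReal.ofReal_prod_of_nonneg]
        · rw [← Finset.prod_congr rfl fun w _ => hone w]
          refine lintegral_pi_prod_ofReal
            (f := fun w x => Real.exp (s * w.mult * x - β w * Real.exp x)) ?_ ?_ ?_
          · exact fun _ _ => (Real.exp_pos _).le
          · intro w; fun_prop
          · intro w; rw [hone]; exact ENNReal.ofReal_ne_top
        · intro w _
          exact mul_nonneg (Real.Gamma_pos_of_pos (mul_pos hs (mult_pos' w))).le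
            (Real.rpow_nonneg (hβ w).le _)

end Mellin

section ClassSums

open NumberField.Units NumberField.Units.dirichletUnitTheorem MeasureTheory
open scoped ENNReal nonZeroDivisors Classical

lemma countable_numberField : Countable K :=
  (Module.finBasis ℚ K).equivFun.toEquiv.countable_iff.2 inferInstance

lemma countable_units : Countable (𝓞 K)ˣ := by
  have := countable_numberField (K := K)
  exact (coe_injective K).countable

/-- The nonzero integral ideals `𝔫` for which `𝔫 I` is principal. -/
def classSet (I : (FractionalIdeal (𝓞 K)⁰ K)ˣ) : Set {J : Ideal (𝓞 K) // J ≠ ⊥} :=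
  {𝔫 | ∃ a : K, a ≠ 0 ∧
    (𝔫.1 : FractionalIdeal (𝓞 K)⁰ K) * I.1 = FractionalIdeal.spanSingleton (𝓞 K)⁰ a}

/-- A generator of the principal ideal `𝔫 I`. -/
def classGen (I : (FractionalIdeal (𝓞 K)⁰ K)ˣ) (𝔫 : classSet I) : K := 𝔫.2.choose

lemma classGen_ne_zero (I : (FractionalIdeal (𝓞 K)⁰ K)ˣ) (𝔫 : classSet I) : classGen I 𝔫 ≠ 0 :=
  𝔫.2.choose_spec.1

lemma mul_eq_span_classGen (I : (FractionalIdeal (𝓞 K)⁰ K)ˣ) (𝔫 : classSet I) :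
    (𝔫.1.1 : FractionalIdeal (𝓞 K)⁰ K) * I.1 =
      FractionalIdeal.spanSingleton (𝓞 K)⁰ (classGen I 𝔫) :=
  𝔫.2.choose_spec.2

lemma span_unit_mul (u : (𝓞 K)ˣ) (a : K) :
    FractionalIdeal.spanSingleton (𝓞 K)⁰ ((u : K) * a) =
      FractionalIdeal.spanSingleton (𝓞 K)⁰ a := by
  symm
  rw [FractionalIdeal.spanSingleton_eq_spanSingleton]
  exact ⟨u, by rw [Units.smul_def, Algebra.smul_def]⟩

lemma classGen_injective (I : (FractionalIdeal (𝓞 K)⁰ K)ˣ) {𝔫 𝔪 : classSet I}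
    (h : FractionalIdeal.spanSingleton (𝓞 K)⁰ (classGen I 𝔫) =
      FractionalIdeal.spanSingleton (𝓞 K)⁰ (classGen I 𝔪)) : 𝔫 = 𝔪 := by
  rw [← mul_eq_span_classGen, ← mul_eq_span_classGen] at h
  have h2 := mul_right_cancel₀ I.ne_zero h
  exact Subtype.ext (Subtype.ext (FractionalIdeal.coeIdeal_injective h2))

lemma countable_classSet (I : (FractionalIdeal (𝓞 K)⁰ K)ˣ) : Countable (classSet I) := by
  have := countable_numberField (K := K)
  refine Function.Injective.countable (f := classGen I) fun 𝔫 𝔪 h => ?_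
  exact classGen_injective I (by rw [h])

lemma unit_mul_classGen_mem (I : (FractionalIdeal (𝓞 K)⁰ K)ˣ) (𝔫 : classSet I) (u : (𝓞 K)ˣ) :
    (u : K) * classGen I 𝔫 ∈ I.1 ∧ (u : K) * classGen I 𝔫 ≠ 0 := by
  refine ⟨?_, mul_ne_zero (coe_ne_zero u) (classGen_ne_zero I 𝔫)⟩
  rw [← FractionalIdeal.spanSingleton_le_iff_mem, span_unit_mul, ← mul_eq_span_classGen]
  calc _ ≤ 1 * I.1 := by
        gcongr
        exact FractionalIdeal.coeIdeal_le_one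
    _ = I.1 := one_mul _

/-- Every nonzero element of `I` is a unit times the chosen generator of a unique `𝔫 I`. -/
def elemEquiv (I : (FractionalIdeal (𝓞 K)⁰ K)ˣ) :
    classSet I × (𝓞 K)ˣ ≃ {a : K // a ∈ I.1 ∧ a ≠ 0} :=
  Equiv.ofBijective
    (fun p => ⟨(p.2 : K) * classGen I p.1, unit_mul_classGen_mem I p.1 p.2⟩) <| by
    constructor
    · rintro ⟨𝔫, u⟩ ⟨𝔪, v⟩ h
      have h1 : (u : K) * classGen I 𝔫 = (v : K) * classGen I 𝔪 := congrArg Subtype.val h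
      have h2 : 𝔫 = 𝔪 := classGen_injective I <| by
        rw [← span_unit_mul u, h1, span_unit_mul]
      subst h2
      have h3 := mul_right_cancel₀ (classGen_ne_zero I 𝔫) h1
      rw [coe_injective K h3]
    · rintro ⟨a, ha, ha0⟩
      have hle : FractionalIdeal.spanSingleton (𝓞 K)⁰ a * (I⁻¹).1 ≤ 1 := by
        calc _ ≤ I.1 * (I⁻¹).1 := by
              gcongr
              exact FractionalIdeal.spanSingleton_le_iff_mem.2 ha
          _ = 1 := by rw [← Units.val_mul, mul_inv_cancel, Units.val_one]
      obtain ⟨J, hJ⟩ := FractionalIdeal.le_one_iff_exists_coeIdeal.1 hle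
      have hJI : (J : FractionalIdeal (𝓞 K)⁰ K) * I.1 =
          FractionalIdeal.spanSingleton (𝓞 K)⁰ a := by
        rw [hJ, mul_assoc, ← Units.val_mul, inv_mul_cancel, Units.val_one, mul_one]
      have hJ0 : J ≠ ⊥ := by
        rintro rfl
        rw [FractionalIdeal.coeIdeal_bot, zero_mul] at hJI
        exact ha0 (FractionalIdeal.spanSingleton_eq_zero_iff.1 hJI.symm)
      let 𝔫 : classSet I := ⟨⟨J, hJ0⟩, a, ha0, hJI⟩
      have h := (mul_eq_span_classGen I 𝔫).symm.trans hJI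
      rw [FractionalIdeal.spanSingleton_eq_spanSingleton] at h
      obtain ⟨u, hu⟩ := h
      refine ⟨(𝔫, u), Subtype.ext (Eq.trans ?_ hu)⟩
      rw [Units.smul_def, Algebra.smul_def]

lemma tsum_nonzero_elems (I : (FractionalIdeal (𝓞 K)⁰ K)ˣ) (F : K → ℝ≥0∞) :
    ∑' a : {a : K // a ∈ I.1 ∧ a ≠ 0}, F a.1 =
      ∑' 𝔫 : classSet I, ∑' u : (𝓞 K)ˣ, F ((u : K) * classGen I 𝔫) := by
  rw [← (elemEquiv I).tsum_eq]
  exact ENNReal.tsum_prod (f := fun (𝔫 : classSet I) (u : (𝓞 K)ˣ) => F ((u : K) * classGen I 𝔫))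

@[fun_prop]
lemma measurable_extLog (w : InfinitePlace K) : Measurable fun z : logSpace K => extLog z w :=
  (continuous_extLog w).measurable

lemma measurable_quadForm_tPar (I : (FractionalIdeal (𝓞 K)⁰ K)ˣ) (a : K) :
    Measurable fun p : ℝ × logSpace K => quadForm (tPar I p.1 p.2) a := by
  unfold quadForm tPar
  refine Finset.measurable_sum _ fun w _ => ?_
  have h : Measurable fun p : ℝ × logSpace K => extLog p.2 w :=
    (measurable_extLog w).comp measurable_snd
  fun_prop

lemma thetaInt_eq_tsum (I : (FractionalIdeal (𝓞 K)⁰ K)ˣ) {ε : ℝ} (hε : ε = 1 ∨ ε = -1) (y : ℝ) :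
    thetaInt I ε y = Nat.card (torsion K) * ∑' 𝔫 : classSet I, ∫⁻ z : logSpace K,
      ENNReal.ofReal (Real.exp (-Real.pi * quadForm (tPar I y z) (classGen I 𝔫))) := by
  have := countable_classSet I
  have := countable_units (K := K)
  have hm : ∀ a : K, Measurable fun z : logSpace K =>
      ENNReal.ofReal (Real.exp (-Real.pi * quadForm (tPar I y (ε • z)) a)) := fun a => by
    have h : Measurable fun z : logSpace K => (y, ε • z) := by fun_prop
    have := (measurable_quadForm_tPar I a).comp h
    exact ENNReal.measurable_ofReal.comp (Real.measurable_exp.comp (this.const_mul _))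
  have hsum : ∀ z : logSpace K, thetaE I (tPar I y (ε • z)) = ∑' 𝔫 : classSet I,
      ∑' u : (𝓞 K)ˣ, ENNReal.ofReal (Real.exp (-Real.pi *
        quadForm (tPar I y (ε • z)) ((u : K) * classGen I 𝔫))) := fun z =>
    tsum_nonzero_elems I fun a =>
      ENNReal.ofReal (Real.exp (-Real.pi * quadForm (tPar I y (ε • z)) a))
  unfold thetaInt
  rw [lintegral_congr hsum]
  rw [lintegral_tsum fun 𝔫 => (Measurable.tsum fun u => hm _).aemeasurable,
    ← ENNReal.tsum_mul_left]
  refine tsum_congr fun 𝔫 => ?_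
  rw [lintegral_tsum fun u => (hm _).aemeasurable]
  simp_rw [quadForm_tPar_unit_mul]
  exact tsum_units_lintegral (fun z => ENNReal.ofReal (Real.exp (-Real.pi *
    quadForm (tPar I y z) (classGen I 𝔫)))) hε

lemma prod_place_pow_mult_classGen (I : (FractionalIdeal (𝓞 K)⁰ K)ˣ) (𝔫 : classSet I) :
    ∏ w : InfinitePlace K, w (classGen I 𝔫) ^ w.mult =
      (Ideal.absNorm 𝔫.1.1 : ℝ) * ((FractionalIdeal.absNorm I.1 : ℚ) : ℝ) := by
  have h := congrArg FractionalIdeal.absNorm (mul_eq_span_classGen I 𝔫)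
  rw [map_mul, FractionalIdeal.coeIdeal_absNorm, FractionalIdeal.absNorm_span_singleton] at h
  rw [InfinitePlace.prod_eq_abs_norm, ← h]
  push_cast
  rfl

/-- The real gamma factor of the completed zeta function, at half scale. -/
def gammaFactor (K : Type*) [Field K] [NumberField K] (s : ℝ) : ℝ :=
  ∏ w : InfinitePlace K, (Real.Gamma (s * w.mult) * (Real.pi * w.mult) ^ (-(s * w.mult)))

lemma gammaFactor_pos {s : ℝ} (hs : 0 < s) : 0 < gammaFactor K s :=
  Finset.prod_pos fun w _ => mul_pos (Real.Gamma_pos_of_pos (mul_pos hs (mult_pos' w)))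
    (Real.rpow_pos_of_pos (mul_pos Real.pi_pos (mult_pos' w)) _)

lemma absNorm_pos' (𝔫 : {J : Ideal (𝓞 K) // J ≠ ⊥}) : (0 : ℝ) < Ideal.absNorm 𝔫.1 := by
  have : Ideal.absNorm 𝔫.1 ≠ 0 := fun h => 𝔫.2 (Ideal.absNorm_eq_zero_iff.1 h)
  positivity

lemma prod_gamma_scaled (I : (FractionalIdeal (𝓞 K)⁰ K)ˣ) (𝔫 : classSet I) (s : ℝ) :
    ∏ w : InfinitePlace K, (Real.Gamma (s * w.mult) *
      (Real.pi * w.mult * idealScale I * w (classGen I 𝔫) ^ 2) ^ (-(s * w.mult))) =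
      (DK K : ℝ) ^ s * gammaFactor K s * (Ideal.absNorm 𝔫.1.1 : ℝ) ^ (-(2 * s)) := by
  have hc := idealScale_pos I
  have hpos : ∀ w : InfinitePlace K, 0 < w (classGen I 𝔫) := fun w =>
    InfinitePlace.pos_iff.2 (classGen_ne_zero I 𝔫)
  have h1 : ∀ w : InfinitePlace K,
      (Real.Gamma (s * w.mult) *
        (Real.pi * w.mult * idealScale I * w (classGen I 𝔫) ^ 2) ^ (-(s * w.mult))) =
      (Real.Gamma (s * w.mult) * (Real.pi * w.mult) ^ (-(s * w.mult))) *
        ((idealScale I ^ w.mult * (w (classGen I 𝔫) ^ w.mult) ^ 2) ^ (-s)) := fun w => by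
    have hp := hpos w
    have hm := mult_pos' w
    rw [mul_assoc (Real.pi * (w.mult : ℝ)), Real.mul_rpow (by positivity) (by positivity),
      mul_assoc]
    congr 2
    rw [← pow_mul, mul_comm w.mult 2, pow_mul, ← mul_pow, ← Real.rpow_natCast _ w.mult,
      ← Real.rpow_mul (by positivity)]
    congr 1
    ring
  have hN := absNorm_pos' 𝔫.1
  have hI := absNorm_pos I
  have hD := DK_pos K
  have hs : ∑ w : InfinitePlace K, w.mult = nK K := InfinitePlace.sum_mult_eq (K := K)
  have hprod : ∏ w : InfinitePlace K, (idealScale I ^ w.mult *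
      (w (classGen I 𝔫) ^ w.mult) ^ 2) =
      ((DK K : ℝ) * ((FractionalIdeal.absNorm I.1 : ℚ) : ℝ) ^ 2)⁻¹ *
      ((Ideal.absNorm 𝔫.1.1 : ℝ) * ((FractionalIdeal.absNorm I.1 : ℚ) : ℝ)) ^ 2 := by
    rw [Finset.prod_mul_distrib, Finset.prod_pow, prod_place_pow_mult_classGen,
      Finset.prod_pow_eq_pow_sum, hs, idealScale_pow]
  rw [Finset.prod_congr rfl fun w _ => h1 w, Finset.prod_mul_distrib,
    Real.finsetProd_rpow _ _ (fun w _ => by have := hpos w; positivity), hprod]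
  have h2 : ((DK K : ℝ) * ((FractionalIdeal.absNorm I.1 : ℚ) : ℝ) ^ 2)⁻¹ *
      ((Ideal.absNorm 𝔫.1.1 : ℝ) * ((FractionalIdeal.absNorm I.1 : ℚ) : ℝ)) ^ 2 =
      (DK K : ℝ)⁻¹ * (Ideal.absNorm 𝔫.1.1 : ℝ) ^ 2 := by
    field_simp
  rw [h2, Real.mul_rpow (by positivity) (by positivity), Real.inv_rpow hD.le, Real.rpow_neg hD.le,
    inv_inv, ← Real.rpow_natCast (Ideal.absNorm 𝔫.1.1 : ℝ) 2, ← Real.rpow_mul hN.le, gammaFactor]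
  rw [show ((2 : ℕ) : ℝ) * -s = -(2 * s) by push_cast; ring]
  ring

/-- Measurability in the radial variable of the summands of `thetaInt_eq_tsum`. -/
lemma measurable_lintegral_tPar (I : (FractionalIdeal (𝓞 K)⁰ K)ˣ) (a : K) :
    Measurable fun y : ℝ => ∫⁻ z : logSpace K,
      ENNReal.ofReal (Real.exp (-Real.pi * quadForm (tPar I y z) a)) :=
  Measurable.lintegral_prod_right'
    (f := fun p : ℝ × logSpace K => ENNReal.ofReal
      (Real.exp (-Real.pi * quadForm (tPar I p.1 p.2) a)))
    (ENNReal.measurable_ofReal.comp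
      (Real.measurable_exp.comp ((measurable_quadForm_tPar I a).const_mul _)))

lemma measurable_thetaInt (I : (FractionalIdeal (𝓞 K)⁰ K)ˣ) {ε : ℝ} (hε : ε = 1 ∨ ε = -1) :
    Measurable (thetaInt I ε) := by
  have := countable_classSet I
  rw [show thetaInt I ε = _ from funext fun y => thetaInt_eq_tsum I hε y]
  exact (Measurable.tsum fun 𝔫 => measurable_lintegral_tPar I _).const_mul _

theorem mellin_thetaInt (I : (FractionalIdeal (𝓞 K)⁰ K)ˣ) {ε : ℝ} (hε : ε = 1 ∨ ε = -1)
    {s : ℝ} (hs : 0 < s) :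
    ∫⁻ y in Set.Ioi (0 : ℝ), thetaInt I ε y * ENNReal.ofReal (y ^ (s - 1)) =
      Nat.card (torsion K) * radialConst K * ENNReal.ofReal ((DK K : ℝ) ^ s * gammaFactor K s) *
        ∑' 𝔫 : classSet I, ENNReal.ofReal ((Ideal.absNorm 𝔫.1.1 : ℝ) ^ (-(2 * s))) := by
  have := countable_classSet I
  have hpow : Measurable fun y : ℝ => ENNReal.ofReal (y ^ (s - 1)) := by fun_prop
  simp_rw [thetaInt_eq_tsum I hε, mul_assoc, ← ENNReal.tsum_mul_right]
  have hm : ∀ 𝔫 : classSet I, Measurable fun y : ℝ => (∫⁻ z : logSpace K,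
      ENNReal.ofReal (Real.exp (-Real.pi * quadForm (tPar I y z) (classGen I 𝔫)))) *
        ENNReal.ofReal (y ^ (s - 1)) := fun 𝔫 => (measurable_lintegral_tPar I _).mul hpow
  rw [lintegral_const_mul _ (Measurable.tsum hm), lintegral_tsum fun 𝔫 => (hm 𝔫).aemeasurable,
    ← ENNReal.tsum_mul_left (a := ENNReal.ofReal ((DK K : ℝ) ^ s * gammaFactor K s)),
    ← ENNReal.tsum_mul_left (a := radialConst K)]
  congr 1
  refine tsum_congr fun 𝔫 => ?_
  have hpos : ∀ w : InfinitePlace K, 0 < w (classGen I 𝔫) := fun w =>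
    InfinitePlace.pos_iff.2 (classGen_ne_zero I 𝔫)
  have hβ : ∀ w : InfinitePlace K,
      0 < Real.pi * w.mult * idealScale I * w (classGen I 𝔫) ^ 2 := fun w => by
    have h1 := mult_pos' w
    have h2 := hpos w
    have h3 := idealScale_pos I
    have := Real.pi_pos
    positivity
  have h := lintegral_radial hβ hs
  rw [prod_gamma_scaled, ENNReal.ofReal_mul (mul_nonneg (Real.rpow_nonneg (DK_pos K).le _)
    (gammaFactor_pos hs).le)] at h
  rw [← h]
  refine lintegral_congr fun y => ?_
  congr 1
  refine lintegral_congr fun z => ?_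
  congr 2
  rw [quadForm, Finset.mul_sum, ← Finset.sum_neg_distrib]
  refine Finset.sum_congr rfl fun w _ => ?_
  rw [tPar]
  ring

end ClassSums

section ZetaBound

open UniqueFactorizationMonoid
open scoped ENNReal Classical

/-- The rational prime below a prime ideal. -/
def primeBelow (P : Ideal (𝓞 K)) : ℕ := Ideal.absNorm (Ideal.under ℤ P)

lemma primeBelow_prime {P : Ideal (𝓞 K)} (hP : P.IsPrime) (h0 : P ≠ ⊥) :
    (primeBelow P).Prime := by
  have : NeZero P := ⟨h0⟩
  exact Nat.absNorm_under_prime P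

lemma primeBelow_le_absNorm {P : Ideal (𝓞 K)} (h0 : P ≠ ⊥) :
    primeBelow P ≤ Ideal.absNorm P :=
  Nat.le_of_dvd (Nat.pos_of_ne_zero (by simpa [Ideal.absNorm_eq_zero_iff] using h0))
    (Int.absNorm_under_dvd_absNorm P)

variable (K) in
/-- The primes above each rational prime can be labelled by `n_K` labels. -/
lemma exists_label : ∃ idx : Ideal (𝓞 K) → Fin (nK K), ∀ P Q : Ideal (𝓞 K),
    P.IsPrime → P ≠ ⊥ → Q.IsPrime → Q ≠ ⊥ → primeBelow P = primeBelow Q → idx P = idx Q →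
      P = Q := by
  have hn : 0 < nK K := nK_pos
  have : Nonempty (Fin (nK K)) := ⟨⟨0, hn⟩⟩
  have key : ∀ p : ℕ, ∃ g : Ideal (𝓞 K) → Fin (nK K), p.Prime →
      Set.InjOn g (Ideal.primesOver (Ideal.span {(p : ℤ)}) (𝓞 K)) := by
    intro p
    by_cases hp : p.Prime
    · have hp0 : (Ideal.span {(p : ℤ)}) ≠ ⊥ := by
        simpa [Ideal.span_singleton_eq_bot] using hp.ne_zero
      have hpm : (Ideal.span {(p : ℤ)}).IsMaximal :=
        ((Ideal.span_singleton_prime (by exact_mod_cast hp.ne_zero)).2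
          (Nat.prime_iff_prime_int.1 hp)).isMaximal hp0
      have hc := Ideal.card_primesOverFinset_le_finrank (S := 𝓞 K) ℚ K hp0
      rw [← IsDedekindDomain.coe_primesOverFinset hp0 (𝓞 K)]
      obtain ⟨g, -, hg⟩ := (Finset.finite_toSet (IsDedekindDomain.primesOverFinset
        (Ideal.span {(p : ℤ)}) (𝓞 K))).exists_injOn_of_encard_le
        (t := (Set.univ : Set (Fin (nK K)))) (by
          rw [Set.encard_coe_eq_coe_finsetCard, Set.encard_univ, ENat.card_eq_coe_fintype_card,
            Fintype.card_fin]
          exact_mod_cast hc)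
      exact ⟨g, fun _ => hg⟩
    · exact ⟨fun _ => Classical.arbitrary _, fun h => absurd h hp⟩
  choose g hg using key
  refine ⟨fun P => g (primeBelow P) P, fun P Q hP hP0 hQ hQ0 h hi => ?_⟩
  dsimp only at hi
  rw [← h] at hi
  refine hg _ (primeBelow_prime hP hP0) ⟨hP, ?_⟩ ⟨hQ, ?_⟩ hi
  · exact Int.liesOver_span_absNorm P
  · rw [h]
    exact Int.liesOver_span_absNorm Q

/-- The product of the rational primes below the prime factors of `𝔫` with label `i`. -/
def labelProd (idx : Ideal (𝓞 K) → Fin (nK K)) (𝔫 : Ideal (𝓞 K)) (i : Fin (nK K)) : ℕ :=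
  (((normalizedFactors 𝔫).filter (fun P => idx P = i)).map primeBelow).prod

lemma isPrime_of_mem_normalizedFactors {𝔫 P : Ideal (𝓞 K)} (h : P ∈ normalizedFactors 𝔫) :
    P.IsPrime ∧ P ≠ ⊥ :=
  ⟨Ideal.isPrime_of_prime (prime_of_normalized_factor P h), (prime_of_normalized_factor P h).ne_zero⟩

lemma labelProd_pos (idx : Ideal (𝓞 K) → Fin (nK K)) (𝔫 : Ideal (𝓞 K)) (i : Fin (nK K)) :
    0 < labelProd idx 𝔫 i := by
  refine Nat.pos_of_ne_zero (Multiset.prod_ne_zero fun h => ?_)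
  obtain ⟨P, hP, h0⟩ := Multiset.mem_map.1 h
  have := isPrime_of_mem_normalizedFactors (Multiset.mem_of_mem_filter hP)
  exact (primeBelow_prime this.1 this.2).ne_zero h0

lemma prod_labelProd_le (idx : Ideal (𝓞 K) → Fin (nK K)) {𝔫 : Ideal (𝓞 K)} (h : 𝔫 ≠ ⊥) :
    ∏ i, labelProd idx 𝔫 i ≤ Ideal.absNorm 𝔫 := by
  have h1 : ∀ s : Multiset (Ideal (𝓞 K)),
      ∏ i, ((s.filter (fun P => idx P = i)).map primeBelow).prod = (s.map primeBelow).prod := by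
    intro s
    induction s using Multiset.induction with
    | empty => simp
    | cons P s ih =>
      rw [Multiset.map_cons, Multiset.prod_cons, ← ih,
        ← Finset.mul_prod_erase Finset.univ _ (Finset.mem_univ (idx P)),
        ← Finset.mul_prod_erase Finset.univ _ (Finset.mem_univ (idx P)),
        Multiset.filter_cons_of_pos (p := fun Q => idx Q = idx P) _ rfl, Multiset.map_cons, Multiset.prod_cons, mul_assoc]
      congr 2
      refine Finset.prod_congr rfl fun i hi => ?_
      rw [Multiset.filter_cons_of_neg (p := fun Q => idx Q = i) _ (Finset.ne_of_mem_erase hi).symm]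
  have h2 : ∀ s : Multiset (Ideal (𝓞 K)), (∀ P ∈ s, P ≠ ⊥) →
      (s.map primeBelow).prod ≤ Ideal.absNorm s.prod := by
    intro s
    induction s using Multiset.induction with
    | empty => simp
    | cons P s ih =>
      intro hs
      rw [Multiset.map_cons, Multiset.prod_cons, Multiset.prod_cons, map_mul]
      exact Nat.mul_le_mul (primeBelow_le_absNorm (hs P (Multiset.mem_cons_self P s)))
        (ih fun Q hQ => hs Q (Multiset.mem_cons_of_mem hQ))
  have h3 := h2 (normalizedFactors 𝔫) fun P hP => (isPrime_of_mem_normalizedFactors hP).2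
  rw [Ideal.prod_normalizedFactors_eq_self h] at h3
  unfold labelProd
  rw [h1]
  exact h3

lemma labelProd_injective {idx : Ideal (𝓞 K) → Fin (nK K)}
    (hidx : ∀ P Q : Ideal (𝓞 K), P.IsPrime → P ≠ ⊥ → Q.IsPrime → Q ≠ ⊥ →
      primeBelow P = primeBelow Q → idx P = idx Q → P = Q)
    {𝔫 𝔪 : Ideal (𝓞 K)} (hn : 𝔫 ≠ ⊥) (hm : 𝔪 ≠ ⊥)
    (h : labelProd idx 𝔫 = labelProd idx 𝔪) : 𝔫 = 𝔪 := by
  have hfac : ∀ (𝔞 : Ideal (𝓞 K)) i, normalizedFactors (labelProd idx 𝔞 i) =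
      ((normalizedFactors 𝔞).filter (fun P => idx P = i)).map primeBelow := by
    intro 𝔞 i
    refine normalizedFactors_prod_of_prime fun p hp => ?_
    obtain ⟨P, hP, rfl⟩ := Multiset.mem_map.1 hp
    have := isPrime_of_mem_normalizedFactors (Multiset.mem_of_mem_filter hP)
    exact (primeBelow_prime this.1 this.2).prime
  have hcount : ∀ (𝔞 P : Ideal (𝓞 K)), P.IsPrime → P ≠ ⊥ →
      (normalizedFactors (labelProd idx 𝔞 (idx P))).count (primeBelow P) =
        (normalizedFactors 𝔞).count P := by
    intro 𝔞 P hP h0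
    rw [hfac, Multiset.count_map, Multiset.filter_filter, Multiset.count_eq_card_filter_eq]
    congr 1
    refine Multiset.filter_congr fun Q hQ => ?_
    have hQ' := isPrime_of_mem_normalizedFactors hQ
    constructor
    · rintro ⟨h1, h2⟩
      exact hidx P Q hP h0 hQ'.1 hQ'.2 h1 h2.symm
    · rintro rfl
      exact ⟨rfl, rfl⟩
  rw [← Ideal.prod_normalizedFactors_eq_self hn, ← Ideal.prod_normalizedFactors_eq_self hm]
  congr 1
  ext P
  by_cases hP : P.IsPrime ∧ P ≠ ⊥
  · rw [← hcount 𝔫 P hP.1 hP.2, ← hcount 𝔪 P hP.1 hP.2, h]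
  · rw [Multiset.count_eq_zero_of_notMem fun h => hP (isPrime_of_mem_normalizedFactors h),
      Multiset.count_eq_zero_of_notMem fun h => hP (isPrime_of_mem_normalizedFactors h)]

variable (K) in
/-- The Dedekind zeta function is dominated by the `n_K`-th power of the Riemann zeta function. -/
theorem tsum_absNorm_le {σ : ℝ} (hσ : 0 < σ) :
    ∑' 𝔫 : {J : Ideal (𝓞 K) // J ≠ ⊥}, ENNReal.ofReal ((Ideal.absNorm 𝔫.1 : ℝ) ^ (-σ)) ≤
      (∑' m : ℕ+, ENNReal.ofReal ((m : ℝ) ^ (-σ))) ^ (nK K) := by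
  obtain ⟨idx, hidx⟩ := exists_label K
  let Φ : {J : Ideal (𝓞 K) // J ≠ ⊥} → Fin (nK K) → ℕ+ :=
    fun 𝔫 i => ⟨labelProd idx 𝔫.1 i, labelProd_pos idx 𝔫.1 i⟩
  have hΦ : Function.Injective Φ := by
    intro 𝔫 𝔪 h
    refine Subtype.ext (labelProd_injective hidx 𝔫.2 𝔪.2 (funext fun i => ?_))
    exact congrArg PNat.val (congrFun h i)
  have h := ennreal_tsum_pi_prod (ι := Fin (nK K)) (fun m : ℕ+ => ENNReal.ofReal ((m : ℝ) ^ (-σ)))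
  rw [Fintype.card_fin] at h
  rw [← h]
  refine le_trans (ENNReal.tsum_le_tsum fun 𝔫 => ?_) (ENNReal.tsum_comp_le_tsum_of_injective hΦ _)
  rw [← ENNReal.ofReal_prod_of_nonneg fun i _ => by positivity]
  refine ENNReal.ofReal_le_ofReal ?_
  rw [Real.finsetProd_rpow _ _ fun i _ => by positivity]
  refine Real.rpow_le_rpow_of_nonpos (Finset.prod_pos fun i _ => by positivity) ?_ (by linarith)
  have h := prod_labelProd_le idx 𝔫.2
  calc ∏ i, ((Φ 𝔫 i : ℕ) : ℝ) = ((∏ i, labelProd idx 𝔫.1 i : ℕ) : ℝ) := by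
        rw [Nat.cast_prod]
        rfl
    _ ≤ _ := by exact_mod_cast h

lemma tsum_pnat_ne_top {σ : ℝ} (hσ : 1 < σ) :
    ∑' m : ℕ+, ENNReal.ofReal ((m : ℝ) ^ (-σ)) ≠ ∞ := by
  refine Summable.tsum_ofReal_ne_top ?_
  exact (Real.summable_nat_rpow.2 (by linarith : -σ < -1)).comp_injective PNat.coe_injective

/-- The Dirichlet series of the Riemann zeta function at a real point. -/
def zetaReal (σ : ℝ) : ℝ := (∑' m : ℕ+, ENNReal.ofReal ((m : ℝ) ^ (-σ))).toReal

lemma one_le_zetaReal {σ : ℝ} (hσ : 1 < σ) : 1 ≤ zetaReal σ := by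
  have h := ENNReal.le_tsum (f := fun m : ℕ+ => ENNReal.ofReal ((m : ℝ) ^ (-σ))) 1
  have := ENNReal.toReal_mono (tsum_pnat_ne_top hσ) h
  simpa [zetaReal] using this

variable (K) in
lemma summable_absNorm_rpow {σ : ℝ} (hσ : 1 < σ) :
    Summable fun 𝔫 : {J : Ideal (𝓞 K) // J ≠ ⊥} => (Ideal.absNorm 𝔫.1 : ℝ) ^ (-σ) := by
  have h := ne_top_of_le_ne_top (ENNReal.pow_ne_top (tsum_pnat_ne_top hσ))
    (tsum_absNorm_le K (by linarith : 0 < σ))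
  refine (ENNReal.summable_toReal h).congr fun 𝔫 => ?_
  rw [ENNReal.toReal_ofReal (by positivity)]

variable (K) in
lemma tsum_absNorm_rpow_le {σ : ℝ} (hσ : 1 < σ) :
    ∑' 𝔫 : {J : Ideal (𝓞 K) // J ≠ ⊥}, (Ideal.absNorm 𝔫.1 : ℝ) ^ (-σ) ≤ zetaReal σ ^ nK K := by
  have h := ENNReal.toReal_mono (ENNReal.pow_ne_top (tsum_pnat_ne_top hσ))
    (tsum_absNorm_le K (by linarith : 0 < σ))
  rw [ENNReal.toReal_pow, ← ENNReal.ofReal_tsum_of_nonneg (fun _ => by positivity)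
    (summable_absNorm_rpow K hσ), ENNReal.toReal_ofReal (tsum_nonneg fun _ => by positivity)] at h
  exact h

end ZetaBound

section FEPair

open MeasureTheory Asymptotics
open scoped ENNReal

lemma antitone_mul_rpow_le {T : ℝ → ℝ≥0∞} (hT : AntitoneOn T (Set.Ioi 0)) {s y : ℝ} (hs : 0 < s)
    (hy : 0 < y) : T y * ENNReal.ofReal (y ^ s / s) ≤
      ∫⁻ t in Set.Ioi (0 : ℝ), T t * ENNReal.ofReal (t ^ (s - 1)) := by
  have h1 : ∫⁻ t in Set.Ioc 0 y, ENNReal.ofReal (t ^ (s - 1)) = ENNReal.ofReal (y ^ s / s) := by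
    have hi : IntervalIntegrable (fun t : ℝ => t ^ (s - 1)) volume 0 y :=
      intervalIntegral.intervalIntegrable_rpow' (by linarith)
    rw [← ofReal_integral_eq_lintegral_ofReal
      ((intervalIntegrable_iff_integrableOn_Ioc_of_le hy.le).1 hi)
      ((ae_restrict_iff' measurableSet_Ioc).2 (ae_of_all _ fun t ht =>
        Real.rpow_nonneg ht.1.le _)), ← intervalIntegral.integral_of_le hy.le,
      integral_rpow (Or.inl (by linarith))]
    rw [sub_add_cancel, Real.zero_rpow hs.ne', sub_zero]
  rw [← h1, ← lintegral_const_mul _ (by fun_prop)]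
  refine le_trans (setLIntegral_mono' measurableSet_Ioc fun t ht => ?_)
    (lintegral_mono_set Set.Ioc_subset_Ioi_self)
  gcongr
  exact hT (Set.mem_Ioi.2 ht.1) (Set.mem_Ioi.2 hy) ht.2

variable {T : ℝ → ℝ≥0∞} {M : ℝ → ℝ≥0∞}

lemma antitone_ne_top (hT : AntitoneOn T (Set.Ioi 0))
    (hM : ∀ s : ℝ, 1 / 2 < s →
      ∫⁻ y in Set.Ioi (0 : ℝ), T y * ENNReal.ofReal (y ^ (s - 1)) = M s)
    (hMtop : ∀ s : ℝ, 1 / 2 < s → M s ≠ ∞) {y : ℝ} (hy : 0 < y) : T y ≠ ∞ := by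
  intro h
  have h1 := antitone_mul_rpow_le hT one_pos hy
  rw [hM 1 (by norm_num), h, ENNReal.top_mul (by simpa using hy)] at h1
  exact hMtop 1 (by norm_num) (top_le_iff.1 h1)

lemma toReal_locallyIntegrableOn (hT : AntitoneOn T (Set.Ioi 0))
    (hfin : ∀ y, 0 < y → T y ≠ ∞) (V : ℝ) :
    LocallyIntegrableOn (fun y => ((V + (T y).toReal : ℝ) : ℂ)) (Set.Ioi 0) := by
  refine (locallyIntegrableOn_iff isOpen_Ioi.isLocallyClosed).2 fun k hk hkc => ?_
  have hanti : AntitoneOn (fun y => V + (T y).toReal) k := fun a ha b hb hab => by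
    have := ENNReal.toReal_mono (hfin a (hk ha)) (hT (hk ha) (hk hb) hab)
    dsimp only
    linarith
  exact (hanti.integrableOn_isCompact hkc).ofReal

lemma toReal_isBigO (hT : AntitoneOn T (Set.Ioi 0))
    (hM : ∀ s : ℝ, 1 / 2 < s →
      ∫⁻ y in Set.Ioi (0 : ℝ), T y * ENNReal.ofReal (y ^ (s - 1)) = M s)
    (hMtop : ∀ s : ℝ, 1 / 2 < s → M s ≠ ∞) (V r : ℝ) :
    (fun y => ((V + (T y).toReal : ℝ) : ℂ) - (V : ℂ)) =O[atTop] fun y : ℝ => y ^ r := by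
  set s := max 1 (-r) with hs
  have hs1 : 1 ≤ s := le_max_left _ _
  refine IsBigO.of_bound (s * (M s).toReal) ?_
  filter_upwards [eventually_ge_atTop (1 : ℝ)] with y hy
  have hy0 : 0 < y := by linarith
  have h := ENNReal.toReal_mono (hMtop s (by linarith))
    ((antitone_mul_rpow_le hT (by linarith) hy0).trans_eq (hM s (by linarith)))
  rw [ENNReal.toReal_mul, ENNReal.toReal_ofReal (by positivity)] at h
  rw [show ((V + (T y).toReal : ℝ) : ℂ) - (V : ℂ) = ((T y).toReal : ℂ) by push_cast; ring,
    Complex.norm_real, Real.norm_of_nonneg ENNReal.toReal_nonneg,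
    Real.norm_of_nonneg (by positivity)]
  calc (T y).toReal = (s * ((T y).toReal * (y ^ s / s))) * y ^ (-s) := by
        rw [Real.rpow_neg hy0.le]
        have : y ^ s ≠ 0 := (Real.rpow_pos_of_pos hy0 _).ne'
        field_simp
    _ ≤ s * (M s).toReal * y ^ r := by
        have h3 : -s ≤ r := by
          have := le_max_right 1 (-r)
          linarith
        gcongr

lemma mellin_toReal (hTm : Measurable T) (hfin : ∀ y, 0 < y → T y ≠ ∞)
    (hM : ∀ s : ℝ, 1 / 2 < s →
      ∫⁻ y in Set.Ioi (0 : ℝ), T y * ENNReal.ofReal (y ^ (s - 1)) = M s)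
    {V s : ℝ} (hs : 1 / 2 < s) :
    mellin (fun y => ((V + (T y).toReal : ℝ) : ℂ) - (V : ℂ)) s = ((M s).toReal : ℂ) := by
  have h1 : mellin (fun y => ((V + (T y).toReal : ℝ) : ℂ) - (V : ℂ)) s =
      ∫ y in Set.Ioi (0 : ℝ), (((T y).toReal * y ^ (s - 1) : ℝ) : ℂ) := by
    refine setIntegral_congr_fun measurableSet_Ioi fun y hy => ?_
    dsimp only
    rw [smul_eq_mul, ← Complex.ofReal_one, ← Complex.ofReal_sub,
      ← Complex.ofReal_cpow (le_of_lt hy)]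
    push_cast
    ring
  rw [h1, integral_complex_ofReal, integral_eq_lintegral_of_nonneg_ae, ← hM s hs]
  · congr 2
    refine setLIntegral_congr_fun measurableSet_Ioi fun y hy => ?_
    rw [ENNReal.ofReal_mul ENNReal.toReal_nonneg, ENNReal.ofReal_toReal (hfin y hy)]
  · exact (ae_restrict_iff' measurableSet_Ioi).2 (ae_of_all _ fun y hy =>
      mul_nonneg ENNReal.toReal_nonneg (Real.rpow_nonneg (le_of_lt hy) _))
  · exact (hTm.ennreal_toReal.mul (by fun_prop)).aestronglyMeasurable

/-- A pair of decreasing functions with finite Mellin transforms satisfying the functional equation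
of a theta function is a weak FE pair. -/
lemma exists_fePair_of_antitone {T' : ℝ → ℝ≥0∞} {V : ℝ≥0∞} (hV : V ≠ ∞)
    (hT : AntitoneOn T (Set.Ioi 0)) (hT' : AntitoneOn T' (Set.Ioi 0))
    (hTm : Measurable T) (hTm' : Measurable T')
    (hM : ∀ s : ℝ, 1 / 2 < s →
      ∫⁻ y in Set.Ioi (0 : ℝ), T y * ENNReal.ofReal (y ^ (s - 1)) = M s)
    (hM' : ∀ s : ℝ, 1 / 2 < s →
      ∫⁻ y in Set.Ioi (0 : ℝ), T' y * ENNReal.ofReal (y ^ (s - 1)) = M s)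
    (hMtop : ∀ s : ℝ, 1 / 2 < s → M s ≠ ∞)
    (hfe : ∀ y : ℝ, 0 < y → V + T y = ENNReal.ofReal (Real.sqrt y)⁻¹ * (V + T' (1 / y))) :
    ∃ P : WeakFEPair ℂ, P.k = 1 / 2 ∧ P.ε = 1 ∧ P.f₀ = V.toReal ∧ P.g₀ = V.toReal ∧
      (∀ s : ℝ, 1 / 2 < s → P.Λ s = ((M s).toReal : ℂ)) ∧
      ∀ s : ℝ, 1 / 2 < s → P.symm.Λ s = ((M s).toReal : ℂ) := by
  have hfin := fun y => antitone_ne_top hT hM hMtop (y := y)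
  have hfin' := fun y => antitone_ne_top hT' hM' hMtop (y := y)
  let P : WeakFEPair ℂ :=
    { f := fun y => ((V.toReal + (T y).toReal : ℝ) : ℂ)
      g := fun y => ((V.toReal + (T' y).toReal : ℝ) : ℂ)
      k := 1 / 2
      ε := 1
      f₀ := (V.toReal : ℂ)
      g₀ := (V.toReal : ℂ)
      hf_int := toReal_locallyIntegrableOn hT hfin _
      hg_int := toReal_locallyIntegrableOn hT' hfin' _
      hk := by norm_num
      hε := one_ne_zero
      h_feq := by
        intro x hx
        have hx0 : 0 < x := hx
        have h := congrArg ENNReal.toReal (hfe (1 / x) (by positivity))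
        rw [one_div_one_div, ENNReal.toReal_mul, ENNReal.toReal_ofReal (by positivity),
          ENNReal.toReal_add hV (hfin _ (by positivity)), ENNReal.toReal_add hV (hfin' _ hx0)] at h
        rw [h, one_mul, smul_eq_mul, ← Complex.ofReal_mul, one_div, Real.sqrt_inv, inv_inv,
          Real.sqrt_eq_rpow]
      hf_top := toReal_isBigO hT hM hMtop _
      hg_top := toReal_isBigO hT' hM' hMtop _ }
  refine ⟨P, rfl, rfl, rfl, rfl, fun s hs => ?_, fun s hs => ?_⟩
  · rw [← (P.hasMellin (s := s) (by simpa [P] using hs)).2]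
    exact mellin_toReal hTm hfin hM hs
  · rw [← (P.symm.hasMellin (s := s) (by simpa [P] using hs)).2]
    exact mellin_toReal hTm' hfin' hM' hs

end FEPair

section ClassFamily

open NumberField.Units NumberField.Units.dirichletUnitTheorem MeasureTheory
open scoped ENNReal nonZeroDivisors Classical

lemma thetaInt_antitoneOn (I : (FractionalIdeal (𝓞 K)⁰ K)ˣ) (ε : ℝ) :
    AntitoneOn (thetaInt I ε) (Set.Ioi 0) := by
  intro a ha b hb hab
  refine lintegral_mono fun z => ENNReal.tsum_le_tsum fun x => ENNReal.ofReal_le_ofReal ?_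
  have ha' : (0 : ℝ) < a := ha
  have h : quadForm (tPar I a (ε • z)) x.1 ≤ quadForm (tPar I b (ε • z)) x.1 := by
    refine Finset.sum_le_sum fun w _ => ?_
    have := idealScale_pos I
    unfold tPar
    gcongr
  have := Real.pi_pos
  exact Real.exp_le_exp.2 (by nlinarith)

lemma mem_classSet_iff (I : (FractionalIdeal (𝓞 K)⁰ K)ˣ) (𝔫 : {J : Ideal (𝓞 K) // J ≠ ⊥}) :
    𝔫 ∈ classSet I ↔ ClassGroup.mk0 ⟨𝔫.1, mem_nonZeroDivisors_iff_ne_zero.2 𝔫.2⟩ =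
      (ClassGroup.mk K I)⁻¹ := by
  rw [eq_inv_iff_mul_eq_one, ← ClassGroup.mk_mk0 K, ← map_mul, ClassGroup.mk_eq_one_iff]
  constructor
  · rintro ⟨a, ha, h⟩
    refine ⟨a, ?_⟩
    rw [Units.val_mul, FractionalIdeal.coe_mk0, h, FractionalIdeal.coe_spanSingleton]
  · rintro ⟨a, h⟩
    rw [Units.val_mul, FractionalIdeal.coe_mk0, ← FractionalIdeal.coe_spanSingleton (𝓞 K)⁰ a] at h
    have h2 := FractionalIdeal.coeToSubmodule_injective h
    refine ⟨a, ?_, h2⟩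
    rintro rfl
    rw [FractionalIdeal.spanSingleton_zero] at h2
    exact mul_ne_zero (FractionalIdeal.coeIdeal_ne_zero.2 𝔫.2) I.ne_zero h2

lemma sum_tsum_classSet {J : ClassGroup (𝓞 K) → (FractionalIdeal (𝓞 K)⁰ K)ˣ}
    (hJ : Function.Bijective fun C => ClassGroup.mk K (J C))
    (f : {J : Ideal (𝓞 K) // J ≠ ⊥} → ℝ≥0∞) :
    ∑ C, ∑' 𝔫 : classSet (J C), f 𝔫.1 = ∑' 𝔫, f 𝔫 := by
  let e : (Σ C, classSet (J C)) → {J : Ideal (𝓞 K) // J ≠ ⊥} := fun p => p.2.1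
  have he : Function.Bijective e := by
    constructor
    · rintro ⟨C, 𝔫, h1⟩ ⟨C', 𝔪, h2⟩ h
      obtain rfl : 𝔫 = 𝔪 := h
      obtain rfl : C = C' := hJ.1 (inv_injective
        (((mem_classSet_iff _ _).1 h1).symm.trans ((mem_classSet_iff _ _).1 h2)))
      rfl
    · intro 𝔫
      obtain ⟨C, hC⟩ := hJ.2 (ClassGroup.mk0 ⟨𝔫.1, mem_nonZeroDivisors_iff_ne_zero.2 𝔫.2⟩)⁻¹
      refine ⟨⟨C, 𝔫, (mem_classSet_iff _ _).2 ?_⟩, rfl⟩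
      dsimp only at hC
      rw [hC, inv_inv]
  rw [← (Equiv.ofBijective e he).tsum_eq, ENNReal.tsum_sigma', tsum_fintype]
  rfl

lemma mk_dualIdeal (I : (FractionalIdeal (𝓞 K)⁰ K)ˣ) :
    ClassGroup.mk K (dualIdeal I) =
      ClassGroup.mk K (dualIdeal 1) * (ClassGroup.mk K I)⁻¹ := by
  rw [← map_inv, ← map_mul]
  congr 1
  refine Units.ext ?_
  rw [Units.val_mul, Units.val_inv_eq_inv_val]
  exact FractionalIdeal.dual_eq_mul_inv ..

lemma mellin_sum_thetaInt {J : ClassGroup (𝓞 K) → (FractionalIdeal (𝓞 K)⁰ K)ˣ}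
    (hJ : Function.Bijective fun C => ClassGroup.mk K (J C)) {ε : ℝ} (hε : ε = 1 ∨ ε = -1)
    {s : ℝ} (hs : 0 < s) :
    ∫⁻ y in Set.Ioi (0 : ℝ), (∑ C, thetaInt (J C) ε y) * ENNReal.ofReal (y ^ (s - 1)) =
      Nat.card (torsion K) * radialConst K * ENNReal.ofReal ((DK K : ℝ) ^ s * gammaFactor K s) *
        ∑' 𝔫 : {J : Ideal (𝓞 K) // J ≠ ⊥},
          ENNReal.ofReal ((Ideal.absNorm 𝔫.1 : ℝ) ^ (-(2 * s))) := by
  simp_rw [Finset.sum_mul]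
  have hm : Measurable fun y : ℝ => ENNReal.ofReal (y ^ (s - 1)) := by fun_prop
  have h : ∀ C ∈ Finset.univ, Measurable fun y : ℝ =>
      thetaInt (J C) ε y * ENNReal.ofReal (y ^ (s - 1)) := fun C _ =>
    (measurable_thetaInt (J C) hε).mul hm
  rw [lintegral_finsetSum _ h]
  simp_rw [mellin_thetaInt _ hε hs]
  rw [← Finset.mul_sum, sum_tsum_classSet hJ
    (fun 𝔫 => ENNReal.ofReal ((Ideal.absNorm 𝔫.1 : ℝ) ^ (-(2 * s))))]

variable (K) in
/-- The theta functions of the ideal classes yield an FE pair for the Dedekind zeta function. -/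
theorem exists_fePair : ∃ (P : WeakFEPair ℂ) (A c : ℝ), 0 < c ∧ P.k = 1 / 2 ∧ P.ε = 1 ∧
    P.f₀ = A ∧ P.g₀ = A ∧
    (∀ s : ℝ, 1 / 2 < s → P.Λ s = ((c * ((DK K : ℝ) ^ s * gammaFactor K s) *
      ∑' 𝔫 : {J : Ideal (𝓞 K) // J ≠ ⊥}, (Ideal.absNorm 𝔫.1 : ℝ) ^ (-(2 * s)) : ℝ) : ℂ)) ∧
    ∀ s : ℝ, 1 / 2 < s → P.symm.Λ s = P.Λ s := by
  have hsurj : Function.Surjective (ClassGroup.mk (R := 𝓞 K) K) := fun C =>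
    ClassGroup.induction (R := 𝓞 K) K (P := fun C => ∃ I, ClassGroup.mk K I = C)
      (fun I => ⟨I, rfl⟩) C
  choose J hJ using hsurj
  have hJ1 : Function.Bijective fun C => ClassGroup.mk K (J C) := by
    simp_rw [hJ]
    exact Function.bijective_id
  have hJ2 : Function.Bijective fun C => ClassGroup.mk K (dualIdeal (J C)) := by
    simp_rw [mk_dualIdeal (J _), hJ]
    exact (Group.mulLeft_bijective _).comp (Equiv.inv _).bijective
  set V : ℝ≥0∞ := Fintype.card (ClassGroup (𝓞 K)) * volume (unitDomain K) with hVdef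
  set c : ℝ≥0∞ := Nat.card (torsion K) * radialConst K with hcdef
  have hc0 : c ≠ 0 := mul_ne_zero (by
    exact_mod_cast (Nat.card_pos (α := torsion K)).ne') radialConst_ne_zero
  have hctop : c ≠ ∞ := ENNReal.mul_ne_top (ENNReal.natCast_ne_top _) radialConst_ne_top
  have hVtop : V ≠ ∞ := ENNReal.mul_ne_top (ENNReal.natCast_ne_top _) volume_unitDomain_ne_top
  have hanti : ∀ (J : ClassGroup (𝓞 K) → (FractionalIdeal (𝓞 K)⁰ K)ˣ) (ε : ℝ),
      AntitoneOn (fun y => ∑ C, thetaInt (J C) ε y) (Set.Ioi 0) := fun J ε a ha b hb hab =>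
    Finset.sum_le_sum fun C _ => thetaInt_antitoneOn (J C) ε ha hb hab
  obtain ⟨P, h1, h2, h3, h4, h5, h6⟩ := exists_fePair_of_antitone hVtop (hanti J 1)
    (hanti (fun C => dualIdeal (J C)) (-1))
    (Finset.measurable_sum _ fun C _ => measurable_thetaInt _ (Or.inl rfl))
    (Finset.measurable_sum _ fun C _ => measurable_thetaInt _ (Or.inr rfl))
    (fun s hs => mellin_sum_thetaInt hJ1 (Or.inl rfl) (by linarith))
    (fun s hs => mellin_sum_thetaInt hJ2 (Or.inr rfl) (by linarith))
    (fun s hs => ENNReal.mul_ne_top (ENNReal.mul_ne_top hctop ENNReal.ofReal_ne_top)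
      (summable_absNorm_rpow K (by linarith)).tsum_ofReal_ne_top)
    (fun y hy => by
      have h : ∀ (J : ClassGroup (𝓞 K) → (FractionalIdeal (𝓞 K)⁰ K)ˣ) (ε y : ℝ),
          V + ∑ C, thetaInt (J C) ε y = ∑ C, (volume (unitDomain K) + thetaInt (J C) ε y) := by
        intro J ε y
        rw [Finset.sum_add_distrib, Finset.sum_const, Finset.card_univ, nsmul_eq_mul]
      rw [h, h, Finset.mul_sum]
      exact Finset.sum_congr rfl fun C _ => thetaInt_functional_equation (J C) 1 hy)
  refine ⟨P, V.toReal, c.toReal, ENNReal.toReal_pos hc0 hctop, h1, h2, h3, h4, fun s hs => ?_,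
    fun s hs => (h6 s hs).trans (h5 s hs).symm⟩
  rw [h5 s hs, ENNReal.toReal_mul, ENNReal.toReal_mul, ENNReal.toReal_ofReal
    (mul_nonneg (Real.rpow_nonneg (DK_pos K).le _) (gammaFactor_pos (by linarith)).le),
    ← ENNReal.ofReal_tsum_of_nonneg (fun _ => by positivity)
      (summable_absNorm_rpow K (by linarith)),
    ENNReal.toReal_ofReal (tsum_nonneg fun _ => by positivity)]

end ClassFamily

section Continuation

open MeasureTheory

/-- The Mellin transform of a strong FE pair is bounded on vertical strips. -/
lemma norm_Lambda0_le (P : WeakFEPair ℂ) (a b : ℝ) :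
    ∃ B : ℝ, ∀ s : ℂ, a ≤ s.re → s.re ≤ b → ‖P.Λ₀ s‖ ≤ B := by
  have h_int : ∀ r : ℝ, IntegrableOn (fun t : ℝ => t ^ (r - 1) * ‖P.f_modif t‖) (Set.Ioi 0) := by
    intro r
    have h := (P.isStrongFEPair_toStrongFEPair.hasMellin (r : ℂ)).1.norm
    refine IntegrableOn.congr_fun h (fun t ht => ?_) measurableSet_Ioi
    simp only [norm_smul]
    rw [Complex.norm_cpow_eq_rpow_re_of_pos ht]
    simp [WeakFEPair.toStrongFEPair]
  refine ⟨∫ t in Set.Ioi (0 : ℝ), (t ^ (a - 1) * ‖P.f_modif t‖ + t ^ (b - 1) * ‖P.f_modif t‖),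
    fun s ha hb => ?_⟩
  refine (norm_integral_le_integral_norm _).trans ?_
  refine setIntegral_mono_on ?_ ((h_int a).add (h_int b)) measurableSet_Ioi fun t ht => ?_
  · exact (P.isStrongFEPair_toStrongFEPair.hasMellin s).1.norm
  · have ht0 : (0 : ℝ) < t := ht
    rw [norm_smul, Complex.norm_cpow_eq_rpow_re_of_pos ht0, ← add_mul]
    gcongr
    have h1 : 0 ≤ t ^ (a - 1) := by positivity
    have h2 : 0 ≤ t ^ (b - 1) := by positivity
    rw [Complex.sub_re, Complex.one_re]
    have h3 : a - 1 ≤ s.re - 1 := by linarith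
    have h4 : s.re - 1 ≤ b - 1 := by linarith
    rcases le_total t 1 with h | h
    · exact (Real.rpow_le_rpow_of_exponent_ge ht0 h h3).trans (by linarith)
    · exact (Real.rpow_le_rpow_of_exponent_le h h4).trans (by linarith)

/-- Two entire functions agreeing at all large real numbers are equal. -/
lemma eq_of_eq_on_real {f g : ℂ → ℂ} {U : Set ℂ} (hU : IsPreconnected U) (hUo : IsOpen U)
    (hf : DifferentiableOn ℂ f U) (hg : DifferentiableOn ℂ g U) {a : ℝ}
    (haU : ∀ s : ℝ, a < s → (s : ℂ) ∈ U)
    (h : ∀ s : ℝ, a < s → f s = g s) : Set.EqOn f g U := by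
  have ha1 : ((a + 1 : ℝ) : ℂ) ∈ U := haU _ (by linarith)
  refine (hf.analyticOnNhd hUo).eqOn_of_preconnected_of_frequently_eq (hg.analyticOnNhd hUo) hU
    ha1 ?_
  have ht : Tendsto (fun x : ℝ => (x : ℂ)) (𝓝[≠] (a + 1)) (𝓝[≠] ((a + 1 : ℝ) : ℂ)) := by
    refine tendsto_nhdsWithin_of_tendsto_nhds_of_eventually_within _
      (Complex.continuous_ofReal.continuousAt.tendsto.mono_left nhdsWithin_le_nhds) ?_
    filter_upwards [self_mem_nhdsWithin] with x hx
    exact fun h => hx (Complex.ofReal_injective h)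
  refine ht.frequently (Eventually.frequently ?_)
  refine (eventually_nhdsWithin_of_eventually_nhds ?_)
  filter_upwards [Ioi_mem_nhds (by linarith : a < a + 1)] with x hx
  exact h x hx

variable (K) in
/-- The regularised completed Dedekind zeta function. -/
theorem exists_completed : ∃ (L : ℂ → ℂ) (A : ℂ), Differentiable ℂ L ∧
    (∀ s, L (1 / 2 - s) = L s) ∧
    (∀ a b : ℝ, ∃ B : ℝ, ∀ s : ℂ, a ≤ s.re → s.re ≤ b → ‖L s‖ ≤ B) ∧
    ∀ s : ℝ, 1 / 2 < s → L s - A / s - A / (1 / 2 - s) =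
      (((DK K : ℝ) ^ s * gammaFactor K s *
        ∑' 𝔫 : {J : Ideal (𝓞 K) // J ≠ ⊥}, (Ideal.absNorm 𝔫.1 : ℝ) ^ (-(2 * s)) : ℝ) : ℂ) := by
  obtain ⟨P, A, c, hc, hk, hε, hf, hg, h1, h2⟩ := exists_fePair K
  have hc' : (c : ℂ) ≠ 0 := by exact_mod_cast hc.ne'
  have hsymm : P.symm.Λ₀ = P.Λ₀ := by
    have := eq_of_eq_on_real (a := 1 / 2) isPreconnected_univ isOpen_univ
      P.symm.differentiable_Λ₀.differentiableOn P.differentiable_Λ₀.differentiableOn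
      (fun _ _ => Set.mem_univ _) (fun s hs => ?_)
    · exact funext fun s => this (Set.mem_univ s)
    · rw [P.symm_Λ₀_eq, P.Λ₀_eq, h2 s hs, hε, hf, hg, inv_one]
  refine ⟨fun s => P.Λ₀ s / c, A / c, P.differentiable_Λ₀.div_const _, fun s => ?_, fun a b => ?_,
    fun s hs => ?_⟩
  · have h := P.functional_equation₀ s
    rw [hk, hε, one_smul, hsymm] at h
    dsimp only
    rw [← h]
    norm_num
  · obtain ⟨B, hB⟩ := norm_Lambda0_le P a b
    refine ⟨B / ‖(c : ℂ)‖, fun s ha hb => ?_⟩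
    dsimp only
    rw [norm_div]
    gcongr
    exact hB s ha hb
  · have h := h1 s hs
    have h3 := P.Λ₀_eq s
    rw [h, hk, hε, hf, hg, smul_eq_mul, smul_eq_mul] at h3
    dsimp only
    rw [h3]
    push_cast
    field_simp
    ring

variable (K) in
lemma norm_zetaSer_term (𝔫 : {J : Ideal (𝓞 K) // J ≠ ⊥}) (s : ℂ) :
    ‖(Ideal.absNorm 𝔫.1 : ℂ) ^ (-s)‖ = (Ideal.absNorm 𝔫.1 : ℝ) ^ (-s.re) := by
  have h := Complex.norm_cpow_eq_rpow_re_of_pos (absNorm_pos' 𝔫) (-s)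
  rw [Complex.neg_re] at h
  rw [← h]
  norm_num

variable (K) in
lemma differentiableOn_zetaSer : DifferentiableOn ℂ (zetaSer K) {s | 1 < s.re} := by
  intro s hs
  have hs1 : 1 < s.re := hs
  obtain ⟨r, hr1, hr2⟩ := exists_between hs1
  have h : DifferentiableOn ℂ (zetaSer K) {z | r < z.re} := by
    refine differentiableOn_tsum_of_summable_norm (u := fun 𝔫 : {J : Ideal (𝓞 K) // J ≠ ⊥} =>
      (Ideal.absNorm 𝔫.1 : ℝ) ^ (-r)) (summable_absNorm_rpow K hr1) (fun 𝔫 => ?_)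
      (isOpen_lt continuous_const Complex.continuous_re) fun 𝔫 z hz => ?_
    · have h0 : (Ideal.absNorm 𝔫.1 : ℂ) ≠ 0 := by
        have := absNorm_pos' 𝔫
        exact_mod_cast this.ne'
      exact (differentiable_id.neg.const_cpow (Or.inl h0)).differentiableOn
    · rw [norm_zetaSer_term]
      have hN : (1 : ℝ) ≤ Ideal.absNorm 𝔫.1 := by
        have := absNorm_pos' 𝔫
        exact_mod_cast this
      exact Real.rpow_le_rpow_of_exponent_le hN (by have : r < z.re := hz; linarith)
  exact (h.differentiableAt ((isOpen_lt continuous_const Complex.continuous_re).mem_nhds hr2)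
    ).differentiableWithinAt

variable (K) in
lemma norm_zetaSer_le {s : ℂ} (hs : 1 < s.re) : ‖zetaSer K s‖ ≤ zetaReal s.re ^ nK K := by
  have h := summable_absNorm_rpow K hs
  refine le_trans ?_ (tsum_absNorm_rpow_le K hs)
  refine tsum_of_norm_bounded h.hasSum fun 𝔫 => (norm_zetaSer_term K 𝔫 s).le

variable (K) in
lemma zetaSer_ofReal (σ : ℝ) : zetaSer K σ =
    ((∑' 𝔫 : {J : Ideal (𝓞 K) // J ≠ ⊥}, (Ideal.absNorm 𝔫.1 : ℝ) ^ (-σ) : ℝ) : ℂ) := by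
  rw [Complex.ofReal_tsum]
  refine tsum_congr fun 𝔫 => ?_
  rw [Complex.ofReal_cpow (Nat.cast_nonneg _)]
  push_cast
  rfl

variable (K) in
/-- The inverse of the gamma factor, an entire function. -/
def invGammaFactor (u : ℂ) : ℂ :=
  ∏ w : InfinitePlace K, ((Complex.Gamma (u * w.mult))⁻¹ *
    ((Real.pi * w.mult : ℝ) : ℂ) ^ (u * w.mult))

lemma pi_mult_pos (w : InfinitePlace K) : 0 < Real.pi * w.mult :=
  mul_pos Real.pi_pos (mult_pos' w)

variable (K) in
lemma differentiable_invGammaFactor : Differentiable ℂ (invGammaFactor K) := by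
  refine Differentiable.fun_finsetProd fun w _ => ?_
  have h1 : Differentiable ℂ fun u : ℂ => u * (w.mult : ℂ) := differentiable_id.mul_const _
  refine Differentiable.mul (Complex.differentiable_one_div_Gamma.comp h1) ?_
  exact h1.const_cpow (Or.inl (by exact_mod_cast (pi_mult_pos w).ne'))

variable (K) in
lemma invGammaFactor_zero : invGammaFactor K 0 = 0 := by
  obtain ⟨w⟩ : Nonempty (InfinitePlace K) := inferInstance
  refine Finset.prod_eq_zero (Finset.mem_univ w) ?_
  simp [Complex.Gamma_zero]

variable (K) in
lemma gammaFactor_mul_inv {s : ℝ} (hs : 0 < s) :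
    (gammaFactor K s : ℂ) * invGammaFactor K s = 1 := by
  rw [gammaFactor, invGammaFactor, Complex.ofReal_prod, ← Finset.prod_mul_distrib]
  refine Finset.prod_eq_one fun w _ => ?_
  have h1 := mult_pos' w
  have h2 := pi_mult_pos w
  have h3 : Complex.Gamma (s * w.mult) ≠ 0 := Complex.Gamma_ne_zero_of_re_pos (by
    simpa using mul_pos hs h1)
  have h4 : ((Real.pi * w.mult : ℝ) : ℂ) ^ ((s : ℂ) * w.mult) ≠ 0 := by
    rw [Complex.cpow_ne_zero_iff]
    exact Or.inl (by exact_mod_cast h2.ne')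
  rw [Complex.ofReal_mul, ← Complex.Gamma_ofReal, Complex.ofReal_cpow h2.le]
  push_cast at h4 ⊢
  rw [Complex.cpow_neg]
  field_simp

end Continuation

section Convexity

/-- Phragmén–Lindelöf convexity in a vertical strip, for functions of polynomial growth on the two
boundary lines. -/
theorem convexity_bound {f : ℂ → ℂ} {a b k l A B C : ℝ} (hab : a < b) (hab3 : b - a ≤ 3)
    (hk : 0 ≤ k) (hl : 0 ≤ l) (hA : 0 < A) (hB : 0 < B)
    (hf : DiffContOnCl ℂ f (Complex.re ⁻¹' Set.Ioo a b))
    (hgrowth : ∀ s : ℂ, a < s.re → s.re < b → 2 ≤ |s.im| →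
      ‖f s‖ ≤ C * Real.exp (C * |s.im|))
    (hfa : ∀ s : ℂ, s.re = a → ‖f s‖ ≤ A * (1 + |s.im|) ^ k)
    (hfb : ∀ s : ℂ, s.re = b → ‖f s‖ ≤ B * (1 + |s.im|) ^ l)
    {s : ℂ} (has : a ≤ s.re) (hsb : s.re ≤ b) :
    ‖f s‖ ≤ (2 * (1 + b - a)) ^ (k + l) *
      ((A * (1 + |s.im|) ^ k) ^ ((b - s.re) / (b - a)) *
        (B * (1 + |s.im|) ^ l) ^ ((s.re - a) / (b - a))) := by
  set T := s.im with hT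
  have hba : 0 < b - a := sub_pos.2 hab
  set A' := A * (1 + |T|) ^ k with hA'
  set B' := B * (1 + |T|) ^ l with hB'
  have hT1 : 0 < 1 + |T| := by positivity
  have hA'0 : 0 < A' := by positivity
  have hB'0 : 0 < B' := by positivity
  set v : ℂ → ℂ := fun z => z - T * I - a + 1 with hv
  set q : ℂ → ℂ := fun z =>
    -((Real.log A' * (b - z) + Real.log B' * (z - a)) / (b - a)) with hq
  have hvre : ∀ z, (v z).re = z.re - a + 1 := fun z => by simp [hv]
  have hvim : ∀ z, (v z).im = z.im - T := fun z => by simp [hv]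
  have hqre : ∀ z, (q z).re =
      -((Real.log A' * (b - z.re) + Real.log B' * (z.re - a)) / (b - a)) := fun z => by
    have : ((b : ℂ) - a) = ((b - a : ℝ) : ℂ) := by push_cast; ring
    simp only [hq, this, Complex.neg_re, Complex.div_ofReal_re, Complex.add_re,
      Complex.re_ofReal_mul, Complex.sub_re, Complex.ofReal_re]
  have hvpos : ∀ z : ℂ, a ≤ z.re → 1 ≤ ‖v z‖ := fun z hz =>
    le_trans (by rw [hvre]; linarith) (Complex.re_le_norm (v z))
  have hvhalf : ∀ z : ℂ, a ≤ z.re → (1 + |z.im - T|) / 2 ≤ ‖v z‖ := fun z hz => by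
    have h1 := hvpos z hz
    have h2 := Complex.abs_im_le_norm (v z)
    rw [hvim] at h2
    linarith
  have hexp : ∀ z, ‖Complex.exp (q z)‖ =
      (A' ^ ((b - z.re) / (b - a)) * B' ^ ((z.re - a) / (b - a)))⁻¹ := fun z => by
    rw [Complex.norm_exp, hqre, Real.exp_neg, Real.rpow_def_of_pos hA'0,
      Real.rpow_def_of_pos hB'0, ← Real.exp_add]
    congr 2
    ring
  have hvc : ∀ z : ℂ, a ≤ z.re → ‖(v z) ^ ((-(k + l) : ℝ) : ℂ)‖ = ‖v z‖ ^ (-(k + l)) :=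
    fun z hz => Complex.norm_cpow_real _ _
  set g : ℂ → ℂ := fun z => f z * (v z) ^ ((-(k + l) : ℝ) : ℂ) * Complex.exp (q z) with hg
  have hgn : ∀ z : ℂ, a ≤ z.re → ‖g z‖ = ‖f z‖ * ‖v z‖ ^ (-(k + l)) *
      (A' ^ ((b - z.re) / (b - a)) * B' ^ ((z.re - a) / (b - a)))⁻¹ := fun z hz => by
    rw [hg, norm_mul, norm_mul, hexp, hvc z hz]
  have hkl : 0 ≤ k + l := by linarith
  have hshift : ∀ z : ℂ, 1 + |z.im| ≤ (1 + |T|) * (1 + |z.im - T|) := fun z => by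
    have h1 : |z.im| ≤ |T| + |z.im - T| := by
      have := abs_add_le T (z.im - T)
      rwa [add_sub_cancel] at this
    nlinarith [abs_nonneg T, abs_nonneg (z.im - T), mul_nonneg (abs_nonneg T)
      (abs_nonneg (z.im - T))]
  -- bound on a boundary line
  have hline : ∀ (z : ℂ) (M p : ℝ), a ≤ z.re → 0 < M → 0 ≤ p → p ≤ k + l →
      ‖f z‖ ≤ M * (1 + |z.im|) ^ p →
      ‖f z‖ * ‖v z‖ ^ (-(k + l)) * (M * (1 + |T|) ^ p)⁻¹ ≤ 2 ^ (k + l) := by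
    intro z M p hz hM hp hpk hfz
    have h0 : (0 : ℝ) < 1 + |z.im - T| := by positivity
    have h1 : ‖v z‖ ^ (-(k + l)) ≤ ((1 + |z.im - T|) / 2) ^ (-(k + l)) :=
      Real.rpow_le_rpow_of_nonpos (by positivity) (hvhalf z hz) (by linarith)
    have h2 : (1 + |z.im|) ^ p ≤ (1 + |T|) ^ p * (1 + |z.im - T|) ^ (k + l) := by
      refine (Real.rpow_le_rpow (by positivity) (hshift z) hp).trans ?_
      rw [Real.mul_rpow hT1.le h0.le]
      gcongr
      linarith [abs_nonneg (z.im - T)]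
    have h3 : ((1 + |z.im - T|) / 2) ^ (-(k + l)) =
        2 ^ (k + l) * ((1 + |z.im - T|) ^ (k + l))⁻¹ := by
      rw [Real.rpow_neg (by positivity), Real.div_rpow h0.le (by norm_num), inv_div]
      rfl
    have h4 : 0 < (1 + |z.im - T|) ^ (k + l) := by positivity
    have h5 : 0 < (1 + |T|) ^ p := by positivity
    rw [← div_eq_mul_inv, div_le_iff₀ (by positivity)]
    calc ‖f z‖ * ‖v z‖ ^ (-(k + l))
        ≤ (M * ((1 + |T|) ^ p * (1 + |z.im - T|) ^ (k + l))) *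
          (2 ^ (k + l) * ((1 + |z.im - T|) ^ (k + l))⁻¹) := by
          rw [← h3]
          gcongr
          exact hfz.trans (by gcongr)
      _ = 2 ^ (k + l) * (M * (1 + |T|) ^ p) := by field_simp
  have key : ‖g s‖ ≤ 2 ^ (k + l) := by
    refine PhragmenLindelof.vertical_strip (a := a) (b := b) ?_ ?_ ?_ ?_ has hsb
    · refine DiffContOnCl.smul (c := fun z => f z * (v z) ^ ((-(k + l) : ℝ) : ℂ))
        (DiffContOnCl.smul hf ?_) ?_
      · refine DifferentiableOn.diffContOnCl fun z hz => DifferentiableAt.differentiableWithinAt ?_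
        have hz' : a ≤ z.re := by
          have h := closure_mono (Set.preimage_mono (Set.Ioo_subset_Icc_self.trans Set.Icc_subset_Ici_self)) hz
          rwa [IsClosed.closure_eq (isClosed_Ici.preimage Complex.continuous_re)] at h
        have hd : DifferentiableAt ℂ v z := by simp only [hv]; fun_prop
        refine hd.cpow_const ?_
        exact Or.inl (by rw [hvre]; linarith)
      · have hd : Differentiable ℂ fun z => Complex.exp (q z) := by simp only [hq]; fun_prop
        exact hd.diffContOnCl
    · refine ⟨1, ?_, |C| + 1, ?_⟩
      · rw [lt_div_iff₀ hba]
        linarith [Real.pi_gt_three]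
      · refine Asymptotics.IsBigO.of_bound
          (|C| * Real.exp (|Real.log A'| + |Real.log B'|)) ?_
        have hev : ∀ᶠ z : ℂ in comap (_root_.abs ∘ Complex.im) atTop, 2 ≤ |z.im| :=
          (eventually_ge_atTop (2 : ℝ)).comap _
        filter_upwards [mem_inf_of_left hev, mem_inf_of_right (mem_principal_self _)] with z h2 hz
        have hz1 : a < z.re := hz.1
        have hz2 : z.re < b := hz.2
        have e1 := hgrowth z hz1 hz2 h2
        have e2 : ‖v z‖ ^ (-(k + l)) ≤ 1 :=
          Real.rpow_le_one_of_one_le_of_nonpos (hvpos z hz1.le) (by linarith)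
        have e3 : ‖Complex.exp (q z)‖ ≤ Real.exp (|Real.log A'| + |Real.log B'|) := by
          rw [Complex.norm_exp, hqre, Real.exp_le_exp, ← neg_div, div_le_iff₀ hba]
          nlinarith [neg_abs_le (Real.log A'), neg_abs_le (Real.log B'),
            abs_nonneg (Real.log A'), abs_nonneg (Real.log B')]
        have e4 : C * Real.exp (C * |z.im|) ≤
            |C| * Real.exp ((|C| + 1) * Real.exp (1 * |z.im|)) := by
          have e5 : C * |z.im| ≤ (|C| + 1) * Real.exp (1 * |z.im|) := by
            have e6 : |z.im| ≤ Real.exp (1 * |z.im|) := by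
              rw [one_mul]
              linarith [Real.add_one_le_exp |z.im|]
            have e7 := le_abs_self C
            have e8 := abs_nonneg C
            have e9 := abs_nonneg z.im
            nlinarith [mul_le_mul_of_nonneg_right e7 e9, mul_le_mul_of_nonneg_left e6 e8,
              Real.exp_pos (1 * |z.im|)]
          exact (mul_le_mul_of_nonneg_right (le_abs_self C) (Real.exp_pos _).le).trans
            (mul_le_mul_of_nonneg_left (Real.exp_le_exp.2 e5) (abs_nonneg C))
        rw [Real.norm_of_nonneg (Real.exp_pos _).le, norm_mul, norm_mul, hvc z hz1.le]
        have e0 : 0 ≤ C * Real.exp (C * |z.im|) := (norm_nonneg _).trans e1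
        calc ‖f z‖ * ‖v z‖ ^ (-(k + l)) * ‖Complex.exp (q z)‖
            ≤ (C * Real.exp (C * |z.im|)) * 1 * Real.exp (|Real.log A'| + |Real.log B'|) := by
              gcongr
          _ ≤ (|C| * Real.exp ((|C| + 1) * Real.exp (1 * |z.im|))) * 1 *
              Real.exp (|Real.log A'| + |Real.log B'|) := by gcongr
          _ = _ := by ring
    · intro z hz
      rw [hgn z hz.ge, hz, div_self hba.ne', sub_self, zero_div, Real.rpow_one, Real.rpow_zero,
        mul_one]
      exact hline z A k hz.ge hA hk (by linarith) (hfa z hz)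
    · intro z hz
      have hz' : a ≤ z.re := by linarith
      rw [hgn z hz', hz, div_self hba.ne', sub_self, zero_div, Real.rpow_one, Real.rpow_zero,
        one_mul]
      exact hline z B l hz' hB hl (by linarith) (hfb z hz)
  rw [hgn s has] at key
  have hvs : ‖v s‖ ≤ 1 + b - a := by
    have : v s = ((s.re - a + 1 : ℝ) : ℂ) := by
      apply Complex.ext
      · rw [hvre]; simp
      · rw [hvim]; simp [hT]
    rw [this, Complex.norm_real, Real.norm_of_nonneg (by linarith)]
    linarith
  have hv0 : 0 < ‖v s‖ := by linarith [hvpos s has]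
  have hE : 0 < A' ^ ((b - s.re) / (b - a)) * B' ^ ((s.re - a) / (b - a)) := by positivity
  rw [← div_eq_mul_inv, div_le_iff₀ hE, Real.rpow_neg hv0.le, ← div_eq_mul_inv,
    div_le_iff₀ (by positivity)] at key
  refine key.trans ?_
  rw [Real.mul_rpow (x := 2) (y := 1 + b - a) (by norm_num) (by linarith)]
  calc 2 ^ (k + l) * (A' ^ ((b - s.re) / (b - a)) * B' ^ ((s.re - a) / (b - a))) *
        ‖v s‖ ^ (k + l)
      ≤ 2 ^ (k + l) * (A' ^ ((b - s.re) / (b - a)) * B' ^ ((s.re - a) / (b - a))) *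
        (1 + b - a) ^ (k + l) := by gcongr
    _ = _ := by ring

end Convexity

section GammaBounds

open MeasureTheory

lemma norm_Gamma_le {w : ℂ} (hw : 0 < w.re) : ‖Complex.Gamma w‖ ≤ Real.Gamma w.re := by
  rw [Complex.Gamma_eq_integral hw, Real.Gamma_eq_integral hw, Complex.GammaIntegral]
  refine (norm_integral_le_integral_norm _).trans_eq ?_
  refine setIntegral_congr_fun measurableSet_Ioi fun t ht => ?_
  have ht0 : (0 : ℝ) < t := ht
  rw [norm_mul, Complex.norm_cpow_eq_rpow_re_of_pos ht0, Complex.norm_real,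
    Real.norm_of_nonneg (Real.exp_pos _).le]
  simp

lemma exists_norm_Gamma_le {a : ℝ} (ha : 0 < a) (b : ℝ) :
    ∃ M : ℝ, 0 ≤ M ∧ ∀ w : ℂ, a ≤ w.re → w.re ≤ b → ‖Complex.Gamma w‖ ≤ M := by
  have hc : ContinuousOn Real.Gamma (Set.Icc a b) := fun x hx =>
    (Real.differentiableAt_Gamma fun m h => by
      have h1 : 0 < x := ha.trans_le hx.1
      have h2 : (0 : ℝ) ≤ m := Nat.cast_nonneg m
      linarith).continuousAt.continuousWithinAt
  obtain ⟨M, hM⟩ := isCompact_Icc.exists_bound_of_continuousOn hc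
  refine ⟨|M|, abs_nonneg _, fun w h1 h2 => (norm_Gamma_le (ha.trans_le h1)).trans ?_⟩
  exact (le_abs_self _).trans ((hM w.re ⟨h1, h2⟩).trans (le_abs_self M))

lemma norm_sin_le_exp (z : ℂ) : ‖Complex.sin z‖ ≤ Real.exp |z.im| := by
  rw [Complex.sin, norm_div, norm_mul, Complex.norm_I, mul_one, Complex.norm_ofNat,
    div_le_iff₀ two_pos]
  refine (norm_sub_le _ _).trans ?_
  rw [Complex.norm_exp, Complex.norm_exp]
  have h1 : (-z * I).re ≤ |z.im| := by simp [le_abs_self]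
  have h2 : (z * I).re ≤ |z.im| := by simp [neg_le_abs]
  linarith [Real.exp_le_exp.2 h1, Real.exp_le_exp.2 h2]

/-- Exponential bound for the reciprocal of the Gamma function in a vertical strip. -/
lemma exists_norm_inv_Gamma_le : ∃ C : ℝ, 0 ≤ C ∧ ∀ w : ℂ, -1 ≤ w.re → w.re ≤ 2 → 1 ≤ |w.im| →
    ‖(Complex.Gamma w)⁻¹‖ ≤ C * Real.exp (Real.pi * |w.im|) := by
  obtain ⟨M, hM0, hM⟩ := exists_norm_Gamma_le one_pos 4
  refine ⟨M, hM0, fun w h1 h2 h3 => ?_⟩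
  have hne : ∀ v : ℂ, 1 ≤ |v.im| → v ≠ 0 ∧ 1 ≤ ‖v‖ := fun v hv => by
    have h := hv.trans (Complex.abs_im_le_norm v)
    exact ⟨norm_pos_iff.1 (by linarith), h⟩
  obtain ⟨a1, a2⟩ := hne (1 - w) (by simpa using h3)
  obtain ⟨b1, b2⟩ := hne (2 - w) (by simpa using h3)
  have e1 : Complex.Gamma (3 - w) = (2 - w) * ((1 - w) * Complex.Gamma (1 - w)) := by
    rw [← Complex.Gamma_add_one _ a1, show (1 - w + 1 : ℂ) = 2 - w by ring,
      ← Complex.Gamma_add_one _ b1]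
    congr 1
    ring
  have hw : Complex.Gamma w ≠ 0 := Complex.Gamma_ne_zero fun m h => by
    have := congrArg Complex.im h
    simp only [Complex.neg_im, Complex.natCast_im, neg_zero] at this
    rw [this] at h3
    norm_num at h3
  have hw' : Complex.Gamma (1 - w) ≠ 0 := Complex.Gamma_ne_zero fun m h => by
    have := congrArg Complex.im h
    simp only [Complex.sub_im, Complex.one_im, Complex.neg_im, Complex.natCast_im, neg_zero] at this
    have h0 : w.im = 0 := by linarith
    rw [h0] at h3
    norm_num at h3
  have e2 := Complex.Gamma_mul_Gamma_one_sub w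
  have hpi : (Real.pi : ℂ) ≠ 0 := by exact_mod_cast Real.pi_pos.ne'
  have hsin : Complex.sin (Real.pi * w) ≠ 0 := fun h => by
    rw [h, div_zero] at e2
    exact mul_ne_zero hw hw' e2
  have e3 : (Complex.Gamma w)⁻¹ =
      Complex.Gamma (3 - w) * Complex.sin (Real.pi * w) / (Real.pi * ((2 - w) * (1 - w))) := by
    rw [e1]
    rw [eq_div_iff hsin] at e2
    have e7 : Complex.sin (w * Real.pi) = Complex.sin (Real.pi * w) := by rw [mul_comm]
    field_simp
    rw [e7]
    linear_combination -e2
  have e4 := hM (3 - w) (by simp; linarith) (by simp; linarith)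
  have e5 := norm_sin_le_exp (Real.pi * w)
  have e6 : ((Real.pi : ℂ) * w).im = Real.pi * w.im := by simp
  rw [e6, abs_mul, abs_of_pos Real.pi_pos] at e5
  rw [e3, norm_div, norm_mul, norm_mul, norm_mul, Complex.norm_real,
    Real.norm_of_nonneg Real.pi_pos.le]
  refine (div_le_self (by positivity) ?_).trans (by gcongr)
  have : 1 ≤ Real.pi := by linarith [Real.pi_gt_three]
  nlinarith [one_le_mul_of_one_le_of_one_le b2 a2]

/-- A quotient of Gamma functions in a strip of width one. -/
theorem norm_Gamma_div_Gamma_le {b : ℝ} (hb0 : 0 < b) (hb1 : b ≤ 1) {w : ℂ}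
    (h1 : b / 2 - 1 ≤ w.re) (h2 : w.re ≤ b / 2) :
    ‖Complex.Gamma (b - w) * (Complex.Gamma w)⁻¹‖ ≤ 16 * (1 + |w.im|) ^ (b - 2 * w.re) := by
  set f : ℂ → ℂ := fun w => Complex.Gamma (b - w) * (Complex.Gamma w)⁻¹ with hf
  obtain ⟨C, hC0, hC⟩ := exists_norm_inv_Gamma_le
  obtain ⟨M, hM0, hM⟩ := exists_norm_Gamma_le (half_pos hb0) (b / 2 + 1)
  have hright : ∀ s : ℂ, s.re = b / 2 → ‖f s‖ ≤ 1 := fun s hs => by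
    have e : (b : ℂ) - s = (starRingEnd ℂ) s := by
      apply Complex.ext
      · simp [hs]
        ring
      · simp
    rw [hf]
    dsimp only
    rw [e, Complex.Gamma_conj, norm_mul, norm_inv, RCLike.norm_conj]
    exact mul_inv_le_one
  have hleft : ∀ s : ℂ, s.re = b / 2 - 1 → ‖f s‖ ≤ 1 * (1 + |s.im|) ^ (2 : ℝ) := fun s hs => by
    have hre : ((b : ℂ) - s - 1).re = b / 2 := by simp [hs]; ring
    have hne : (b : ℂ) - s - 1 ≠ 0 := fun h => by rw [h] at hre; simp at hre; linarith
    have e1 := Complex.Gamma_add_one _ hne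
    rw [sub_add_cancel] at e1
    have e2 := Complex.one_div_Gamma_eq_self_mul_one_div_Gamma_add_one s
    have e3 : f s = ((b : ℂ) - s - 1) * s * f (s + 1) := by
      rw [hf]
      dsimp only
      rw [e1, e2, show (b : ℂ) - (s + 1) = b - s - 1 by ring]
      ring
    have e4 := hright (s + 1) (by simp [hs])
    have n1 : ‖(b : ℂ) - s - 1‖ ≤ 1 + |s.im| := by
      refine (Complex.norm_le_abs_re_add_abs_im _).trans ?_
      rw [hre, abs_of_pos (half_pos hb0)]
      simp only [Complex.sub_im, Complex.ofReal_im, Complex.one_im, zero_sub, sub_zero, abs_neg]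
      linarith
    have n2 : ‖s‖ ≤ 1 + |s.im| := by
      refine (Complex.norm_le_abs_re_add_abs_im _).trans ?_
      rw [hs, abs_of_nonpos (by linarith)]
      linarith
    rw [e3, norm_mul, norm_mul, one_mul, Real.rpow_two]
    calc _ ≤ (1 + |s.im|) * (1 + |s.im|) * 1 := by gcongr
      _ = _ := by ring
  have hdiff : DiffContOnCl ℂ f (Complex.re ⁻¹' Set.Ioo (b / 2 - 1) (b / 2)) := by
    refine DifferentiableOn.diffContOnCl fun z hz => DifferentiableAt.differentiableWithinAt ?_
    have hz' : z.re ≤ b / 2 := by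
      have h := closure_mono (Set.preimage_mono
        (Set.Ioo_subset_Icc_self.trans Set.Icc_subset_Iic_self)) hz
      rwa [IsClosed.closure_eq (isClosed_Iic.preimage Complex.continuous_re)] at h
    refine DifferentiableAt.mul ?_ (Complex.differentiable_one_div_Gamma z)
    have hd : DifferentiableAt ℂ Complex.Gamma (b - z) :=
      Complex.differentiableAt_Gamma _ fun m h => by
        have := congrArg Complex.re h
        simp only [Complex.sub_re, Complex.ofReal_re, Complex.neg_re, Complex.natCast_re] at this
        have h0 : (0 : ℝ) ≤ m := Nat.cast_nonneg m
        linarith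
    exact hd.comp z (by fun_prop)
  have hgrow : ∀ s : ℂ, b / 2 - 1 < s.re → s.re < b / 2 → 2 ≤ |s.im| →
      ‖f s‖ ≤ (M * C + Real.pi) * Real.exp ((M * C + Real.pi) * |s.im|) := fun s g1 g2 g3 => by
    have e1 := hM (b - s) (by simp; linarith) (by simp; linarith)
    have e2 := hC s (by linarith) (by linarith) (by linarith)
    have hMC : 0 ≤ M * C := mul_nonneg hM0 hC0
    rw [hf, norm_mul]
    calc _ ≤ M * (C * Real.exp (Real.pi * |s.im|)) := by gcongr
      _ = M * C * Real.exp (Real.pi * |s.im|) := by ring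
      _ ≤ _ := by
        gcongr
        · linarith [Real.pi_pos]
        · linarith
  have key := convexity_bound (k := 2) (l := 0) (A := 1) (B := 1) (by linarith) (by linarith)
    (by norm_num) le_rfl one_pos one_pos hdiff hgrow hleft
    (fun s hs => by simpa using hright s hs) h1 h2
  refine key.trans_eq ?_
  have hT : (0 : ℝ) ≤ 1 + |w.im| := by positivity
  rw [Real.rpow_zero, mul_one, Real.one_rpow, mul_one, one_mul, ← Real.rpow_mul hT]
  congr 1
  · ring_nf
    norm_num
  · congr 1
    ring

end GammaBounds

section ContinuedZeta

lemma one_le_mult (w : InfinitePlace K) : (1 : ℝ) ≤ w.mult := by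
  have := mult_pos' w
  exact_mod_cast this

lemma mult_le_two (w : InfinitePlace K) : (w.mult : ℝ) ≤ 2 := by
  rw [InfinitePlace.mult]
  split_ifs <;> norm_num

variable (K) in
lemma one_le_DK : (1 : ℝ) ≤ DK K := by
  have := DK_pos K
  exact_mod_cast this

variable (K) in
lemma exists_norm_invGammaFactor_le : ∃ C : ℝ, 0 ≤ C ∧ ∀ u : ℂ, -(1 / 2) ≤ u.re → u.re ≤ 1 →
    1 ≤ |u.im| → ‖invGammaFactor K u‖ ≤ C * Real.exp (C * |u.im|) := by
  obtain ⟨C, hC0, hC⟩ := exists_norm_inv_Gamma_le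
  set n := Fintype.card (InfinitePlace K) with hn
  set M : ℝ := (C * (2 * Real.pi) ^ (2 : ℝ)) ^ n with hM
  have hM0 : 0 ≤ M := by positivity
  refine ⟨M + n * (2 * Real.pi), by positivity, fun u h1 h2 h3 => ?_⟩
  have key : ‖invGammaFactor K u‖ ≤
      ∏ _w : InfinitePlace K, (C * (2 * Real.pi) ^ (2 : ℝ) * Real.exp (2 * Real.pi * |u.im|)) := by
    rw [invGammaFactor, norm_prod]
    refine Finset.prod_le_prod (fun _ _ => norm_nonneg _) fun w _ => ?_
    have m1 := one_le_mult w
    have m2 := mult_le_two w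
    have hre : (u * w.mult).re = u.re * w.mult := by simp
    have him : (u * w.mult).im = u.im * w.mult := by simp
    have e1 : |(u * w.mult).im| = |u.im| * w.mult := by
      rw [him, abs_mul, abs_of_nonneg (by linarith : (0 : ℝ) ≤ w.mult)]
    have e2 := hC (u * w.mult) (by rw [hre]; nlinarith) (by rw [hre]; nlinarith)
      (by rw [e1]; nlinarith)
    have hpi : 1 ≤ Real.pi := by linarith [Real.pi_gt_three]
    have e3 : ‖((Real.pi * w.mult : ℝ) : ℂ) ^ (u * w.mult)‖ ≤ (2 * Real.pi) ^ (2 : ℝ) := by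
      rw [Complex.norm_cpow_eq_rpow_re_of_pos (pi_mult_pos w), hre]
      refine (Real.rpow_le_rpow_of_exponent_le (y := u.re * w.mult) (z := 2) (by nlinarith)
        (by nlinarith)).trans ?_
      exact Real.rpow_le_rpow (pi_mult_pos w).le (by nlinarith) (by norm_num)
    rw [norm_mul]
    calc _ ≤ (C * Real.exp (Real.pi * |(u * w.mult).im|)) * (2 * Real.pi) ^ (2 : ℝ) := by gcongr
      _ ≤ (C * Real.exp (2 * Real.pi * |u.im|)) * (2 * Real.pi) ^ (2 : ℝ) := by
        rw [e1]
        gcongr ?_ * ?_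
        gcongr C * Real.exp ?_
        nlinarith [mul_nonneg Real.pi_pos.le (abs_nonneg u.im)]
      _ = _ := by ring
  refine key.trans ?_
  rw [Finset.prod_const, Finset.card_univ, mul_pow, ← Real.exp_nat_mul, ← hn, ← hM]
  have hpi := Real.pi_pos
  have : (0 : ℝ) ≤ n * (2 * Real.pi) := by positivity
  refine mul_le_mul (by linarith) (Real.exp_le_exp.2 ?_) (Real.exp_pos _).le (by linarith)
  nlinarith [abs_nonneg u.im, mul_nonneg hM0 (abs_nonneg u.im)]

variable (K) in
/-- The entire function continuing `s ζ_K(s + 1)`, with its functional equation. -/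
theorem exists_continuedZeta : ∃ z : ℂ → ℂ, Differentiable ℂ z ∧
    (∀ s : ℂ, 0 < s.re → z s = s * zetaSer K (s + 1)) ∧
    (∀ s : ℂ, s.re < -1 → z s = s * (DK K : ℂ) ^ (-(1 / 2) - s) *
      (∏ w : InfinitePlace K, (Complex.Gamma (((w.mult / 2 : ℝ) : ℂ) - (s + 1) / 2 * w.mult) *
        (Complex.Gamma ((s + 1) / 2 * w.mult))⁻¹ *
        ((Real.pi * w.mult : ℝ) : ℂ) ^ ((s + 1 / 2) * w.mult))) * zetaSer K (-s)) ∧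
    ∃ C : ℝ, ∀ s : ℂ, -2 ≤ s.re → s.re ≤ 1 → 2 ≤ |s.im| → ‖z s‖ ≤ C * Real.exp (C * |s.im|) := by
  obtain ⟨L, A, hL, hfe, hbd, hLs⟩ := exists_completed K
  have hD0 : (DK K : ℂ) ≠ 0 := by
    have := DK_pos K
    exact_mod_cast this.ne'
  have hDpos : (0 : ℝ) < DK K := DK_pos K
  set G := invGammaFactor K with hG
  have hGd : Differentiable ℂ G := differentiable_invGammaFactor K
  have hdsl : Differentiable ℂ (dslope G 0) := by
    rw [← differentiableOn_univ]
    exact (Complex.differentiableOn_dslope univ_mem).2 hGd.differentiableOn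
  set z : ℂ → ℂ := fun s => (DK K : ℂ) ^ (-((s + 1) / 2)) *
    ((s * L ((s + 1) / 2) + 2 * A) * G ((s + 1) / 2) - s * A * dslope G 0 ((s + 1) / 2)) with hz
  have hu : Differentiable ℂ fun s : ℂ => (s + 1) / 2 := by fun_prop
  have hzd : Differentiable ℂ z := by
    refine (hu.neg.const_cpow (Or.inl hD0)).mul ((((differentiable_id.mul (hL.comp hu)).add_const
      _).mul (hGd.comp hu)).sub ((differentiable_id.mul_const A).mul (hdsl.comp hu)))
  have hdslope : ∀ u : ℂ, u ≠ 0 → dslope G 0 u = G u / u := fun u hu0 => by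
    rw [dslope_of_ne _ hu0, slope_def_field, hG, invGammaFactor_zero, sub_zero, sub_zero]
  -- the closed form away from the removable singularities
  have hform : ∀ s : ℂ, s ≠ 0 → s + 1 ≠ 0 → z s = s * (DK K : ℂ) ^ (-((s + 1) / 2)) *
      G ((s + 1) / 2) * (L ((s + 1) / 2) - A / ((s + 1) / 2) - A / (1 / 2 - (s + 1) / 2)) := by
    intro s h0 h1
    have h2 : (s + 1) / 2 ≠ 0 := div_ne_zero h1 two_ne_zero
    have h3 : (1 : ℂ) / 2 - (s + 1) / 2 = -(s / 2) := by ring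
    rw [hz]
    dsimp only
    rw [hdslope _ h2, h3]
    field_simp
    ring
  have hreal : ∀ σ : ℝ, 0 < σ → z σ = σ * zetaSer K (σ + 1) := by
    intro σ hσ
    have hu0 : (0 : ℝ) < (σ + 1) / 2 := by linarith
    have h := hLs ((σ + 1) / 2) (by linarith)
    have hg := gammaFactor_mul_inv (K := K) hu0
    have hσ0 : (σ : ℂ) ≠ 0 := by exact_mod_cast hσ.ne'
    have hσ1 : (σ : ℂ) + 1 ≠ 0 := by
      have : σ + 1 ≠ 0 := by linarith
      exact_mod_cast this
    have hzs := zetaSer_ofReal K (σ + 1)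
    rw [show -(2 * ((σ + 1) / 2)) = -(σ + 1) by ring, Complex.ofReal_mul, ← hzs,
      Complex.ofReal_mul, Complex.ofReal_cpow hDpos.le] at h
    push_cast at h hg
    rw [hform σ hσ0 hσ1, h, Complex.cpow_neg]
    have hDs : (DK K : ℂ) ^ (((σ : ℂ) + 1) / 2) ≠ 0 := by
      rw [Complex.cpow_ne_zero_iff]
      exact Or.inl hD0
    field_simp
    linear_combination (zetaSer K (σ + 1)) * hg
  have hpos : ∀ s : ℂ, 0 < s.re → z s = s * zetaSer K (s + 1) := by
    have hopen : IsOpen {s : ℂ | 0 < s.re} := isOpen_lt continuous_const Complex.continuous_re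
    refine eq_of_eq_on_real (a := 0) (convex_halfSpace_re_gt 0).isPreconnected
      hopen hzd.differentiableOn ?_ (fun s hs => show (0 : ℝ) < (s : ℂ).re from hs) hreal
    refine differentiableOn_id.mul ((differentiableOn_zetaSer K).comp
      (differentiable_id.add_const 1).differentiableOn fun s hs => ?_)
    have : 0 < s.re := hs
    simp only [Set.mem_ofPred_eq, Complex.add_re, Complex.one_re]
    linarith
  refine ⟨z, hzd, hpos, fun s hs => ?_, ?_⟩
  · have h0 : s ≠ 0 := fun h => by rw [h] at hs; norm_num at hs
    have h1 : s + 1 ≠ 0 := fun h => by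
      have := congrArg Complex.re h
      simp at this
      linarith
    have h2 : -s - 1 ≠ 0 := fun h => h1 (by linear_combination -h)
    have h3 : -s - 1 + 1 ≠ 0 := fun h => h0 (by linear_combination -h)
    have e1 := hform s h0 h1
    have e2 := hform (-s - 1) h2 h3
    rw [hpos (-s - 1) (by simp; linarith), show (-s - 1 + 1) / 2 = 1 / 2 - (s + 1) / 2 by ring,
      hfe, sub_sub_cancel, sub_add_cancel] at e2
    set u := (s + 1) / 2 with hu'
    have e3 : zetaSer K (-s) = (DK K : ℂ) ^ (-(1 / 2 - u)) * G (1 / 2 - u) *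
        (L u - A / u - A / (1 / 2 - u)) := by
      refine mul_left_cancel₀ h2 (e2.trans ?_)
      ring
    have hprod : (∏ w : InfinitePlace K, (Complex.Gamma (((w.mult / 2 : ℝ) : ℂ) - u * w.mult) *
        (Complex.Gamma (u * w.mult))⁻¹ *
        ((Real.pi * w.mult : ℝ) : ℂ) ^ ((s + 1 / 2) * w.mult))) * G (1 / 2 - u) = G u := by
      rw [hG, invGammaFactor, invGammaFactor, ← Finset.prod_mul_distrib]
      refine Finset.prod_congr rfl fun w _ => ?_
      have m1 := mult_pos' w
      have g1 : ((w.mult / 2 : ℝ) : ℂ) - u * w.mult = (1 / 2 - u) * w.mult := by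
        push_cast
        ring
      have g2 : Complex.Gamma ((1 / 2 - u) * w.mult) ≠ 0 := by
        refine Complex.Gamma_ne_zero_of_re_pos ?_
        have : ((1 / 2 - u) * w.mult).re = -s.re / 2 * w.mult := by
          rw [hu']
          simp
          ring
        rw [this]
        exact mul_pos (by linarith) m1
      have g3 : ((Real.pi * w.mult : ℝ) : ℂ) ≠ 0 := by exact_mod_cast (pi_mult_pos w).ne'
      have g4 : ((Real.pi * w.mult : ℝ) : ℂ) ^ (u * w.mult) =
          ((Real.pi * w.mult : ℝ) : ℂ) ^ ((s + 1 / 2) * w.mult) *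
          ((Real.pi * w.mult : ℝ) : ℂ) ^ ((1 / 2 - u) * w.mult) := by
        rw [← Complex.cpow_add _ _ g3]
        congr 1
        rw [hu']
        ring
      rw [g1, g4]
      generalize Complex.Gamma ((1 / 2 - u) * w.mult) = γ at g2 ⊢
      field_simp
    have hDD : (DK K : ℂ) ^ (-u) =
        (DK K : ℂ) ^ (-(1 / 2) - s) * (DK K : ℂ) ^ (-(1 / 2 - u)) := by
      rw [← Complex.cpow_add _ _ hD0]
      congr 1
      rw [hu']
      ring
    rw [e1, e3, ← hprod, hDD]
    ring
  · obtain ⟨C, hC0, hC⟩ := exists_norm_invGammaFactor_le K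
    obtain ⟨B, hB⟩ := hbd (-(1 / 2)) 1
    set M : ℝ := (DK K : ℝ) ^ (1 / 2 : ℝ) * (2 * (|B| + ‖A‖) + 2 * ‖A‖) * C with hM
    have hM0 : 0 ≤ M := by positivity
    refine ⟨M + (C + 1), fun s h1 h2 h3 => ?_⟩
    set u := (s + 1) / 2 with hu'
    have hure : u.re = (s.re + 1) / 2 := by simp [hu']
    have huim : u.im = s.im / 2 := by simp [hu']
    have huabs : |u.im| = |s.im| / 2 := by rw [huim, abs_div, abs_two]
    have hu1 : 1 ≤ ‖u‖ := le_trans (by rw [huabs]; linarith) (Complex.abs_im_le_norm u)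
    have hu0 : u ≠ 0 := norm_pos_iff.1 (by linarith)
    have e1 := hC u (by rw [hure]; linarith) (by rw [hure]; linarith) (by rw [huabs]; linarith)
    have e2 : ‖L u‖ ≤ |B| := (hB u (by rw [hure]; linarith) (by rw [hure]; linarith)).trans
      (le_abs_self B)
    have e3 : ‖(DK K : ℂ) ^ (-u)‖ ≤ (DK K : ℝ) ^ (1 / 2 : ℝ) := by
      have h := Complex.norm_cpow_eq_rpow_re_of_pos hDpos (-u)
      rw [Complex.ofReal_natCast] at h
      rw [h]
      exact Real.rpow_le_rpow_of_exponent_le (one_le_DK K) (by rw [Complex.neg_re, hure]; linarith)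
    have e4 : ‖s‖ ≤ 2 * Real.exp |s.im| := by
      have g1 := Complex.norm_le_abs_re_add_abs_im s
      have g2 : |s.re| ≤ 2 := abs_le.2 ⟨h1, by linarith⟩
      linarith [Real.add_one_le_exp |s.im|]
    have e5 : 1 ≤ Real.exp |s.im| := Real.one_le_exp (abs_nonneg _)
    have e6 : ‖s * A * dslope G 0 u‖ ≤ ‖s‖ * ‖A‖ * ‖G u‖ := by
      rw [hdslope u hu0, norm_mul, norm_mul, norm_div]
      gcongr
      exact div_le_self (norm_nonneg _) hu1
    have e7 : ‖(s * L u + 2 * A) * G u‖ ≤ (‖s‖ * |B| + 2 * ‖A‖) * ‖G u‖ := by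
      rw [norm_mul]
      gcongr
      refine (norm_add_le _ _).trans ?_
      rw [norm_mul, norm_mul, Complex.norm_ofNat]
      gcongr
    have e8 : ‖z s‖ ≤ (DK K : ℝ) ^ (1 / 2 : ℝ) *
        ((‖s‖ * |B| + 2 * ‖A‖) * ‖G u‖ + ‖s‖ * ‖A‖ * ‖G u‖) := by
      rw [hz]
      dsimp only
      rw [← hu', norm_mul]
      gcongr
      exact (norm_sub_le _ _).trans (add_le_add e7 e6)
    calc ‖z s‖ ≤ (DK K : ℝ) ^ (1 / 2 : ℝ) *
          ((‖s‖ * |B| + 2 * ‖A‖) * ‖G u‖ + ‖s‖ * ‖A‖ * ‖G u‖) := e8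
      _ = (DK K : ℝ) ^ (1 / 2 : ℝ) * (‖s‖ * (|B| + ‖A‖) + 2 * ‖A‖ * 1) * ‖G u‖ := by ring
      _ ≤ (DK K : ℝ) ^ (1 / 2 : ℝ) * (2 * Real.exp |s.im| * (|B| + ‖A‖) +
          2 * ‖A‖ * Real.exp |s.im|) * (C * Real.exp (C * |u.im|)) := by gcongr
      _ = M * (Real.exp |s.im| * Real.exp (C * |u.im|)) := by rw [hM]; ring
      _ ≤ (M + (C + 1)) * Real.exp ((M + (C + 1)) * |s.im|) := by
        rw [← Real.exp_add, huabs]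
        refine mul_le_mul (by linarith) (Real.exp_le_exp.2 ?_) (Real.exp_pos _).le (by linarith)
        nlinarith [abs_nonneg s.im, mul_nonneg hM0 (abs_nonneg s.im),
          mul_nonneg hC0 (abs_nonneg s.im)]

end ContinuedZeta

section ZetaGrowth

variable (K) in
lemma card_infinitePlace_le : Fintype.card (InfinitePlace K) ≤ nK K := by
  have h : (Fintype.card (InfinitePlace K) : ℝ) ≤ nK K := by
    rw [← sum_mult (K := K)]
    calc (Fintype.card (InfinitePlace K) : ℝ) = ∑ _w : InfinitePlace K, (1 : ℝ) := by simp
      _ ≤ _ := Finset.sum_le_sum fun w _ => one_le_mult w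
  exact_mod_cast h

variable (K) in
/-- The archimedean factor of the functional equation, to the left of the critical strip. -/
lemma norm_prod_Gamma_le {δ : ℝ} (hδ0 : 0 < δ) (hδ : δ ≤ 1 / 4) {s : ℂ} (hs : s.re = -1 - δ) :
    ‖∏ w : InfinitePlace K, (Complex.Gamma (((w.mult / 2 : ℝ) : ℂ) - (s + 1) / 2 * w.mult) *
        (Complex.Gamma ((s + 1) / 2 * w.mult))⁻¹ *
        ((Real.pi * w.mult : ℝ) : ℂ) ^ ((s + 1 / 2) * w.mult))‖ ≤
      16 ^ nK K * (1 + |s.im|) ^ (nK K * (1 / 2 + δ)) := by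
  have hT : (0 : ℝ) < 1 + |s.im| := by positivity
  have key : ∀ w : InfinitePlace K,
      ‖Complex.Gamma (((w.mult / 2 : ℝ) : ℂ) - (s + 1) / 2 * w.mult) *
        (Complex.Gamma ((s + 1) / 2 * w.mult))⁻¹ *
        ((Real.pi * w.mult : ℝ) : ℂ) ^ ((s + 1 / 2) * w.mult)‖ ≤
      16 * (1 + |s.im|) ^ (w.mult * (1 / 2 + δ)) := fun w => by
    have m1 := one_le_mult w
    have m2 := mult_le_two w
    have hre : ((s + 1) / 2 * w.mult).re = -(δ / 2 * w.mult) := by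
      simp [hs]
      ring
    have him : ((s + 1) / 2 * w.mult).im = s.im * (w.mult / 2) := by
      simp
      ring
    have h1 := norm_Gamma_div_Gamma_le (b := w.mult / 2) (w := (s + 1) / 2 * w.mult)
      (by linarith) (by linarith) (by rw [hre]; nlinarith) (by rw [hre]; nlinarith)
    have h2 : ‖((Real.pi * w.mult : ℝ) : ℂ) ^ ((s + 1 / 2) * w.mult)‖ ≤ 1 := by
      rw [Complex.norm_cpow_eq_rpow_re_of_pos (pi_mult_pos w)]
      refine Real.rpow_le_one_of_one_le_of_nonpos ?_ ?_
      · nlinarith [Real.pi_gt_three]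
      · have : ((s + 1 / 2) * w.mult).re = (-(1 / 2) - δ) * w.mult := by
          simp [hs]
          ring
        rw [this]
        nlinarith
    rw [norm_mul]
    refine (mul_le_of_le_one_right (norm_nonneg _) h2).trans (h1.trans ?_)
    have e1 : (w.mult / 2 : ℝ) - 2 * ((s + 1) / 2 * w.mult).re = w.mult * (1 / 2 + δ) := by
      rw [hre]
      ring
    rw [e1]
    refine mul_le_mul_of_nonneg_left (Real.rpow_le_rpow (by positivity) ?_ (by positivity))
      (by norm_num)
    rw [him, abs_mul, abs_of_pos (by linarith : (0 : ℝ) < w.mult / 2)]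
    linarith [mul_le_of_le_one_right (abs_nonneg s.im) (by linarith : (w.mult / 2 : ℝ) ≤ 1)]
  rw [norm_prod]
  refine (Finset.prod_le_prod (fun _ _ => norm_nonneg _) fun w _ => key w).trans ?_
  rw [Finset.prod_mul_distrib, Finset.prod_const, Finset.card_univ,
    ← Real.rpow_sum_of_pos hT, ← Finset.sum_mul, sum_mult]
  gcongr
  · norm_num
  · exact card_infinitePlace_le K

/-- Convexity bound for the Dedekind zeta function, on the critical line and in the strip. -/
theorem exists_continuedZeta_bounds {δ : ℝ} (hδ0 : 0 < δ) (hδ : δ ≤ 1 / 4) :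
    ∃ C : ℝ, 1 ≤ C ∧ ∀ (K : Type) [Field K] [NumberField K], ∃ z : ℂ → ℂ, Differentiable ℂ z ∧
      (∀ s : ℂ, 0 < s.re → z s = s * zetaSer K (s + 1)) ∧
      (∀ s : ℂ, s.re = -(1 / 2) → ‖z s‖ ≤ C ^ nK K * (1 + |s.im|) *
        ((DK K : ℝ) * (1 + |s.im|) ^ nK K) ^ (1 / 4 + δ / 2)) ∧
      ∃ M : ℝ, 0 ≤ M ∧ ∀ s : ℂ, -(1 / 2) ≤ s.re → s.re ≤ δ →
        ‖z s‖ ≤ M * (1 + |s.im|) ^ (nK K + 1) := by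
  set Z := zetaReal (1 + δ) with hZ
  have hZ1 : 1 ≤ Z := one_le_zetaReal (by linarith)
  refine ⟨216 * (8 * Z), by linarith, fun K _ _ => ?_⟩
  obtain ⟨z, hzd, hz0, hzfe, C, hC⟩ := exists_continuedZeta K
  set n := nK K with hn
  have hn1 : (1 : ℝ) ≤ n := by
    have := nK_pos (K := K)
    exact_mod_cast this
  have hD := one_le_DK K
  set A : ℝ := 2 * (16 * Z) ^ n * (DK K : ℝ) ^ (1 / 2 + δ) with hA
  set B : ℝ := 2 * Z ^ n with hB
  set k : ℝ := 1 + n * (1 / 2 + δ) with hk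
  have hk0 : 0 ≤ k := by positivity
  have hkn : k ≤ n + 1 := by nlinarith
  have hA1 : 1 ≤ A := by
    have h1 : 1 ≤ (16 * Z) ^ n := one_le_pow₀ (by linarith)
    have h2 : 1 ≤ (DK K : ℝ) ^ (1 / 2 + δ) := Real.one_le_rpow hD (by linarith)
    nlinarith [one_le_mul_of_one_le_of_one_le h1 h2]
  have hB1 : 1 ≤ B := by
    have h1 : 1 ≤ Z ^ n := one_le_pow₀ hZ1
    linarith
  have hleft : ∀ s : ℂ, s.re = -1 - δ → ‖z s‖ ≤ A * (1 + |s.im|) ^ k := fun s hs => by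
    have hT : (0 : ℝ) < 1 + |s.im| := by positivity
    have e1 := norm_prod_Gamma_le K hδ0 hδ hs
    have e2 : ‖s‖ ≤ 2 * (1 + |s.im|) := by
      refine (Complex.norm_le_abs_re_add_abs_im s).trans ?_
      rw [hs, abs_of_neg (by linarith)]
      linarith [abs_nonneg s.im]
    have e3 : ‖zetaSer K (-s)‖ ≤ Z ^ n := by
      have hre : (-s).re = 1 + δ := by rw [Complex.neg_re, hs]; ring
      have := norm_zetaSer_le K (s := -s) (by rw [hre]; linarith)
      rwa [hre] at this
    have e4 : ‖(DK K : ℂ) ^ (-(1 / 2) - s)‖ = (DK K : ℝ) ^ (1 / 2 + δ) := by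
      have h := Complex.norm_cpow_eq_rpow_re_of_pos (by linarith : (0 : ℝ) < DK K) (-(1 / 2) - s)
      rw [Complex.ofReal_natCast] at h
      rw [h]
      congr 1
      simp [hs]
      ring
    rw [hzfe s (by linarith), norm_mul, norm_mul, norm_mul, e4]
    calc _ ≤ (2 * (1 + |s.im|)) * (DK K : ℝ) ^ (1 / 2 + δ) *
          (16 ^ n * (1 + |s.im|) ^ (n * (1 / 2 + δ))) * Z ^ n := by gcongr
      _ = A * ((1 + |s.im|) ^ (1 : ℝ) * (1 + |s.im|) ^ (n * (1 / 2 + δ))) := by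
        rw [hA, mul_pow, Real.rpow_one]
        ring
      _ = A * (1 + |s.im|) ^ k := by rw [← Real.rpow_add hT]
  have hright : ∀ s : ℂ, s.re = δ → ‖z s‖ ≤ B * (1 + |s.im|) ^ (1 : ℝ) := fun s hs => by
    have e2 : ‖s‖ ≤ 1 + |s.im| := by
      refine (Complex.norm_le_abs_re_add_abs_im s).trans ?_
      rw [hs, abs_of_pos hδ0]
      linarith
    have e3 : ‖zetaSer K (s + 1)‖ ≤ Z ^ n := by
      have hre : (s + 1).re = 1 + δ := by simp [hs]; ring
      have := norm_zetaSer_le K (s := s + 1) (by rw [hre]; linarith)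
      rwa [hre] at this
    rw [hz0 s (by linarith), norm_mul, Real.rpow_one]
    have hZn : 0 ≤ Z ^ n := by positivity
    calc _ ≤ (1 + |s.im|) * Z ^ n := by gcongr
      _ ≤ _ := by rw [hB]; nlinarith [abs_nonneg s.im, mul_nonneg (abs_nonneg s.im) hZn]
  have hconv : ∀ s : ℂ, -1 - δ ≤ s.re → s.re ≤ δ → _ := fun s h1 h2 =>
    convexity_bound (a := -1 - δ) (b := δ) (k := k) (l := 1) (A := A) (B := B) (C := C)
      (f := z) (s := s) (by linarith) (by linarith) hk0 zero_le_one (by linarith) (by linarith)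
      hzd.diffContOnCl
      (fun s h1 h2 h3 => hC s (by linarith) (by linarith) h3) hleft hright h1 h2
  refine ⟨z, hzd, hz0, fun s hs => ?_, (2 * (1 + δ - (-1 - δ))) ^ (k + 1) * (A * B),
    by have : 0 ≤ A * B := by positivity
       have : 0 ≤ 2 * (1 + δ - (-1 - δ)) := by linarith
       positivity, fun s h1 h2 => ?_⟩
  · have h := hconv s (by linarith) (by linarith)
    have hT : (0 : ℝ) < 1 + |s.im| := by positivity
    have hw : δ - (-1 - δ) ≠ 0 := by linarith
    have q1 : (δ - s.re) / (δ - (-1 - δ)) = 1 / 2 := by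
      rw [hs, div_eq_div_iff hw two_ne_zero]; ring
    have q2 : (s.re - (-1 - δ)) / (δ - (-1 - δ)) = 1 / 2 := by
      rw [hs, div_eq_div_iff hw two_ne_zero]; ring
    rw [q1, q2, ← Real.mul_rpow (by positivity) (by positivity)] at h
    have q3 : (2 * (1 + δ - (-1 - δ))) ^ (k + 1) ≤ (216 : ℝ) ^ n := by
      calc (2 * (1 + δ - (-1 - δ))) ^ (k + 1) ≤ (6 : ℝ) ^ (k + 1) :=
            Real.rpow_le_rpow (by linarith) (by linarith) (by linarith)
        _ ≤ (6 : ℝ) ^ ((3 * n : ℕ) : ℝ) := by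
            refine Real.rpow_le_rpow_of_exponent_le (by norm_num) ?_
            push_cast
            linarith
        _ = (216 : ℝ) ^ n := by rw [Real.rpow_natCast, pow_mul]; norm_num
    have q4 : (A * (1 + |s.im|) ^ k * (B * (1 + |s.im|) ^ (1 : ℝ))) ^ (1 / 2 : ℝ) ≤
        (8 * Z) ^ n * ((1 + |s.im|) * ((DK K : ℝ) * (1 + |s.im|) ^ n) ^ (1 / 4 + δ / 2)) := by
      have e1 : (((DK K : ℝ) * (1 + |s.im|) ^ n) ^ (1 / 4 + δ / 2)) ^ 2 =
          (DK K : ℝ) ^ (1 / 2 + δ) * (1 + |s.im|) ^ (n * (1 / 2 + δ)) := by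
        rw [← Real.rpow_natCast, ← Real.rpow_mul (by positivity),
          Real.mul_rpow (by positivity) (by positivity), ← Real.rpow_natCast (1 + |s.im|),
          ← Real.rpow_mul hT.le]
        push_cast
        congr 2 <;> ring
      have e2 : (4 : ℝ) ≤ 4 ^ n := by
        have : n ≠ 0 := (nK_pos (K := K)).ne'
        exact le_self_pow₀ (by norm_num) this
      have e3 : (1 + |s.im|) ^ k = (1 + |s.im|) * (1 + |s.im|) ^ (n * (1 / 2 + δ)) := by
        rw [hk, Real.rpow_add hT, Real.rpow_one]
      have e4 : (8 * Z) ^ n * (8 * Z) ^ n = 4 ^ n * ((16 * Z) ^ n * Z ^ n) := by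
        rw [← mul_pow, ← mul_pow, ← mul_pow]
        congr 1
        ring
      rw [← Real.sqrt_eq_rpow, Real.sqrt_le_iff]
      refine ⟨by positivity, ?_⟩
      rw [mul_pow, mul_pow (1 + |s.im|), e1, e3, Real.rpow_one, hA, hB, sq ((8 * Z) ^ n), e4]
      calc _ = 4 * ((16 * Z) ^ n * Z ^ n) * ((1 + |s.im|) ^ 2 *
            ((DK K : ℝ) ^ (1 / 2 + δ) * (1 + |s.im|) ^ (n * (1 / 2 + δ)))) := by ring
        _ ≤ _ := by gcongr
    calc ‖z s‖ ≤ _ := h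
      _ ≤ (216 : ℝ) ^ n * ((8 * Z) ^ n * ((1 + |s.im|) *
          ((DK K : ℝ) * (1 + |s.im|) ^ n) ^ (1 / 4 + δ / 2))) := by gcongr
      _ = _ := by rw [mul_pow 216 (8 * Z)]; ring
  · have h := hconv s (by linarith) (by linarith)
    have hT : (1 : ℝ) ≤ 1 + |s.im| := by linarith [abs_nonneg s.im]
    have hw : 0 < δ - (-1 - δ) := by linarith
    set θ := (δ - s.re) / (δ - (-1 - δ)) with hθ
    have q2 : (s.re - (-1 - δ)) / (δ - (-1 - δ)) = 1 - θ := by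
      rw [hθ, eq_sub_iff_add_eq, ← add_div, div_eq_one_iff_eq hw.ne']
      ring
    have hθ0 : 0 ≤ θ := div_nonneg (by linarith) hw.le
    have hθ1 : θ ≤ 1 := by rw [hθ, div_le_one hw]; linarith
    rw [q2] at h
    have q0 : (0 : ℝ) ≤ 2 * (1 + δ - (-1 - δ)) := by linarith
    refine h.trans ?_
    rw [mul_assoc ((2 * (1 + δ - (-1 - δ))) ^ (k + 1))]
    refine mul_le_mul_of_nonneg_left ?_ (by positivity)
    have r1 : (A * (1 + |s.im|) ^ k) ^ θ ≤ A * ((1 + |s.im|) ^ (n + 1)) ^ θ := by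
      rw [Real.mul_rpow (by positivity) (by positivity)]
      gcongr
      · exact Real.rpow_le_self_of_one_le hA1 hθ1
      · rw [← Real.rpow_natCast]
        exact Real.rpow_le_rpow_of_exponent_le hT (by push_cast; linarith)
    have r2 : (B * (1 + |s.im|) ^ (1 : ℝ)) ^ (1 - θ) ≤ B * ((1 + |s.im|) ^ (n + 1)) ^ (1 - θ) := by
      rw [Real.mul_rpow (by positivity) (by positivity)]
      have : 0 ≤ 1 - θ := by linarith
      gcongr
      · exact Real.rpow_le_self_of_one_le hB1 (by linarith)
      · rw [← Real.rpow_natCast]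
        exact Real.rpow_le_rpow_of_exponent_le hT (by push_cast; linarith)
    calc _ ≤ (A * ((1 + |s.im|) ^ (n + 1)) ^ θ) * (B * ((1 + |s.im|) ^ (n + 1)) ^ (1 - θ)) :=
          mul_le_mul r1 r2 (by positivity) (by positivity)
      _ = A * B * (((1 + |s.im|) ^ (n + 1)) ^ θ * ((1 + |s.im|) ^ (n + 1)) ^ (1 - θ)) := by ring
      _ = A * B * (1 + |s.im|) ^ (n + 1) := by
        rw [← Real.rpow_add (by positivity), add_sub_cancel, Real.rpow_one]

end ZetaGrowth

section RieszKernel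

open MeasureTheory

/-- `s` times the Mellin transform of `u ↦ (1 - u)₊ ^ n`. -/
def rieszKernel (n : ℕ) (s : ℂ) : ℂ := ∏ j ∈ Finset.range n, ((j + 1 : ℂ) / (s + (j + 1)))

/-- The Riesz weight `(1 - u)₊ ^ n`. -/
def rieszWeight (n : ℕ) (u : ℝ) : ℝ := max 0 (1 - u) ^ n

lemma rieszKernel_eq (n : ℕ) (s : ℂ) :
    rieszKernel n s = (n.factorial : ℂ) / ∏ j ∈ Finset.range n, (s + (j + 1)) := by
  rw [rieszKernel, Finset.prod_div_distrib, ← Finset.prod_range_add_one_eq_factorial]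
  push_cast
  rfl

lemma rieszKernel_zero (n : ℕ) : rieszKernel n 0 = 1 := by
  refine Finset.prod_eq_one fun j _ => ?_
  have : (j + 1 : ℂ) ≠ 0 := by exact_mod_cast Nat.succ_ne_zero j
  rw [zero_add, div_self this]

lemma add_natCast_add_one_ne_zero {s : ℂ} (hs : -1 < s.re) (j : ℕ) : s + (j + 1) ≠ 0 := by
  intro h
  have := congrArg Complex.re h
  simp at this
  have hj : (0 : ℝ) ≤ j := j.cast_nonneg
  linarith

lemma differentiableAt_rieszKernel (n : ℕ) {s : ℂ} (hs : -1 < s.re) :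
    DifferentiableAt ℂ (rieszKernel n) s := by
  unfold rieszKernel
  refine DifferentiableAt.fun_finsetProd fun j _ => ?_
  exact (differentiableAt_const _).div (by fun_prop) (add_natCast_add_one_ne_zero hs j)

lemma hasDerivAt_rieszKernel_zero (n : ℕ) :
    HasDerivAt (rieszKernel n) (-((∑ j ∈ Finset.Icc 1 n, (1 : ℝ) / j : ℝ) : ℂ)) 0 := by
  induction n with
  | zero =>
    have : rieszKernel 0 = fun _ => 1 := by
      ext s
      simp [rieszKernel]
    simpa [this] using hasDerivAt_const (0 : ℂ) (1 : ℂ)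
  | succ n ih =>
    have e : rieszKernel (n + 1) = fun s => rieszKernel n s * ((n + 1 : ℂ) / (s + (n + 1))) := by
      ext s
      rw [rieszKernel, Finset.prod_range_succ, ← rieszKernel]
    have hn : (n + 1 : ℂ) ≠ 0 := by exact_mod_cast Nat.succ_ne_zero n
    have h := (hasDerivAt_const (0 : ℂ) (n + 1 : ℂ)).div ((hasDerivAt_id (0 : ℂ)).add_const (n + 1 : ℂ))
      (by simpa using hn)
    rw [e]
    refine (ih.mul h).congr_deriv ?_
    rw [rieszKernel_zero, Finset.sum_Icc_succ_top (by omega)]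
    simp only [id, Pi.div_apply, zero_add]
    push_cast
    field_simp
    ring

lemma norm_rieszKernel_le (n : ℕ) {a : ℝ} (ha0 : 0 ≤ a) (ha1 : a ≤ 1) {s : ℂ}
    (hs : -(1 / 2) ≤ s.re) :
    ‖rieszKernel n s‖ ≤ 4 ^ n * (n.factorial : ℝ) ^ a * ((1 + |s.im|) ^ a)⁻¹ ^ n := by
  have hT : (0 : ℝ) < 1 + |s.im| := by positivity
  have key : ∀ j ∈ Finset.range n, ‖(j + 1 : ℂ) / (s + (j + 1))‖ ≤
      4 * (((j + 1 : ℕ) : ℝ) ^ a) * ((1 + |s.im|) ^ a)⁻¹ := fun j _ => by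
    have hj : (0 : ℝ) ≤ j := j.cast_nonneg
    have hj1 : (0 : ℝ) < j + 1 := by linarith
    have hre : (s + (j + 1)).re = s.re + (j + 1) := by simp
    have him : (s + (j + 1)).im = s.im := by simp
    have h1 : |(s + (j + 1)).re| ≤ _ := Complex.abs_re_le_norm (s + (j + 1))
    have h2 : |(s + (j + 1)).im| ≤ _ := Complex.abs_im_le_norm (s + (j + 1))
    rw [hre] at h1
    rw [him] at h2
    have h3 := le_abs_self (s.re + (j + 1))
    have h4 : (1 / 4 : ℝ) * (j + 1 + |s.im|) ≤ ‖s + (j + 1)‖ := by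
      have := abs_nonneg s.im
      linarith
    have h5 : ((j + 1 : ℝ)) ^ (1 - a) * (1 + |s.im|) ^ a ≤ j + 1 + |s.im| := by
      have hpos : (0 : ℝ) < j + 1 + |s.im| := by positivity
      calc ((j + 1 : ℝ)) ^ (1 - a) * (1 + |s.im|) ^ a
          ≤ (j + 1 + |s.im|) ^ (1 - a) * (j + 1 + |s.im|) ^ a := by
            refine mul_le_mul (Real.rpow_le_rpow hj1.le ?_ (by linarith))
              (Real.rpow_le_rpow hT.le ?_ ha0) (by positivity) (by positivity)
            · linarith [abs_nonneg s.im]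
            · linarith
        _ = j + 1 + |s.im| := by
            rw [← Real.rpow_add hpos, sub_add_cancel, Real.rpow_one]
    have h6 : ‖(j + 1 : ℂ)‖ = j + 1 := by
      rw [← Nat.cast_succ, Complex.norm_natCast]
      push_cast
      rfl
    have h7 : ((j + 1 : ℝ)) ^ (1 - a) * (j + 1 : ℝ) ^ a = j + 1 := by
      rw [← Real.rpow_add hj1, sub_add_cancel, Real.rpow_one]
    rw [norm_div, h6, div_le_iff₀ (lt_of_lt_of_le (by positivity) h4)]
    push_cast
    have hpa : (0 : ℝ) < (1 + |s.im|) ^ a := by positivity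
    calc (j + 1 : ℝ) = 4 * (j + 1 : ℝ) ^ a * ((1 + |s.im|) ^ a)⁻¹ *
          (1 / 4 * ((j + 1 : ℝ) ^ (1 - a) * (1 + |s.im|) ^ a)) := by
          field_simp
          linarith
      _ ≤ 4 * (j + 1 : ℝ) ^ a * ((1 + |s.im|) ^ a)⁻¹ * ‖s + (j + 1)‖ := by
          gcongr
          linarith
  rw [rieszKernel, norm_prod]
  refine (Finset.prod_le_prod (fun _ _ => norm_nonneg _) key).trans (le_of_eq ?_)
  rw [Finset.prod_mul_distrib, Finset.prod_mul_distrib, Finset.prod_const, Finset.prod_const,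
    Finset.card_range, Real.finsetProd_rpow _ _ (fun _ _ => by positivity),
    ← Finset.prod_range_add_one_eq_factorial]
  push_cast
  rfl

lemma rieszWeight_of_one_le {n : ℕ} (hn : n ≠ 0) {u : ℝ} (hu : 1 ≤ u) : rieszWeight n u = 0 := by
  rw [rieszWeight, max_eq_left (by linarith), zero_pow hn]

lemma rieszWeight_of_le_one (n : ℕ) {u : ℝ} (hu : u ≤ 1) : rieszWeight n u = (1 - u) ^ n := by
  rw [rieszWeight, max_eq_right (by linarith)]

lemma continuous_rieszWeight (n : ℕ) : Continuous (rieszWeight n) := by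
  unfold rieszWeight
  fun_prop

lemma mellinConvergent_rieszWeight {n : ℕ} (hn : n ≠ 0) {s : ℂ} (hs : 0 < s.re) :
    MellinConvergent (fun u => (rieszWeight n u : ℂ)) s := by
  have h := Complex.betaIntegral_convergent hs (v := n + 1) (by simp; positivity)
  rw [intervalIntegrable_iff_integrableOn_Ioc_of_le zero_le_one] at h
  have h' : IntegrableOn (fun u : ℝ => (u : ℂ) ^ (s - 1) • (rieszWeight n u : ℂ))
      (Set.Ioc 0 1) := by
    refine h.congr_fun (fun u hu => ?_) measurableSet_Ioc
    simp [rieszWeight_of_le_one n hu.2]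
  refine h'.of_forall_sdiff_eq_zero measurableSet_Ioi fun u hu => ?_
  have : 1 < u := by
    by_contra! hc
    exact hu.2 ⟨hu.1, hc⟩
  simp [rieszWeight_of_one_le hn this.le]

lemma mellin_rieszWeight {n : ℕ} (hn : n ≠ 0) {s : ℂ} (hs : 0 < s.re) :
    mellin (fun u => (rieszWeight n u : ℂ)) s = rieszKernel n s / s := by
  have h : Complex.betaIntegral s (n + 1) = mellin (fun u => (rieszWeight n u : ℂ)) s := by
    rw [Complex.betaIntegral, intervalIntegral.integral_of_le zero_le_one, mellin,
      setIntegral_congr_fun (g := fun u : ℝ => (u : ℂ) ^ (s - 1) • (rieszWeight n u : ℂ))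
        measurableSet_Ioc fun u hu => ?_]
    · refine (setIntegral_eq_of_subset_of_forall_sdiff_eq_zero measurableSet_Ioi
        Set.Ioc_subset_Ioi_self fun u hu => ?_).symm
      have : 1 < u := by
        by_contra! hc
        exact hu.2 ⟨hu.1, hc⟩
      simp [rieszWeight_of_one_le hn this.le]
    · simp [rieszWeight_of_le_one n hu.2]
  rw [← h, Complex.betaIntegral_eval_nat_add_one_right hs, Finset.prod_range_succ', rieszKernel_eq,
    div_div]
  simp

lemma norm_inv_le_of_re_ne_zero {c : ℝ} (hc0 : c ≠ 0) (hc : |c| ≤ 1) (t : ℝ) :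
    ‖(c + t * I : ℂ)‖⁻¹ ≤ 2 / |c| * (1 + |t|)⁻¹ := by
  have hc1 : 0 < |c| := abs_pos.mpr hc0
  have h1 : |c| ≤ ‖(c + t * I : ℂ)‖ := by simpa using Complex.abs_re_le_norm (c + t * I : ℂ)
  have h2 : |t| ≤ ‖(c + t * I : ℂ)‖ := by simpa using Complex.abs_im_le_norm (c + t * I : ℂ)
  have h3 : |c| / 2 * (1 + |t|) ≤ ‖(c + t * I : ℂ)‖ := by
    nlinarith [abs_nonneg t]
  calc ‖(c + t * I : ℂ)‖⁻¹ ≤ (|c| / 2 * (1 + |t|))⁻¹ := by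
        apply inv_anti₀ (by positivity) h3
    _ = _ := by rw [mul_inv, inv_div]

lemma integrable_one_add_abs_rpow {r : ℝ} (hr : 1 < r) :
    Integrable fun t : ℝ => (1 + |t|) ^ (-r) := by
  simpa using integrable_one_add_norm (E := ℝ) (μ := volume) (r := r) (by simpa using hr)

lemma integrable_rieszKernel_div {n : ℕ} (hn : n ≠ 0) {c : ℝ} (hc0 : 0 < c) (hc : c ≤ 1) :
    Integrable fun t : ℝ => rieszKernel n (c + t * I) / (c + t * I) := by
  refine ((integrable_one_add_abs_rpow one_lt_two).const_mul
    (4 ^ n * (n.factorial : ℝ) * (2 / |c|))).mono' ?_ (Eventually.of_forall fun t => ?_)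
  · refine Continuous.aestronglyMeasurable (continuous_iff_continuousAt.mpr fun t => ?_)
    have hne : (c + t * I : ℂ) ≠ 0 := by
      intro h
      have := congrArg Complex.re h
      simp at this
      exact hc0.ne' this
    refine ContinuousAt.div ?_ (by fun_prop) hne
    exact (differentiableAt_rieszKernel n (s := c + t * I)
      (by simp; linarith)).continuousAt.comp (f := fun t : ℝ => (c + t * I : ℂ)) (by fun_prop)
  · have hT : (1 : ℝ) ≤ 1 + |t| := by linarith [abs_nonneg t]
    have h1 := norm_rieszKernel_le n zero_le_one le_rfl (s := c + t * I) (by simp; linarith)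
    have h2 := norm_inv_le_of_re_ne_zero hc0.ne' (by rwa [abs_of_pos hc0]) t
    simp only [Real.rpow_one] at h1
    have him : (c + t * I : ℂ).im = t := by simp
    rw [him] at h1
    have h3 : (1 + |t|)⁻¹ ^ n ≤ (1 + |t|)⁻¹ :=
      pow_le_of_le_one (by positivity) (inv_le_one_of_one_le₀ hT) hn
    rw [div_eq_mul_inv, norm_mul, norm_inv]
    calc _ ≤ 4 ^ n * (n.factorial : ℝ) * (1 + |t|)⁻¹ * (2 / |c| * (1 + |t|)⁻¹) := by
          refine mul_le_mul (h1.trans ?_) h2 (by positivity) (by positivity)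
          gcongr
      _ = _ := by
          rw [Real.rpow_neg (by positivity), Real.rpow_two]
          field_simp

/-- Mellin inversion for the Riesz weight. -/
lemma integral_rieszKernel {n : ℕ} (hn : n ≠ 0) {c : ℝ} (hc0 : 0 < c) (hc : c ≤ 1) {u : ℝ}
    (hu : 0 < u) :
    ∫ t : ℝ, (u : ℂ) ^ (-(c + t * I : ℂ)) * (rieszKernel n (c + t * I) / (c + t * I)) =
      2 * Real.pi * rieszWeight n u := by
  have hm : ∀ t : ℝ, mellin (fun u => (rieszWeight n u : ℂ)) (c + t * I) =
      rieszKernel n (c + t * I) / (c + t * I) := fun t =>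
    mellin_rieszWeight hn (by simpa using hc0)
  have h := mellinInv_mellin_eq c (fun u => (rieszWeight n u : ℂ)) hu
    (mellinConvergent_rieszWeight hn (by simpa using hc0))
    ((integrable_rieszKernel_div hn hc0 hc).congr (Eventually.of_forall fun t => (hm t).symm))
    (Complex.continuous_ofReal.comp (continuous_rieszWeight n)).continuousAt
  simp only [mellinInv, hm, smul_eq_mul] at h
  rw [← h]
  rw [Complex.real_smul]
  push_cast
  rw [← mul_assoc, mul_one_div_cancel (by simp), one_mul]

end RieszKernel

section VerticalContours

open MeasureTheory

/-- Shifting a vertical contour for a function decaying at the ends of the strip. -/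
lemma integral_vertical_eq {a b M : ℝ} (hab : a ≤ b) {R : ℂ → ℂ}
    (hR : ∀ s : ℂ, a ≤ s.re → s.re ≤ b → DifferentiableAt ℂ R s)
    (hM : ∀ s : ℂ, a ≤ s.re → s.re ≤ b → 1 ≤ |s.im| → ‖R s‖ ≤ M / |s.im|)
    (ha : Integrable fun t : ℝ => R (a + t * I)) (hb : Integrable fun t : ℝ => R (b + t * I)) :
    ∫ t : ℝ, R (a + t * I) = ∫ t : ℝ, R (b + t * I) := by
  have hT := tendsto_id (α := ℝ) (x := atTop)
  have hT' := tendsto_neg_atTop_atBot (G := ℝ)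
  have la := intervalIntegral_tendsto_integral ha hT' hT
  have lb := intervalIntegral_tendsto_integral hb hT' hT
  have l0 : Tendsto (fun T : ℝ => 2 * (M / T * |b - a|)) atTop (𝓝 0) := by
    simpa using ((tendsto_const_nhds (x := M)).div_atTop hT).mul_const |b - a| |>.const_mul 2
  have hz : Tendsto (fun T : ℝ => (∫ t in -T..T, R (b + t * I)) - ∫ t in -T..T, R (a + t * I))
      atTop (𝓝 0) := by
    refine squeeze_zero_norm' ?_ l0
    filter_upwards [eventually_ge_atTop 1] with T hT1
    have hrect := Complex.integral_boundary_rect_eq_zero_of_differentiableOn R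
      (⟨a, -T⟩ : ℂ) ⟨b, T⟩ (fun s hs => by
        rw [Complex.mem_reProdIm, Set.uIcc_of_le hab] at hs
        exact (hR s hs.1.1 hs.1.2).differentiableWithinAt)
    have hor : ∀ y : ℝ, |y| = T → ‖∫ u in a..b, R (u + y * I)‖ ≤ M / T * |b - a| := fun y hy => by
      refine intervalIntegral.norm_integral_le_of_norm_le_const fun u hu => ?_
      rw [Set.uIoc_of_le hab] at hu
      have := hM (u + y * I) (by simpa using hu.1.le) (by simpa using hu.2) (by simpa [hy])
      simpa [hy] using this
    have h1 := hor (-T) (by rw [abs_neg, abs_of_pos (by linarith)])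
    have h2 := hor T (abs_of_pos (by linarith))
    set A := ∫ u in a..b, R (u + (-T : ℝ) * I)
    set B := ∫ u in a..b, R (u + T * I)
    have e : (∫ t in -T..T, R (b + t * I)) - ∫ t in -T..T, R (a + t * I) = I * (A - B) := by
      simp only [smul_eq_mul] at hrect
      linear_combination (-I) * hrect + ((∫ t in -T..T, R (b + t * I)) -
        ∫ t in -T..T, R (a + t * I)) * Complex.I_sq
    rw [e, norm_mul, Complex.norm_I, one_mul]
    calc ‖A - B‖ ≤ ‖A‖ + ‖B‖ := norm_sub_le _ _
      _ ≤ _ := by linarith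
  have := tendsto_nhds_unique (lb.sub la) hz
  exact (sub_eq_zero.mp this).symm

lemma ofReal_add_mul_I_ne_zero {c : ℝ} (hc : c ≠ 0) (t : ℝ) : (c + t * I : ℂ) ≠ 0 := by
  intro h
  have := congrArg Complex.re h
  simp at this
  exact hc this

lemma norm_inv_sq_le {c : ℝ} (hc0 : c ≠ 0) (hc : |c| ≤ 1) (t : ℝ) :
    ‖((c + t * I : ℂ) ^ 2)⁻¹‖ ≤ (2 / |c|) ^ 2 * (1 + |t|) ^ (-2 : ℝ) := by
  have h := norm_inv_le_of_re_ne_zero hc0 hc t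
  rw [norm_inv, norm_pow, ← inv_pow, Real.rpow_neg (by positivity), Real.rpow_two, ← inv_pow,
    ← mul_pow]
  gcongr

lemma integrable_inv_sq {c : ℝ} (hc0 : c ≠ 0) (hc : |c| ≤ 1) :
    Integrable fun t : ℝ => ((c + t * I : ℂ) ^ 2)⁻¹ := by
  refine ((integrable_one_add_abs_rpow one_lt_two).const_mul ((2 / |c|) ^ 2)).mono' ?_
    (Eventually.of_forall fun t => norm_inv_sq_le hc0 hc t)
  refine Continuous.aestronglyMeasurable ?_
  exact Continuous.inv₀ (by fun_prop) fun t => pow_ne_zero 2 (ofReal_add_mul_I_ne_zero hc0 t)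

lemma integral_inv_sq {c : ℝ} (hc0 : c ≠ 0) (hc : |c| ≤ 1) :
    ∫ t : ℝ, ((c + t * I : ℂ) ^ 2)⁻¹ = 0 := by
  have hl : ∀ l : Filter ℝ, Tendsto (fun t : ℝ => |t|) l atTop →
      Tendsto (fun t : ℝ => I * (c + t * I : ℂ)⁻¹) l (𝓝 0) := fun l hl => by
    refine squeeze_zero_norm (a := fun t => 2 / |c| * (1 + |t|)⁻¹) (fun t => ?_) ?_
    · rw [norm_mul, Complex.norm_I, one_mul, norm_inv]
      exact norm_inv_le_of_re_ne_zero hc0 hc t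
    · simpa using (tendsto_inv_atTop_zero.comp
        (tendsto_atTop_add_const_left l (1 : ℝ) hl)).const_mul (2 / |c|)
  have h := integral_of_hasDerivAt_of_tendsto (f := fun t : ℝ => I * (c + t * I : ℂ)⁻¹)
    (f' := fun t : ℝ => ((c + t * I : ℂ) ^ 2)⁻¹) (fun t => ?_) (integrable_inv_sq hc0 hc)
    (hl _ tendsto_abs_atBot_atTop) (hl _ tendsto_abs_atTop_atTop)
  · simpa using h
  · have h1 : HasDerivAt (fun t : ℝ => (c + t * I : ℂ)) I t := by
      simpa using ((Complex.ofRealCLM.hasDerivAt (x := t)).mul_const I).const_add (c : ℂ)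
    refine ((h1.inv (ofReal_add_mul_I_ne_zero hc0 t)).const_mul I).congr_deriv ?_
    have := pow_ne_zero 2 (ofReal_add_mul_I_ne_zero hc0 t)
    field_simp
    rw [Complex.I_sq]
    ring

lemma integrable_inv_mul_add_one {c : ℝ} (hc0 : 0 < c) (hc : c ≤ 1) :
    Integrable fun t : ℝ => ((c + t * I : ℂ) * (c + t * I + 1))⁻¹ := by
  refine (integrable_rieszKernel_div one_ne_zero hc0 hc).congr (Eventually.of_forall fun t => ?_)
  simp [rieszKernel, div_eq_mul_inv]

lemma integral_inv_mul_add_one {c : ℝ} (hc0 : 0 < c) (hc : c ≤ 1) :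
    ∫ t : ℝ, ((c + t * I : ℂ) * (c + t * I + 1))⁻¹ = 0 := by
  have h := integral_rieszKernel one_ne_zero hc0 hc one_pos
  rw [rieszWeight_of_one_le one_ne_zero le_rfl] at h
  simpa [rieszKernel, div_eq_mul_inv, mul_comm] using h

lemma neg_half_mul_add_one (t : ℝ) :
    ((((-(1 / 2) : ℝ) : ℂ) + t * I) * (((-(1 / 2) : ℝ) : ℂ) + t * I + 1))⁻¹ =
      ((-4 * (1 + (2 * t) ^ 2)⁻¹ : ℝ) : ℂ) := by
  have h : (((-(1 / 2) : ℝ) : ℂ) + t * I) * (((-(1 / 2) : ℝ) : ℂ) + t * I + 1) =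
      ((-((1 + (2 * t) ^ 2) / 4) : ℝ) : ℂ) := by
    push_cast
    linear_combination (t : ℂ) ^ 2 * Complex.I_sq
  rw [h, ← Complex.ofReal_inv, inv_neg, inv_div]
  congr 1
  ring

lemma integrable_neg_half_inv_mul_add_one :
    Integrable fun t : ℝ =>
      ((((-(1 / 2) : ℝ) : ℂ) + t * I) * (((-(1 / 2) : ℝ) : ℂ) + t * I + 1))⁻¹ := by
  simp only [neg_half_mul_add_one]
  exact ((integrable_inv_one_add_sq.comp_mul_left' two_ne_zero).const_mul (-4)).ofReal

lemma integral_neg_half_inv_mul_add_one :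
    ∫ t : ℝ, ((((-(1 / 2) : ℝ) : ℂ) + t * I) * (((-(1 / 2) : ℝ) : ℂ) + t * I + 1))⁻¹ =
      -(2 * Real.pi) := by
  simp only [neg_half_mul_add_one]
  rw [integral_complex_ofReal, integral_const_mul,
    Measure.integral_comp_mul_left (fun y : ℝ => (1 + y ^ 2)⁻¹) 2, integral_univ_inv_one_add_sq,
    abs_of_pos (by norm_num), smul_eq_mul]
  push_cast
  ring

/-- Moving the contour past the double pole of `P s / s ^ 2` at the origin. -/
lemma integral_div_sq_sub {δ M : ℝ} (hδ0 : 0 < δ) (hδ : δ ≤ 1) {P : ℂ → ℂ}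
    (hP : DifferentiableOn ℂ P {s | -1 < s.re})
    (hM : ∀ s : ℂ, -(1 / 2) ≤ s.re → s.re ≤ δ → ‖P s‖ ≤ M * (1 + |s.im|))
    (h1 : Integrable fun t : ℝ => P ((-(1 / 2) : ℝ) + t * I) / ((-(1 / 2) : ℝ) + t * I) ^ 2)
    (h2 : Integrable fun t : ℝ => P (δ + t * I) / (δ + t * I) ^ 2) :
    (∫ t : ℝ, P (δ + t * I) / (δ + t * I) ^ 2) -
      ∫ t : ℝ, P ((-(1 / 2) : ℝ) + t * I) / ((-(1 / 2) : ℝ) + t * I) ^ 2 =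
      2 * Real.pi * deriv P 0 := by
  have hopen : IsOpen {s : ℂ | -1 < s.re} := isOpen_lt continuous_const Complex.continuous_re
  have h0 : {s : ℂ | -1 < s.re} ∈ 𝓝 (0 : ℂ) := hopen.mem_nhds (show -1 < (0 : ℂ).re by simp)
  set d := deriv P 0 with hd
  set P₂ := dslope (dslope P 0) 0 with hP₂
  have hdP₂ : DifferentiableOn ℂ P₂ {s | -1 < s.re} :=
    (Complex.differentiableOn_dslope h0).mpr ((Complex.differentiableOn_dslope h0).mpr hP)
  set R : ℂ → ℂ := fun s => P₂ s + d * (s + 1)⁻¹ with hRdef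
  have hR : ∀ s : ℂ, s ≠ 0 → -1 < s.re →
      R s = P s / s ^ 2 - P 0 * (s ^ 2)⁻¹ - d * (s * (s + 1))⁻¹ := fun s hs hre => by
    have hs1 : s + 1 ≠ 0 := by simpa using add_natCast_add_one_ne_zero hre 0
    simp only [hRdef, hP₂]
    rw [dslope_of_ne _ hs, slope_def_field, dslope_same, dslope_of_ne _ hs, slope_def_field, ← hd,
      sub_zero]
    field_simp
    ring
  have hM0 : 0 ≤ M := by
    have := hM 0 (by simp) (by simpa using hδ0.le)
    simp at this
    exact (norm_nonneg _).trans this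
  have hline : ∀ c : ℝ, -1 < c → c ≠ 0 → ∀ t : ℝ, R (c + t * I) =
      P (c + t * I) / (c + t * I) ^ 2 - P 0 * ((c + t * I : ℂ) ^ 2)⁻¹ -
        d * ((c + t * I : ℂ) * (c + t * I + 1))⁻¹ := fun c hc hc0 t =>
    hR _ (ofReal_add_mul_I_ne_zero hc0 t) (by simpa using hc)
  have hn0 : (-(1 / 2) : ℝ) ≠ 0 := by norm_num
  have hn1 : |(-(1 / 2) : ℝ)| ≤ 1 := by norm_num [abs_le]
  have hδ' : |δ| ≤ 1 := by rwa [abs_of_pos hδ0]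
  have i1 := ((integrable_inv_sq hn0 hn1).const_mul (P 0))
  have i2 := ((integrable_inv_sq hδ0.ne' hδ').const_mul (P 0))
  have j1 := integrable_neg_half_inv_mul_add_one.const_mul d
  have j2 := (integrable_inv_mul_add_one hδ0 hδ).const_mul d
  have k1 : Integrable fun t : ℝ => P ((-(1 / 2) : ℝ) + t * I) / ((-(1 / 2) : ℝ) + t * I) ^ 2 -
      P 0 * ((((-(1 / 2) : ℝ) : ℂ) + t * I) ^ 2)⁻¹ := h1.sub i1
  have k2 : Integrable fun t : ℝ => P (δ + t * I) / (δ + t * I) ^ 2 -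
      P 0 * ((δ + t * I : ℂ) ^ 2)⁻¹ := h2.sub i2
  have key := integral_vertical_eq (a := -(1 / 2)) (b := δ)
    (M := 2 * M + ‖P 0‖ + ‖d‖) (by linarith) (R := R) (fun s hs _ => ?_) (fun s hs hs' ht => ?_)
    ?_ ?_
  · simp only [hline _ (by norm_num : (-1 : ℝ) < -(1 / 2)) hn0,
      hline δ (by linarith) hδ0.ne'] at key
    rw [integral_sub k1 j1, integral_sub h1 i1, integral_sub k2 j2,
      integral_sub h2 i2] at key
    simp only [integral_const_mul] at key
    rw [integral_inv_sq hn0 hn1, integral_inv_sq hδ0.ne' hδ', integral_neg_half_inv_mul_add_one,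
      integral_inv_mul_add_one hδ0 hδ] at key
    linear_combination -key
  · have hre : -1 < s.re := by linarith
    have hs1 : s + 1 ≠ 0 := by simpa using add_natCast_add_one_ne_zero hre 0
    exact ((hdP₂ s hre).differentiableAt (hopen.mem_nhds hre)).add
      ((differentiableAt_const d).mul (DifferentiableAt.inv (by fun_prop) hs1))
  · have hre : -1 < s.re := by linarith
    have htpos : 0 < |s.im| := by linarith
    have hs0 : s ≠ 0 := by
      rintro rfl
      simp at htpos
    have n1 : |s.im| ≤ ‖s‖ := Complex.abs_im_le_norm s
    have n2 : |s.im| ≤ ‖s + 1‖ := by simpa using Complex.abs_im_le_norm (s + 1)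
    have b1 : ‖P s / s ^ 2‖ ≤ 2 * M / |s.im| := by
      rw [norm_div, norm_pow, div_le_div_iff₀ (by positivity) htpos]
      calc ‖P s‖ * |s.im| ≤ M * (1 + |s.im|) * |s.im| := by
            gcongr
            exact hM s hs hs'
        _ ≤ M * (|s.im| + |s.im|) * |s.im| := by gcongr
        _ = 2 * M * |s.im| ^ 2 := by ring
        _ ≤ 2 * M * ‖s‖ ^ 2 := by gcongr
    have b2 : ‖P 0 * (s ^ 2)⁻¹‖ ≤ ‖P 0‖ / |s.im| := by
      rw [norm_mul, norm_inv, norm_pow, ← div_eq_mul_inv]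
      gcongr
      nlinarith
    have b3 : ‖d * (s * (s + 1))⁻¹‖ ≤ ‖d‖ / |s.im| := by
      rw [norm_mul, norm_inv, norm_mul, ← div_eq_mul_inv]
      gcongr
      nlinarith [norm_nonneg s, norm_nonneg (s + 1)]
    rw [hR s hs0 hre]
    calc _ ≤ ‖P s / s ^ 2‖ + ‖P 0 * (s ^ 2)⁻¹‖ + ‖d * (s * (s + 1))⁻¹‖ :=
          (norm_sub_le _ _).trans (add_le_add_left (norm_sub_le _ _) _)
      _ ≤ 2 * M / |s.im| + ‖P 0‖ / |s.im| + ‖d‖ / |s.im| := by gcongr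
      _ = _ := by ring
  · simp only [hline _ (by norm_num : (-1 : ℝ) < -(1 / 2)) hn0]
    exact k1.sub j1
  · simp only [hline δ (by linarith) hδ0.ne']
    exact k2.sub j2

end VerticalContours

section Perron

open MeasureTheory

variable (K) in
lemma countable_nonzero_ideals : Countable {J : Ideal (𝓞 K) // J ≠ ⊥} := by
  rw [← Set.countable_univ_iff]
  refine (summable_absNorm_rpow K one_lt_two).countable_support.mono fun 𝔫 _ => ?_
  exact (Real.rpow_pos_of_pos (absNorm_pos' 𝔫) _).ne'

variable (K) in
/-- Perron's formula for the Riesz means of the coefficients of `ζ_K`. -/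
lemma integral_zetaSer_mul_rieszKernel {n : ℕ} (hn : n ≠ 0) {x c : ℝ} (hx : 0 < x) (hc0 : 0 < c)
    (hc : c ≤ 1) :
    ∫ t : ℝ, zetaSer K (c + t * I + 1) * (x : ℂ) ^ (c + t * I : ℂ) *
        (rieszKernel n (c + t * I) / (c + t * I)) =
      2 * Real.pi * ((∑' 𝔫 : {J : Ideal (𝓞 K) // J ≠ ⊥},
        1 / (Ideal.absNorm 𝔫.1 : ℝ) * rieszWeight n (Ideal.absNorm 𝔫.1 / x) : ℝ) : ℂ) := by
  have := countable_nonzero_ideals K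
  set g : ℝ → ℂ := fun t => rieszKernel n (c + t * I) / (c + t * I) with hg
  have ig : Integrable g := integrable_rieszKernel_div hn hc0 hc
  set u : {J : Ideal (𝓞 K) // J ≠ ⊥} → ℝ := fun 𝔫 => Ideal.absNorm 𝔫.1 / x with hu
  have hu0 : ∀ 𝔫, 0 < u 𝔫 := fun 𝔫 => div_pos (absNorm_pos' 𝔫) hx
  set F : {J : Ideal (𝓞 K) // J ≠ ⊥} → ℝ → ℂ := fun 𝔫 t =>
    ((1 / (Ideal.absNorm 𝔫.1 : ℝ) : ℝ) : ℂ) * ((u 𝔫 : ℂ) ^ (-(c + t * I : ℂ)) * g t) with hF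
  have hnF : ∀ 𝔫 t, ‖F 𝔫 t‖ = x ^ c * (Ideal.absNorm 𝔫.1 : ℝ) ^ (-(c + 1)) * ‖g t‖ := fun 𝔫 t => by
    have hN := absNorm_pos' 𝔫
    rw [hF]
    simp only
    rw [norm_mul, norm_mul, Complex.norm_cpow_eq_rpow_re_of_pos (hu0 𝔫), Complex.norm_real,
      Real.norm_of_nonneg (by positivity)]
    have : (-(c + t * I : ℂ)).re = -c := by simp
    rw [this, hu]
    simp only
    rw [Real.div_rpow hN.le hx.le, neg_add, Real.rpow_add hN, Real.rpow_neg_one,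
      Real.rpow_neg hx.le]
    field_simp
  have hiF : ∀ 𝔫, Integrable (F 𝔫) := fun 𝔫 => by
    refine (ig.norm.const_mul (x ^ c * (Ideal.absNorm 𝔫.1 : ℝ) ^ (-(c + 1)))).mono' ?_
      (Eventually.of_forall fun t => (hnF 𝔫 t).le)
    refine AEStronglyMeasurable.const_mul (AEStronglyMeasurable.mul ?_ ig.aestronglyMeasurable) _
    refine Continuous.aestronglyMeasurable ?_
    exact Continuous.const_cpow (by fun_prop) (Or.inl (by exact_mod_cast (hu0 𝔫).ne'))
  have hsum := hasSum_integral_of_summable_integral_norm hiF (by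
    simp only [hnF, integral_const_mul]
    exact ((summable_absNorm_rpow K (by linarith : 1 < c + 1)).mul_left _).mul_right _)
  have e1 : ∀ t : ℝ, ∑' 𝔫, F 𝔫 t =
      zetaSer K (c + t * I + 1) * (x : ℂ) ^ (c + t * I : ℂ) * g t := fun t => by
    rw [zetaSer, ← tsum_mul_right, ← tsum_mul_right]
    refine tsum_congr fun 𝔫 => ?_
    have hN := absNorm_pos' 𝔫
    have hN' : (Ideal.absNorm 𝔫.1 : ℂ) ≠ 0 := by exact_mod_cast hN.ne'
    have hux : (u 𝔫 : ℂ) = ((Ideal.absNorm 𝔫.1 : ℝ) : ℂ) * ((x⁻¹ : ℝ) : ℂ) := by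
      rw [hu]
      push_cast
      rw [div_eq_mul_inv]
    have hxs : ((x⁻¹ : ℝ) : ℂ) ^ (-(c + t * I : ℂ)) = (x : ℂ) ^ (c + t * I : ℂ) := by
      rw [Complex.ofReal_inv, Complex.inv_cpow _ _ (by
        rw [Complex.arg_ofReal_of_nonneg hx.le]
        exact Real.pi_ne_zero.symm), Complex.cpow_neg, inv_inv]
    rw [hF]
    simp only
    rw [hux, Complex.mul_cpow_ofReal_nonneg hN.le (inv_pos.mpr hx).le, hxs,
      neg_add (c + t * I : ℂ) 1, Complex.cpow_add _ _ hN', Complex.cpow_neg_one]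
    push_cast
    ring
  simp only [e1] at hsum
  rw [← hsum.tsum_eq]
  have e2 : ∀ 𝔫, ∫ t, F 𝔫 t = 2 * Real.pi *
      ((1 / (Ideal.absNorm 𝔫.1 : ℝ) * rieszWeight n (u 𝔫) : ℝ) : ℂ) := fun 𝔫 => by
    rw [hF]
    simp only
    rw [integral_const_mul, hg, integral_rieszKernel hn hc0 hc (hu0 𝔫)]
    push_cast
    ring
  simp only [e2]
  rw [tsum_mul_left, Complex.ofReal_tsum]

variable (K) in
lemma integrable_zetaSer_mul_rieszKernel {n : ℕ} (hn : n ≠ 0) {x c : ℝ} (hx : 0 < x) (hc0 : 0 < c)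
    (hc : c ≤ 1) :
    Integrable fun t : ℝ => zetaSer K (c + t * I + 1) * (x : ℂ) ^ (c + t * I : ℂ) *
      (rieszKernel n (c + t * I) / (c + t * I)) := by
  refine (integrable_rieszKernel_div hn hc0 hc).bdd_mul (c := zetaReal (c + 1) ^ nK K * x ^ c)
    (Continuous.aestronglyMeasurable ?_) (Eventually.of_forall fun t => ?_)
  · refine Continuous.mul ?_
      (Continuous.const_cpow (by fun_prop) (Or.inl (by exact_mod_cast hx.ne')))
    refine (differentiableOn_zetaSer K).continuousOn.comp_continuous (by fun_prop) fun t => ?_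
    show 1 < (c + t * I + 1 : ℂ).re
    simpa using hc0
  · have h := norm_zetaSer_le K (s := c + t * I + 1) (by simpa using hc0)
    rw [norm_mul, Complex.norm_cpow_eq_rpow_re_of_pos hx]
    simp only [add_re, ofReal_re, mul_re, I_re, mul_zero, ofReal_im, I_im, mul_one, sub_self,
      add_zero, one_re] at h ⊢
    gcongr

variable (K) in
lemma tsum_rieszWeight {n : ℕ} (hn : n ≠ 0) {x : ℝ} (hx : 0 < x) :
    ∑' 𝔫 : {J : Ideal (𝓞 K) // J ≠ ⊥},
        1 / (Ideal.absNorm 𝔫.1 : ℝ) * rieszWeight n (Ideal.absNorm 𝔫.1 / x) =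
      ∑' 𝔫 : {J : Ideal (𝓞 K) // J ≠ ⊥ ∧ (Ideal.absNorm J : ℝ) ≤ x},
        (1 / (Ideal.absNorm 𝔫.1 : ℝ)) * (1 - (Ideal.absNorm 𝔫.1 : ℝ) / x) ^ n := by
  let ι : {J : Ideal (𝓞 K) // J ≠ ⊥ ∧ (Ideal.absNorm J : ℝ) ≤ x} →
    {J : Ideal (𝓞 K) // J ≠ ⊥} := fun 𝔫 => ⟨𝔫.1, 𝔫.2.1⟩
  have hι : Function.Injective ι := fun 𝔪 𝔫 h => Subtype.ext
    (congrArg (fun 𝔮 : {J : Ideal (𝓞 K) // J ≠ ⊥} => 𝔮.1) h)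
  rw [← hι.tsum_eq]
  · refine tsum_congr fun 𝔫 => ?_
    rw [rieszWeight_of_le_one n ((div_le_one hx).mpr 𝔫.2.2)]
  · intro 𝔫 h𝔫
    by_contra hc
    refine h𝔫 ?_
    have : 1 ≤ (Ideal.absNorm 𝔫.1 : ℝ) / x := by
      rw [one_le_div hx]
      by_contra! hlt
      exact hc ⟨⟨𝔫.1, 𝔫.2, hlt.le⟩, rfl⟩
    simp only [rieszWeight_of_one_le hn this, mul_zero]

lemma eq_residue_and_deriv_eq {z : ℂ → ℂ} (hz : Differentiable ℂ z)
    (hzs : ∀ s : ℂ, 0 < s.re → z s = s * zetaSer K (s + 1)) {κ γ : ℝ} (hκ : IsResidue K κ)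
    (hγ : IsEulerKronecker K κ γ) : z 0 = κ ∧ deriv z 0 = ((κ * γ : ℝ) : ℂ) := by
  have hval : ∀ σ : ℝ, 1 < σ → z ((σ - 1 : ℝ) : ℂ) = (((σ - 1) *
      ∑' 𝔞 : {J : Ideal (𝓞 K) // J ≠ ⊥}, (Ideal.absNorm 𝔞.1 : ℝ) ^ (-σ) : ℝ) : ℂ) := fun σ hσ => by
    have e : ((σ - 1 : ℝ) : ℂ) + 1 = (σ : ℂ) := by
      push_cast
      ring
    rw [hzs _ (by rw [Complex.ofReal_re]; linarith), e, zetaSer_ofReal K σ, ← Complex.ofReal_mul]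
  have hlim : Tendsto (fun σ : ℝ => ((σ - 1 : ℝ) : ℂ)) (𝓝[>] 1) (𝓝[≠] 0) := by
    refine tendsto_nhdsWithin_iff.mpr ⟨?_, ?_⟩
    · have : Continuous fun σ : ℝ => ((σ - 1 : ℝ) : ℂ) := by fun_prop
      have h := this.tendsto 1
      simp only [sub_self, Complex.ofReal_zero] at h
      exact h.mono_left nhdsWithin_le_nhds
    · filter_upwards [self_mem_nhdsWithin] with σ hσ
      have hσ' : (1 : ℝ) < σ := hσ
      exact Complex.ofReal_ne_zero.mpr (by linarith)
  have h0 : z 0 = κ := by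
    refine tendsto_nhds_unique (hz.continuous.continuousAt.tendsto.comp
      (hlim.mono_right nhdsWithin_le_nhds)) (((Complex.continuous_ofReal.tendsto κ).comp hκ).congr' ?_)
    filter_upwards [self_mem_nhdsWithin] with σ hσ
    exact (hval σ hσ).symm
  refine ⟨h0, ?_⟩
  have hs := (hasDerivAt_iff_tendsto_slope.mp (hz 0).hasDerivAt).comp hlim
  refine tendsto_nhds_unique hs (((Complex.continuous_ofReal.tendsto _).comp hγ).congr' ?_)
  filter_upwards [self_mem_nhdsWithin] with σ hσ
  have hσ' : (1 : ℝ) < σ := hσ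
  have hne : (σ - 1 : ℝ) ≠ 0 := by linarith
  simp only [Function.comp_apply]
  rw [slope_def_field, hval σ hσ, h0, sub_zero, ← Complex.ofReal_sub, ← Complex.ofReal_div]
  congr 1
  field_simp

end Perron

section RieszMeans

open MeasureTheory

variable (K) in
lemma one_le_nK_pow_mul_DK : (1 : ℝ) ≤ (nK K : ℝ) ^ nK K * DK K := by
  have h1 : (1 : ℝ) ≤ nK K := by exact_mod_cast nK_pos (K := K)
  exact one_le_mul_of_one_le_of_one_le (one_le_pow₀ h1) (one_le_DK K)

/-- Bound for the integrand of the Riesz mean on the line `Re s = -1/2`. -/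
lemma norm_mul_rieszKernel_le {δ C : ℝ} (hδ0 : 0 < δ) (hδ : δ ≤ 1 / 8) (hC : 1 ≤ C) {z : ℂ → ℂ}
    (hz : ∀ s : ℂ, s.re = -(1 / 2) → ‖z s‖ ≤ C ^ nK K * (1 + |s.im|) *
      ((DK K : ℝ) * (1 + |s.im|) ^ nK K) ^ (1 / 4 + δ / 2)) {s : ℂ} (hs : s.re = -(1 / 2)) :
    ‖z s * rieszKernel (nK K) s‖ ≤ (4 * C) ^ nK K *
      ((nK K : ℝ) ^ nK K * DK K) ^ (1 / 4 + δ / 2 + δ) * (1 + |s.im|) ^ (1 - δ) := by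
  set n := nK K with hn
  set T := 1 + |s.im| with hT
  have hT1 : 1 ≤ T := by simp [hT]
  have hT0 : 0 < T := by linarith
  have hD := one_le_DK K
  have hn1 : (1 : ℝ) ≤ n := by exact_mod_cast nK_pos (K := K)
  have h1 := hz s hs
  have h2 := norm_rieszKernel_le n (a := 1 / 4 + δ / 2 + δ) (by linarith) (by linarith)
    (s := s) hs.ge
  rw [← hT] at h1 h2
  set α := 1 / 4 + δ / 2 with hα
  have hα0 : 0 < α := by positivity
  have hfac : (n.factorial : ℝ) ≤ (n : ℝ) ^ n := by exact_mod_cast Nat.factorial_le_pow n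
  have hpow : (T ^ n) ^ α * (T ^ (α + δ))⁻¹ ^ n ≤ T ^ (-δ) := by
    have e1 : (T ^ n) ^ α = T ^ (n * α) := by
      rw [← Real.rpow_natCast, ← Real.rpow_mul hT0.le]
    have e2 : (T ^ (α + δ))⁻¹ ^ n = T ^ (-(n * (α + δ))) := by
      rw [← Real.rpow_neg hT0.le, ← Real.rpow_natCast, ← Real.rpow_mul hT0.le]
      congr 1
      ring
    rw [e1, e2, ← Real.rpow_add hT0]
    refine Real.rpow_le_rpow_of_exponent_le hT1 ?_
    nlinarith
  rw [norm_mul]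
  calc ‖z s‖ * ‖rieszKernel n s‖
      ≤ (C ^ n * T * ((DK K : ℝ) * T ^ n) ^ α) *
        (4 ^ n * (n.factorial : ℝ) ^ (α + δ) * (T ^ (α + δ))⁻¹ ^ n) :=
        mul_le_mul h1 h2 (norm_nonneg _) (by positivity)
    _ = (4 * C) ^ n * ((n.factorial : ℝ) ^ (α + δ) * (DK K : ℝ) ^ α) * T *
        ((T ^ n) ^ α * (T ^ (α + δ))⁻¹ ^ n) := by
        rw [Real.mul_rpow (by linarith) (by positivity), mul_pow]
        ring
    _ ≤ (4 * C) ^ n * (((n : ℝ) ^ n) ^ (α + δ) * (DK K : ℝ) ^ (α + δ)) * T * T ^ (-δ) := by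
        have : (DK K : ℝ) ^ α ≤ (DK K : ℝ) ^ (α + δ) :=
          Real.rpow_le_rpow_of_exponent_le hD (by linarith)
        gcongr
    _ = _ := by
        rw [Real.mul_rpow (by positivity) (by positivity), mul_assoc _ T, sub_eq_add_neg,
          Real.rpow_add hT0, Real.rpow_one]

/-- The error term in the asymptotic formula for the Riesz mean is an integral over the line
`Re s = -1/2`. -/
lemma norm_integral_error_le {δ C x : ℝ} (hδ0 : 0 < δ) (hδ : δ ≤ 1 / 8) (hC : 1 ≤ C) (hx : 0 < x)
    {z : ℂ → ℂ} (hzd : Differentiable ℂ z)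
    (hz : ∀ s : ℂ, s.re = -(1 / 2) → ‖z s‖ ≤ C ^ nK K * (1 + |s.im|) *
      ((DK K : ℝ) * (1 + |s.im|) ^ nK K) ^ (1 / 4 + δ / 2)) :
    Integrable (fun t : ℝ => z ((-(1 / 2) : ℝ) + t * I) *
      rieszKernel (nK K) ((-(1 / 2) : ℝ) + t * I) * (x : ℂ) ^ (((-(1 / 2) : ℝ) : ℂ) + t * I) /
        ((-(1 / 2) : ℝ) + t * I) ^ 2) ∧
    ‖∫ t : ℝ, z ((-(1 / 2) : ℝ) + t * I) *
      rieszKernel (nK K) ((-(1 / 2) : ℝ) + t * I) * (x : ℂ) ^ (((-(1 / 2) : ℝ) : ℂ) + t * I) /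
        ((-(1 / 2) : ℝ) + t * I) ^ 2‖ ≤
      (4 * C) ^ nK K * ((nK K : ℝ) ^ nK K * DK K) ^ (1 / 4 + δ / 2 + δ) * x ^ (-(1 : ℝ) / 2) *
        16 * ∫ t : ℝ, (1 + |t|) ^ (-(1 + δ)) := by
  have hn0 : (-(1 / 2) : ℝ) ≠ 0 := by norm_num
  have hn1 : |(-(1 / 2) : ℝ)| ≤ 1 := by norm_num [abs_le]
  set A := (4 * C) ^ nK K * ((nK K : ℝ) ^ nK K * DK K) ^ (1 / 4 + δ / 2 + δ) with hA
  have hA0 : 0 ≤ A := by positivity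
  have h_int := (integrable_one_add_abs_rpow (by linarith : 1 < 1 + δ)).const_mul
    (A * x ^ (-(1 : ℝ) / 2) * 16)
  have hb : ∀ t : ℝ, ‖z ((-(1 / 2) : ℝ) + t * I) *
      rieszKernel (nK K) ((-(1 / 2) : ℝ) + t * I) * (x : ℂ) ^ (((-(1 / 2) : ℝ) : ℂ) + t * I) /
        ((-(1 / 2) : ℝ) + t * I) ^ 2‖ ≤
      A * x ^ (-(1 : ℝ) / 2) * 16 * (1 + |t|) ^ (-(1 + δ)) := fun t => by
    have hT0 : (0 : ℝ) < 1 + |t| := by positivity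
    have hre : (((-(1 / 2) : ℝ) : ℂ) + t * I).re = -(1 / 2) := by simp
    have him : (((-(1 / 2) : ℝ) : ℂ) + t * I).im = t := by simp
    have h1 := norm_mul_rieszKernel_le hδ0 hδ hC hz hre
    have h2 := norm_inv_sq_le hn0 hn1 t
    rw [him, ← hA] at h1
    rw [div_eq_mul_inv, norm_mul, norm_mul, Complex.norm_cpow_eq_rpow_re_of_pos hx, hre]
    calc _ ≤ A * (1 + |t|) ^ (1 - δ) * x ^ (-(1 / 2) : ℝ) *
          ((2 / |(-(1 / 2) : ℝ)|) ^ 2 * (1 + |t|) ^ (-2 : ℝ)) := by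
          gcongr
      _ = _ := by
          have e : (1 + |t|) ^ (-(1 + δ)) = (1 + |t|) ^ (1 - δ) * (1 + |t|) ^ (-2 : ℝ) := by
            rw [← Real.rpow_add hT0]
            congr 1
            ring
          have e2 : (2 / |(-(1 / 2) : ℝ)|) ^ 2 = 16 := by
            rw [abs_neg, abs_of_pos (by norm_num)]
            norm_num
          have e3 : (-(1 / 2) : ℝ) = -1 / 2 := by norm_num
          rw [e, e2, e3]
          ring
  refine ⟨h_int.mono' (Continuous.aestronglyMeasurable ?_) (Eventually.of_forall hb), ?_⟩
  · have hv : Continuous fun t : ℝ => rieszKernel (nK K) ((-(1 / 2) : ℝ) + t * I) := by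
      refine continuous_iff_continuousAt.mpr fun t => ?_
      exact (differentiableAt_rieszKernel (nK K) (s := ((-(1 / 2) : ℝ) : ℂ) + t * I)
        (by simp; norm_num)).continuousAt.comp
        (f := fun t : ℝ => (((-(1 / 2) : ℝ) : ℂ) + t * I)) (by fun_prop)
    have hzc : Continuous fun t : ℝ => z ((-(1 / 2) : ℝ) + t * I) :=
      hzd.continuous.comp (by fun_prop)
    exact ((hzc.mul hv).mul (Continuous.const_cpow (by fun_prop)
      (Or.inl (by exact_mod_cast hx.ne')))).div (by fun_prop)
      fun t => pow_ne_zero 2 (ofReal_add_mul_I_ne_zero hn0 t)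
  · refine (norm_integral_le_of_norm_le h_int (Eventually.of_forall hb)).trans (le_of_eq ?_)
    rw [integral_const_mul]

/-- The contribution of the double pole at the origin. -/
lemma hasDerivAt_mul_rieszKernel_mul_cpow {x : ℝ} (hx : 0 < x) {z : ℂ → ℂ}
    (hzd : Differentiable ℂ z) {κ γ : ℝ} (hz0 : z 0 = κ) (hz0' : deriv z 0 = ((κ * γ : ℝ) : ℂ))
    (n : ℕ) :
    HasDerivAt (fun s => z s * rieszKernel n s * (x : ℂ) ^ s)
      ((κ * (Real.log x - ∑ j ∈ Finset.Icc 1 n, (1 : ℝ) / j) + κ * γ : ℝ) : ℂ) 0 := by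
  have hx' : (x : ℂ) ≠ 0 := by exact_mod_cast hx.ne'
  have h1 := (hzd 0).hasDerivAt
  have h2 := ((hasDerivAt_id (0 : ℂ)).const_cpow (c := (x : ℂ)) (Or.inl hx'))
  refine ((h1.mul (hasDerivAt_rieszKernel_zero n)).mul h2).congr_deriv ?_
  simp only [Pi.mul_apply, id, hz0, hz0', rieszKernel_zero, Complex.cpow_zero]
  push_cast [Complex.ofReal_log hx.le]
  ring

/-- Coarse growth of the integrand in the strip. -/
lemma norm_mul_rieszKernel_mul_cpow_le {δ M x : ℝ} (hx : 0 < x) (hM0 : 0 ≤ M) {z : ℂ → ℂ} {n : ℕ}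
    (hM : ∀ s : ℂ, -(1 / 2) ≤ s.re → s.re ≤ δ → ‖z s‖ ≤ M * (1 + |s.im|) ^ (n + 1)) {s : ℂ}
    (hs : -(1 / 2) ≤ s.re) (hs' : s.re ≤ δ) :
    ‖z s * rieszKernel n s * (x : ℂ) ^ s‖ ≤
      M * (4 ^ n * (n.factorial : ℝ)) * (x ^ (-(1 / 2) : ℝ) + x ^ δ) * (1 + |s.im|) := by
  have hT0 : (0 : ℝ) < 1 + |s.im| := by positivity
  have h1 := hM s hs hs'
  have h2 := norm_rieszKernel_le n zero_le_one le_rfl hs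
  simp only [Real.rpow_one] at h2
  have h3 : x ^ s.re ≤ x ^ (-(1 / 2) : ℝ) + x ^ δ := by
    rcases le_total 1 x with h | h
    · have := Real.rpow_le_rpow_of_exponent_le h hs'
      have := Real.rpow_nonneg hx.le (-(1 / 2))
      linarith
    · have := Real.rpow_le_rpow_of_exponent_ge hx h hs
      have := Real.rpow_nonneg hx.le δ
      linarith
  rw [norm_mul, norm_mul, Complex.norm_cpow_eq_rpow_re_of_pos hx]
  calc _ ≤ (M * (1 + |s.im|) ^ (n + 1)) * (4 ^ n * (n.factorial : ℝ) * (1 + |s.im|)⁻¹ ^ n) *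
        (x ^ (-(1 / 2) : ℝ) + x ^ δ) := by gcongr
    _ = _ := by
        rw [inv_pow, pow_succ]
        field_simp

end RieszMeans

/-- **Smoothed harmonic sum over ideals** (Lemma 2.8). For `x > 0` and `η > 0`,
`|Σ_{N𝔫 ≤ x} (1/N𝔫)(1 - N𝔫/x)^{n_K} - κ_K (log x - Σ_{j=1}^{n_K} 1/j) - κ_K γ_K|
  ≪ e^{O_η(n_K)} (n_K^{n_K} D_K)^{1/4+η} x^{-1/2}`. -/
theorem smoothed_harmonic_sum :
    ∀ η : ℝ, 0 < η →
    ∃ C₁ C₂ : ℝ, 0 < C₁ ∧ 0 < C₂ ∧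
      ∀ (K : Type) [Field K] [NumberField K] (κ γK x : ℝ),
        IsResidue K κ → IsEulerKronecker K κ γK → 0 < x →
        |(∑' 𝔫 : {I : Ideal (𝓞 K) // I ≠ ⊥ ∧ (Ideal.absNorm I : ℝ) ≤ x},
            (1 / (Ideal.absNorm 𝔫.1 : ℝ)) *
              (1 - (Ideal.absNorm 𝔫.1 : ℝ) / x) ^ (nK K)) -
          κ * (Real.log x - ∑ j ∈ Finset.Icc 1 (nK K), (1 : ℝ) / j) - κ * γK| ≤
          C₂ * Real.exp (C₁ * (nK K : ℝ)) *
            ((nK K : ℝ) ^ (nK K) * (DK K : ℝ)) ^ ((1 : ℝ) / 4 + η) *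
            x ^ (-(1 : ℝ) / 2) := by
  intro η hη
  set δ : ℝ := min η (1 / 4) / 2 with hδdef
  have hδ0 : 0 < δ := by positivity
  have hδη : δ ≤ η / 2 := by
    have := min_le_left η (1 / 4)
    linarith
  have hδ8 : δ ≤ 1 / 8 := by
    have := min_le_right η (1 / 4)
    linarith
  obtain ⟨C, hC, hall⟩ := exists_continuedZeta_bounds hδ0 (by linarith : δ ≤ 1 / 4)
  set J : ℝ := ∫ t : ℝ, (1 + |t|) ^ (-(1 + δ)) with hJ
  have hJ0 : 0 ≤ J := MeasureTheory.integral_nonneg fun t => by positivity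
  refine ⟨Real.log (4 * C), 16 * J + 1, Real.log_pos (by linarith), by positivity, ?_⟩
  intro K _ _ κ γ x hκ hγ hx
  obtain ⟨z, hzd, hzs, hz, M, hM0, hM⟩ := hall K
  obtain ⟨hz0, hz0'⟩ := eq_residue_and_deriv_eq hzd hzs hκ hγ
  have hn : nK K ≠ 0 := (nK_pos (K := K)).ne'
  obtain ⟨hi, hb⟩ := norm_integral_error_le hδ0 hδ8 hC hx hzd hz
  have hline : ∀ t : ℝ, z (δ + t * I) * rieszKernel (nK K) (δ + t * I) *
      (x : ℂ) ^ (δ + t * I : ℂ) / (δ + t * I) ^ 2 =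
      zetaSer K (δ + t * I + 1) * (x : ℂ) ^ (δ + t * I : ℂ) *
        (rieszKernel (nK K) (δ + t * I) / (δ + t * I)) := fun t => by
    have hne := ofReal_add_mul_I_ne_zero hδ0.ne' t
    rw [hzs _ (by simpa using hδ0)]
    field_simp
  have key := integral_div_sq_sub hδ0 (by linarith : δ ≤ 1)
    (P := fun s => z s * rieszKernel (nK K) s * (x : ℂ) ^ s)
    (fun s hs => (((hzd s).mul (differentiableAt_rieszKernel _ hs)).mul
      (differentiableAt_id.const_cpow (Or.inl (by exact_mod_cast hx.ne')))).differentiableWithinAt)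
    (fun s hs hs' => norm_mul_rieszKernel_mul_cpow_le hx hM0 hM hs hs') hi
    (by
      simp only [hline]
      exact integrable_zetaSer_mul_rieszKernel K hn hx hδ0 (by linarith))
  simp only [hline] at key
  rw [integral_zetaSer_mul_rieszKernel K hn hx hδ0 (by linarith), tsum_rieszWeight K hn hx,
    (hasDerivAt_mul_rieszKernel_mul_cpow hx hzd hz0 hz0' (nK K)).deriv] at key
  set S : ℝ := ∑' 𝔫 : {I : Ideal (𝓞 K) // I ≠ ⊥ ∧ (Ideal.absNorm I : ℝ) ≤ x},
    (1 / (Ideal.absNorm 𝔫.1 : ℝ)) * (1 - (Ideal.absNorm 𝔫.1 : ℝ) / x) ^ (nK K)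
  set L : ℝ := Real.log x - ∑ j ∈ Finset.Icc 1 (nK K), (1 : ℝ) / j
  have herr : ((2 * Real.pi * (S - κ * L - κ * γ) : ℝ) : ℂ) =
      ∫ t : ℝ, z ((-(1 / 2) : ℝ) + t * I) * rieszKernel (nK K) ((-(1 / 2) : ℝ) + t * I) *
        (x : ℂ) ^ (((-(1 / 2) : ℝ) : ℂ) + t * I) / ((-(1 / 2) : ℝ) + t * I) ^ 2 := by
    push_cast at key ⊢
    linear_combination key
  rw [← herr, Complex.norm_real, norm_mul, Real.norm_of_nonneg Real.two_pi_pos.le,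
    Real.norm_eq_abs, ← hJ] at hb
  have hB := one_le_nK_pow_mul_DK K
  have hexp : Real.exp (Real.log (4 * C) * nK K) = (4 * C) ^ nK K := by
    rw [Real.exp_mul, Real.exp_log (by linarith), Real.rpow_natCast]
  rw [hexp]
  calc |S - κ * L - κ * γ| ≤ 2 * Real.pi * |S - κ * L - κ * γ| :=
        le_mul_of_one_le_left (abs_nonneg _) (by linarith [Real.pi_gt_three])
    _ ≤ _ := hb
    _ ≤ (4 * C) ^ nK K * ((nK K : ℝ) ^ nK K * DK K) ^ (1 / 4 + η) * x ^ (-(1 : ℝ) / 2) *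
        (16 * J + 1) := by
        rw [mul_assoc _ (16 : ℝ)]
        have := Real.rpow_le_rpow_of_exponent_le hB (by linarith : 1 / 4 + δ / 2 + δ ≤ 1 / 4 + η)
        gcongr
        linarith
    _ = _ := by ring

end RTZ
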